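/- For every prime p, every positive integer e, and q = p^e, the p-adic valuation of the nonzero rational number h(GL_3(F_q)) equals e·3(q − 1)(q² − 2), where F_q denotes the finite field with q elements. -/

import Mathlib

/-- The set of pairs (χ, d) where χ is the character of an irreducible (simple) complex
representation of `G` and `d` is its degree. Distinct irreducible characters correspond to
distinct isomorphism classes, so this set is in bijection with `Irr(G)`. -/
noncomputable def irrCharDegSet (G : Type) [Group G] : Set ((G → ℂ) × ℕ) :=
  {p | ∃ V : FDRep ℂ G, CategoryTheory.Simple V ∧ p.1 = V.character ∧ p.2 = Module.finrank ℂ V}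

/-- `h(G)`: the product of the sizes of all conjugacy classes of `G` divided by the
product of the degrees of all irreducible complex characters of `G`. -/
noncomputable def groupH (G : Type) [Group G] : ℚ :=
  (∏ᶠ c : ConjClasses G, (c.carrier.ncard : ℚ)) / (∏ᶠ p ∈ irrCharDegSet G, (p.2 : ℚ))

open CategoryTheory

section CharacterTheory

set_option linter.unusedSectionVars false

variable {G : Type} [Group G] [Fintype G]

noncomputable instance invertibleCardComplex : Invertible (Nat.card G : ℂ) :=
  invertibleOfNonzero (by simp)

/-- The symmetric bilinear pairing on functions whose restriction to characters is the usual
scalar product. -/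
noncomputable def charPair (f g : G → ℂ) : ℂ :=
  (Nat.card G : ℂ)⁻¹ * ∑ x, f x * g x⁻¹

/-- Functions which are constant on conjugacy classes. -/
def IsClassFun (f : G → ℂ) : Prop := ∀ g h, f (h * g * h⁻¹) = f g

theorem finrank_pos_of_simple {V : FDRep ℂ G} (hV : Simple V) : 0 < Module.finrank ℂ V := by
  have h1 := (FDRep.simple_iff_char_is_norm_one V).1 hV
  by_contra hn
  have hn : Subsingleton V := (Module.finrank_zero_iff (R := ℂ)).1 (by omega)
  have : ∀ g, V.character g = 0 := fun g => by
    have : V.ρ g = 0 := Subsingleton.elim _ _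
    simp [FDRep.character, this]
  simp only [this, zero_mul, Finset.sum_const_zero] at h1
  exact (Nat.card_pos (α := G)).ne (Nat.cast_injective (R := ℂ) (by simpa using h1))

theorem FDRep.simple_iff_isIrreducible (V : FDRep ℂ G) :
    Simple V ↔ Representation.IsIrreducible (V.ρ : Representation ℂ G V) := by
  constructor
  · intro h
    have hnt : Nontrivial V := Module.nontrivial_of_finrank_pos (finrank_pos_of_simple h)
    refine { exists_pair_ne := ⟨⊥, ⊤, fun h0 => ?_⟩, eq_bot_or_eq_top := fun W => ?_ }
    · obtain ⟨v, hv⟩ := exists_ne (0 : V)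
      have : v ∈ (⊤ : Subrepresentation (V.ρ : Representation ℂ G V)).toSubmodule :=
        Submodule.mem_top
      rw [← h0] at this
      exact hv ((Submodule.mem_bot ℂ).1 this)
    · by_cases hW : W = ⊥
      · exact Or.inl hW
      · right
        let f : FDRep.of W.toRepresentation ⟶ V :=
          { hom := FGModuleCat.ofHom W.toSubmodule.subtype
            comm := fun g => by ext; rfl }
        have hf : Function.Injective f.hom.hom := Subtype.val_injective
        have : Mono f := by
          refine ⟨fun {Z} a b hab => ?_⟩
          ext x
          have := congrArg (fun t : Z ⟶ V => t.hom.hom x) hab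
          exact this
        have hf0 : f ≠ 0 := by
          intro h0
          refine hW (Subrepresentation.toSubmodule_injective ((Submodule.eq_bot_iff _).2 ?_))
          intro v hv
          have h1 : f.hom.hom (⟨v, hv⟩ : W.toSubmodule) = v := rfl
          rw [h0] at h1
          exact h1.symm
        have := isIso_of_mono_of_nonzero hf0
        refine Subrepresentation.toSubmodule_injective (Submodule.eq_top_iff'.2 fun v => ?_)
        have h1 := congrArg (fun t : V ⟶ V => t.hom.hom v) (IsIso.inv_hom_id f)
        have h2 : f.hom.hom ((inv f).hom.hom v) = v := h1
        rw [← h2]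
        exact Subtype.property (p := fun x => x ∈ W.toSubmodule) ((inv f).hom.hom v)
  · intro h
    rw [FDRep.simple_iff_char_is_norm_one]
    have := Representation.char_orthonormal (V.ρ : Representation ℂ G V) V.ρ
    rw [if_pos ⟨Representation.Equiv.refl _⟩, inv_mul_eq_one₀ (by simp)] at this
    exact this.symm

theorem charPair_comm (f g : G → ℂ) : charPair f g = charPair g f := by
  unfold charPair
  congr 1
  rw [← Equiv.sum_comp (Equiv.inv G)]
  exact Finset.sum_congr rfl fun x _ => by simp [mul_comm]

theorem charPair_add_left (f f' g : G → ℂ) :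
    charPair (f + f') g = charPair f g + charPair f' g := by
  simp [charPair, add_mul, Finset.sum_add_distrib, mul_add]

theorem charPair_smul_left (c : ℂ) (f g : G → ℂ) :
    charPair (c • f) g = c * charPair f g := by
  simp only [charPair, Pi.smul_apply, smul_eq_mul, Finset.mul_sum]
  exact Finset.sum_congr rfl fun x _ => by ring

theorem charPair_sub_left (f f' g : G → ℂ) :
    charPair (f - f') g = charPair f g - charPair f' g := by
  simp [charPair, sub_mul, Finset.sum_sub_distrib, mul_sub]

theorem charPair_sub_right (f g g' : G → ℂ) :
    charPair f (g - g') = charPair f g - charPair f g' := by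
  rw [charPair_comm, charPair_sub_left, charPair_comm g, charPair_comm g']

theorem Subrepresentation.isIrreducible_of_isAtom {M : Type} [AddCommGroup M] [Module ℂ M]
    {ρ : Representation ℂ G M} {W : Subrepresentation ρ} (hW : IsAtom W) :
    Representation.IsIrreducible W.toRepresentation := by
  refine { exists_pair_ne := ⟨⊥, ⊤, fun h0 => hW.1 ?_⟩, eq_bot_or_eq_top := fun X => ?_ }
  · refine Subrepresentation.toSubmodule_injective ((Submodule.eq_bot_iff _).2 fun v hv => ?_)
    have : (⟨v, hv⟩ : W.toSubmodule) ∈ (⊤ : Subrepresentation W.toRepresentation).toSubmodule :=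
      Submodule.mem_top
    rw [← h0] at this
    exact congrArg Subtype.val ((Submodule.mem_bot ℂ).1 this)
  · let Y : Subrepresentation ρ :=
      { toSubmodule := X.toSubmodule.map W.toSubmodule.subtype
        apply_mem_toSubmodule := by
          rintro g _ ⟨x, hx, rfl⟩
          exact ⟨_, X.apply_mem_toSubmodule g hx, rfl⟩ }
    have hYW : Y ≤ W := by
      rintro _ ⟨x, -, rfl⟩
      exact x.2
    rcases hW.le_iff.1 hYW with h | h
    · left
      refine Subrepresentation.toSubmodule_injective ((Submodule.eq_bot_iff _).2 fun v hv => ?_)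
      have : (v : M) ∈ Y.toSubmodule := ⟨v, hv, rfl⟩
      rw [h] at this
      exact Subtype.ext ((Submodule.mem_bot ℂ).1 this)
    · right
      refine Subrepresentation.toSubmodule_injective (Submodule.eq_top_iff'.2 fun v => ?_)
      have : (v : M) ∈ Y.toSubmodule := by rw [h]; exact v.2
      obtain ⟨x, hx, hxv⟩ := this
      rwa [Subtype.ext hxv] at hx

theorem IsClassFun.sum_comm {f : G → ℂ} (hf : IsClassFun f) {M : Type} [AddCommGroup M]
    [Module ℂ M] (ρ : Representation ℂ G M) (h : G) :
    (∑ g, f g • ρ g⁻¹) * ρ h = ρ h * ∑ g, f g • ρ g⁻¹ := by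
  rw [Finset.sum_mul, Finset.mul_sum, ← Equiv.sum_comp (MulAut.conj h).toEquiv]
  refine Finset.sum_congr rfl fun g _ => ?_
  have : (MulAut.conj h).toEquiv g = h * g * h⁻¹ := rfl
  rw [this, hf, smul_mul_assoc, mul_smul_comm, ← map_mul, ← map_mul]
  congr 2
  group

/-- A class function orthogonal to all irreducible characters acts as zero on every
representation. -/
theorem sum_smul_rep_eq_zero {f : G → ℂ} (hf : IsClassFun f)
    (h : ∀ V : FDRep ℂ G, Simple V → charPair f V.character = 0)
    {M : Type} [AddCommGroup M] [Module ℂ M] [FiniteDimensional ℂ M] (ρ : Representation ℂ G M) :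
    ∑ g, f g • ρ g⁻¹ = 0 := by
  set z : M →ₗ[ℂ] M := ∑ g, f g • ρ g⁻¹ with hz
  have key : ∀ (W : Subrepresentation ρ), IsAtom W → ∀ v ∈ W.toSubmodule, z v = 0 := by
    intro W hW
    have hirr := Subrepresentation.isIrreducible_of_isAtom hW
    let τ := W.toRepresentation
    let Z : Representation.IntertwiningMap τ τ :=
      { toLinearMap := ∑ g, f g • τ g⁻¹
        isIntertwining' := hf.sum_comm τ }
    obtain ⟨c, hc⟩ :=
      (Representation.IsIrreducible.algebraMap_intertwiningMap_bijective_of_isAlgClosed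
        (ρ := τ)).2 Z
    have hcZ : Z.toLinearMap = c • LinearMap.id := by
      rw [← hc]; rfl
    have htr : LinearMap.trace ℂ _ Z.toLinearMap = 0 := by
      have h1 := h (FDRep.of τ) ((FDRep.simple_iff_isIrreducible _).2 hirr)
      rw [charPair, mul_eq_zero] at h1
      have h2 := h1.resolve_left (inv_ne_zero (by simp))
      rw [← h2]
      change LinearMap.trace ℂ _ (∑ g, f g • τ g⁻¹) = _
      rw [map_sum]
      refine Finset.sum_congr rfl fun g _ => ?_
      rw [map_smul]
      rfl
    have hnt : Nontrivial W.toSubmodule :=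
      (Submodule.nontrivial_iff_ne_bot).2
        fun h0 => hW.1 (Subrepresentation.toSubmodule_injective h0)
    have hc0 : c = 0 := by
      rw [hcZ, map_smul, LinearMap.trace_id, smul_eq_mul, mul_eq_zero] at htr
      exact htr.resolve_right (Nat.cast_ne_zero.2 Module.finrank_pos.ne')
    intro v hv
    have h2 : (∑ g, f g • τ g⁻¹) ⟨v, hv⟩ = 0 := by
      change Z.toLinearMap _ = 0
      rw [hcZ, hc0]; simp
    have h3 := congrArg Subtype.val h2
    rw [LinearMap.sum_apply] at h3
    rw [hz, LinearMap.sum_apply]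
    exact (map_sum W.toSubmodule.subtype _ _).symm.trans h3
  let K : Subrepresentation ρ :=
    { toSubmodule := LinearMap.ker z
      apply_mem_toSubmodule := fun g v hv => by
        have := LinearMap.congr_fun (hf.sum_comm ρ g) v
        rw [LinearMap.mem_ker] at hv ⊢
        change z (ρ g v) = ρ g (z v) at this
        rw [this, hv, map_zero] }
  have hss : ComplementedLattice (Subrepresentation ρ) :=
    (Representation.isSemisimpleRepresentation_iff_isSemisimpleModule_asModule ρ).2 inferInstance
  have hat : IsAtomic (Subrepresentation ρ) :=
    (OrderIso.isAtomic_iff Subrepresentation.subrepresentationSubmoduleOrderIso).2 inferInstance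
  obtain ⟨K', hK'⟩ := exists_isCompl K
  rcases hat.eq_bot_or_exists_atom_le K' with h0 | ⟨W, hW, hWK⟩
  · have hK : K = ⊤ := by
      have := hK'.sup_eq_top
      rwa [h0, sup_bot_eq] at this
    refine LinearMap.ext fun v => ?_
    have : v ∈ K.toSubmodule := by rw [hK]; exact Submodule.mem_top
    exact this
  · exfalso
    have hWK2 : W ≤ K := fun v hv => key W hW v hv
    exact hW.1 (le_bot_iff.1 (hK'.disjoint hWK2 hWK))

/-- Irreducible characters separate class functions. -/
theorem IsClassFun.eq_zero {f : G → ℂ} (hf : IsClassFun f)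
    (h : ∀ V : FDRep ℂ G, Simple V → charPair f V.character = 0) : f = 0 := by
  let ρ : Representation ℂ G (G → ℂ) :=
    { toFun := fun g => LinearMap.funLeft ℂ ℂ (fun x => g⁻¹ * x)
      map_one' := by ext; simp [LinearMap.funLeft]
      map_mul' := fun a b => by
        ext
        simp [LinearMap.funLeft, mul_assoc] }
  classical
  have h1 := sum_smul_rep_eq_zero hf h ρ
  funext x
  have h3 := congrFun (LinearMap.congr_fun h1 (Pi.single 1 1)) x⁻¹
  rw [LinearMap.sum_apply, Finset.sum_apply] at h3
  have h4 : ∀ g, (f g • ρ g⁻¹) (Pi.single 1 1) x⁻¹ = if g = x then f x else 0 := by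
    intro g
    change f g * (Pi.single (1 : G) (1 : ℂ) : G → ℂ) (g⁻¹⁻¹ * x⁻¹) = _
    rw [Pi.single_apply, inv_inv, mul_inv_eq_one]
    split_ifs with h
    · rw [h, mul_one]
    · rw [mul_zero]
  simpa [h4] using h3

/-- The set of irreducible characters. -/
def irrChars (G : Type) [Group G] : Set (G → ℂ) :=
  {χ | ∃ V : FDRep ℂ G, Simple V ∧ χ = V.character}

theorem isClassFun_character (V : FDRep ℂ G) : IsClassFun V.character := fun g h => V.char_conj g h

theorem isClassFun_of_mem_irrChars {χ : G → ℂ} (hχ : χ ∈ irrChars G) : IsClassFun χ := by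
  obtain ⟨V, -, rfl⟩ := hχ
  exact isClassFun_character V

theorem charPair_self_of_mem_irrChars {χ : G → ℂ} (hχ : χ ∈ irrChars G) : charPair χ χ = 1 := by
  obtain ⟨V, hV, rfl⟩ := hχ
  have := FDRep.char_orthonormal V V
  rwa [if_pos ⟨Iso.refl _⟩] at this

theorem charPair_of_ne {χ χ' : G → ℂ} (hχ : χ ∈ irrChars G) (hχ' : χ' ∈ irrChars G)
    (h : χ ≠ χ') : charPair χ χ' = 0 := by
  obtain ⟨V, hV, rfl⟩ := hχ
  obtain ⟨V', hV', rfl⟩ := hχ'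
  have := FDRep.char_orthonormal V V'
  rwa [if_neg fun ⟨i⟩ => h (FDRep.char_iso i)] at this

theorem charPair_sum_left {ι : Type*} (s : Finset ι) (F : ι → G → ℂ) (g : G → ℂ) :
    charPair (∑ i ∈ s, F i) g = ∑ i ∈ s, charPair (F i) g := by
  classical
  induction s using Finset.induction_on with
  | empty => simp [charPair]
  | insert i s hi ih => rw [Finset.sum_insert hi, Finset.sum_insert hi, charPair_add_left, ih]

theorem irrChars_finite : (irrChars G).Finite := by
  have hli : LinearIndependent ℂ ((↑) : irrChars G → G → ℂ) := by
    rw [linearIndependent_iff']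
    intro s c hc i hi
    have h1 := congrArg (fun f => charPair f i.1) hc
    simp only [charPair_sum_left, charPair_smul_left] at h1
    rw [Finset.sum_eq_single i] at h1
    · rw [charPair_self_of_mem_irrChars i.2, mul_one] at h1
      rw [h1]; simp [charPair]
    · intro j _ hj
      rw [charPair_of_ne j.2 i.2 (fun h => hj (Subtype.ext h)), mul_zero]
    · exact fun h => absurd hi h
  exact hli.setFinite

theorem exists_charPair_ne_zero {f : G → ℂ} (hf : IsClassFun f) (h0 : f ≠ 0) :
    ∃ χ ∈ irrChars G, charPair f χ ≠ 0 := by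
  by_contra! h
  exact h0 (hf.eq_zero fun V hV => h _ ⟨V, hV, rfl⟩)

theorem IsClassFun.sub {f g : G → ℂ} (hf : IsClassFun f) (hg : IsClassFun g) :
    IsClassFun (f - g) := fun x h => by simp [hf x h, hg x h]

theorem IsClassFun.smul {f : G → ℂ} (hf : IsClassFun f) (c : ℂ) :
    IsClassFun (c • f) := fun x h => by simp [hf x h]

theorem IsClassFun.sum {ι : Type*} {s : Finset ι} {F : ι → G → ℂ}
    (h : ∀ i ∈ s, IsClassFun (F i)) : IsClassFun (∑ i ∈ s, F i) := fun x y => by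
  simp only [Finset.sum_apply]
  exact Finset.sum_congr rfl fun i hi => h i hi x y

theorem IsClassFun.eq_sum_irrChars {f : G → ℂ} (hf : IsClassFun f) :
    f = ∑ χ ∈ (irrChars_finite (G := G)).toFinset, charPair f χ • χ := by
  rw [← sub_eq_zero]
  refine (hf.sub (IsClassFun.sum fun χ hχ => ?_)).eq_zero fun V hV => ?_
  · exact (isClassFun_of_mem_irrChars ((Set.Finite.mem_toFinset _).1 hχ)).smul _
  · have hVm : V.character ∈ irrChars G := ⟨V, hV, rfl⟩
    rw [charPair_sub_left, charPair_sum_left, Finset.sum_eq_single V.character]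
    · rw [charPair_smul_left, charPair_self_of_mem_irrChars hVm, mul_one, sub_self]
    · intro χ hχ hne
      rw [charPair_smul_left, charPair_of_ne ((Set.Finite.mem_toFinset _).1 hχ) hVm hne, mul_zero]
    · exact fun h => absurd ((Set.Finite.mem_toFinset _).2 hVm) h

theorem IsClassFun.charPair_self {f : G → ℂ} (hf : IsClassFun f) :
    charPair f f = ∑ χ ∈ (irrChars_finite (G := G)).toFinset, charPair f χ ^ 2 := by
  conv_lhs => enter [1]; rw [hf.eq_sum_irrChars]
  rw [charPair_sum_left]
  exact Finset.sum_congr rfl fun χ _ => by rw [charPair_smul_left, charPair_comm χ, sq]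

/-- A class function pairs integrally with all irreducible characters. -/
def IsVirtualChar (f : G → ℂ) : Prop :=
  IsClassFun f ∧ ∀ χ ∈ irrChars G, ∃ n : ℤ, charPair f χ = n

theorem IsVirtualChar.sub {f g : G → ℂ} (hf : IsVirtualChar f) (hg : IsVirtualChar g) :
    IsVirtualChar (f - g) := by
  refine ⟨hf.1.sub hg.1, fun χ hχ => ?_⟩
  obtain ⟨m, hm⟩ := hf.2 χ hχ
  obtain ⟨n, hn⟩ := hg.2 χ hχ
  exact ⟨m - n, by rw [charPair_sub_left, hm, hn]; push_cast; rfl⟩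

theorem isVirtualChar_of_mem_irrChars {χ : G → ℂ} (hχ : χ ∈ irrChars G) : IsVirtualChar χ := by
  refine ⟨isClassFun_of_mem_irrChars hχ, fun χ' hχ' => ?_⟩
  by_cases h : χ = χ'
  · subst h; exact ⟨1, by simpa using charPair_self_of_mem_irrChars hχ⟩
  · exact ⟨0, by simpa using charPair_of_ne hχ hχ' h⟩

/-- A virtual character of norm one and nonnegative degree is irreducible. -/
theorem IsVirtualChar.mem_irrChars {f : G → ℂ} (hf : IsVirtualChar f) (h1 : charPair f f = 1)
    {d : ℕ} (hd : f 1 = d) : f ∈ irrChars G := by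
  classical
  choose! c hc using hf.2
  set S := (irrChars_finite (G := G)).toFinset with hS
  have hsum : ∑ χ ∈ S, c χ ^ 2 = 1 := by
    have := hf.1.charPair_self
    rw [h1] at this
    have h2 : ((∑ χ ∈ S, c χ ^ 2 : ℤ) : ℂ) = 1 := by
      rw [this]; push_cast
      exact Finset.sum_congr rfl fun χ hχ => by rw [hc χ ((Set.Finite.mem_toFinset _).1 hχ)]
    exact_mod_cast h2
  obtain ⟨χ, hχ, hne⟩ : ∃ χ ∈ S, c χ ≠ 0 := by
    by_contra! h
    rw [Finset.sum_eq_zero fun χ hχ => by rw [h χ hχ]; rfl] at hsum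
    exact zero_ne_one hsum
  have hpos : 1 ≤ c χ ^ 2 := by
    have := sq_nonneg (c χ); have : c χ ^ 2 ≠ 0 := pow_ne_zero 2 hne; omega
  rw [← Finset.add_sum_erase _ _ hχ] at hsum
  have hnn : 0 ≤ ∑ χ ∈ S.erase χ, c χ ^ 2 := Finset.sum_nonneg fun _ _ => sq_nonneg _
  have hz : ∑ χ ∈ S.erase χ, c χ ^ 2 = 0 := by omega
  have hone : c χ ^ 2 = 1 := by omega
  rw [Finset.sum_eq_zero_iff_of_nonneg fun _ _ => sq_nonneg _] at hz
  have hfeq : f = (c χ : ℂ) • χ := by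
    conv_lhs => rw [hf.1.eq_sum_irrChars]
    rw [Finset.sum_eq_single χ, hc χ ((Set.Finite.mem_toFinset _).1 hχ)]
    · intro χ' hχ' hne'
      have := hz χ' (Finset.mem_erase.2 ⟨hne', hχ'⟩)
      rw [hc χ' ((Set.Finite.mem_toFinset _).1 hχ'),
        pow_eq_zero_iff (by norm_num : 2 ≠ 0) |>.1 this]
      simp
    · exact fun h => absurd hχ h
  have hχm := (Set.Finite.mem_toFinset _).1 hχ
  rcases mul_self_eq_one_iff.1 (by rw [← hone, sq]) with h | h
  · rw [hfeq, h]; simpa using hχm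
  · exfalso
    obtain ⟨V, hV, rfl⟩ := hχm
    rw [hfeq, h, Pi.smul_apply, FDRep.char_one] at hd
    have h0 : (d + Module.finrank ℂ V : ℕ) = 0 := by
      have : ((d + Module.finrank ℂ V : ℕ) : ℂ) = 0 := by
        push_cast; rw [← hd]; simp
      exact_mod_cast this
    exact (finrank_pos_of_simple hV).ne' (by omega)

end CharacterTheory

section Induction

set_option linter.unusedSectionVars false

variable {G : Type} [Group G] [Fintype G]

theorem charPair_add_right (f g g' : G → ℂ) :
    charPair f (g + g') = charPair f g + charPair f g' := by
  rw [charPair_comm, charPair_add_left, charPair_comm g, charPair_comm g']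

theorem isClassFun_trace {M : Type} [AddCommGroup M] [Module ℂ M] [FiniteDimensional ℂ M]
    (ρ : Representation ℂ G M) : IsClassFun (fun g => LinearMap.trace ℂ M (ρ g)) :=
  fun g h => Representation.char_conj ρ g h

theorem isVirtualChar_trace {M : Type} [AddCommGroup M] [Module ℂ M] [FiniteDimensional ℂ M]
    (ρ : Representation ℂ G M) : IsVirtualChar (fun g => LinearMap.trace ℂ M (ρ g)) := by
  refine ⟨isClassFun_trace ρ, ?_⟩
  rintro _ ⟨V, -, rfl⟩
  exact ⟨_, Representation.card_inv_mul_sum_char_mul_char_eq_finrank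
    (V.ρ : Representation ℂ G V) ρ⟩

open Classical in
/-- Extension by zero of a function on a subgroup. -/
noncomputable def extendZero {P : Subgroup G} (f : P → ℂ) (g : G) : ℂ :=
  if h : g ∈ P then f ⟨g, h⟩ else 0

open Classical in
/-- The class function induced from a function on a subgroup. -/
noncomputable def indFun {P : Subgroup G} (f : P → ℂ) (g : G) : ℂ :=
  (Nat.card P : ℂ)⁻¹ * ∑ x, extendZero f (x⁻¹ * g * x)

theorem extendZero_coe {P : Subgroup G} (f : P → ℂ) (p : P) : extendZero f p = f p := by
  simp [extendZero]

theorem extendZero_of_notMem {P : Subgroup G} (f : P → ℂ) {g : G} (h : g ∉ P) :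
    extendZero f g = 0 := by
  simp [extendZero, h]

theorem extendZero_conj {P : Subgroup G} {f : P → ℂ} (hf : ∀ g h, f (h * g * h⁻¹) = f g)
    (p : P) (g : G) : extendZero f (p * g * (p : G)⁻¹) = extendZero f g := by
  by_cases h : g ∈ P
  · have h1 := extendZero_coe f (p * ⟨g, h⟩ * p⁻¹)
    rw [hf] at h1
    exact h1.trans (extendZero_coe f ⟨g, h⟩).symm
  · rw [extendZero_of_notMem f h, extendZero_of_notMem]
    intro h1
    refine h ?_
    have := P.mul_mem (P.mul_mem (P.inv_mem p.2) h1) p.2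
    simpa [mul_assoc] using this

theorem isClassFun_indFun {P : Subgroup G} (f : P → ℂ) : IsClassFun (indFun f) := by
  intro g h
  unfold indFun
  congr 1
  rw [← Equiv.sum_comp (Equiv.mulLeft h)]
  refine Finset.sum_congr rfl fun x _ => ?_
  simp only [Equiv.coe_mulLeft]
  congr 1
  group

theorem indFun_one {P : Subgroup G} (f : P → ℂ) :
    indFun f 1 = (Nat.card G : ℂ) / Nat.card P * f 1 := by
  have : ∀ x : G, extendZero f (x⁻¹ * 1 * x) = f 1 := fun x => by
    rw [mul_one, inv_mul_cancel]
    exact extendZero_coe f 1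
  simp only [indFun, this, Finset.sum_const, Finset.card_univ, nsmul_eq_mul,
    Nat.card_eq_fintype_card (α := G)]
  ring

theorem sum_extendZero_mul {P : Subgroup G} [Fintype P] (f : P → ℂ) (F : G → ℂ) :
    ∑ g, extendZero f g * F g = ∑ p : P, f p * F p := by
  classical
  symm
  refine Fintype.sum_of_injective Subtype.val Subtype.val_injective _ _ ?_ ?_
  · intro g hg
    rw [extendZero_of_notMem f (fun h => hg ⟨⟨g, h⟩, rfl⟩), zero_mul]
  · intro p
    rw [extendZero_coe]

/-- Frobenius reciprocity. -/
theorem charPair_indFun {P : Subgroup G} [Fintype P] (f : P → ℂ) {F : G → ℂ} (hF : IsClassFun F) :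
    charPair (indFun f) F = charPair f (fun p => F p) := by
  have h1 : ∀ x : G, ∑ g, extendZero f (x⁻¹ * g * x) * F g⁻¹ = ∑ p : P, f p * F (p : G)⁻¹ := by
    intro x
    rw [← sum_extendZero_mul f (fun g => F g⁻¹), ← Equiv.sum_comp (MulAut.conj x).toEquiv]
    refine Finset.sum_congr rfl fun g _ => ?_
    have : (MulAut.conj x).toEquiv g = x * g * x⁻¹ := rfl
    rw [this, ← hF g⁻¹ x]
    congr 2
    · group
    · group
  unfold charPair indFun
  have h2 : ∑ g, ((Nat.card P : ℂ)⁻¹ * ∑ x, extendZero f (x⁻¹ * g * x)) * F g⁻¹ =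
      (Nat.card P : ℂ)⁻¹ * ∑ x : G, ∑ g, extendZero f (x⁻¹ * g * x) * F g⁻¹ := by
    rw [Finset.sum_comm, Finset.mul_sum]
    exact Finset.sum_congr rfl fun g _ => by rw [mul_assoc, Finset.sum_mul]
  rw [h2]
  simp_rw [h1]
  rw [Finset.sum_const, Finset.card_univ, nsmul_eq_mul, ← Nat.card_eq_fintype_card]
  have : (Nat.card G : ℂ) ≠ 0 := by simp
  rw [mul_left_comm, ← mul_assoc (Nat.card G : ℂ)⁻¹, inv_mul_cancel₀ this, one_mul]
  rfl

theorem isVirtualChar_indFun {P : Subgroup G} {M : Type} [AddCommGroup M] [Module ℂ M]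
    [FiniteDimensional ℂ M] (ρ : Representation ℂ P M) :
    IsVirtualChar (indFun fun p => LinearMap.trace ℂ M (ρ p)) := by
  classical
  refine ⟨isClassFun_indFun _, ?_⟩
  rintro _ ⟨V, hV, rfl⟩
  rw [charPair_indFun _ (isClassFun_character V)]
  exact ⟨_, Representation.card_inv_mul_sum_char_mul_char_eq_finrank
    ((V.ρ : Representation ℂ G V).comp P.subtype) ρ⟩

/-- Mackey's formula for a subgroup with two double cosets. -/
theorem charPair_indFun_indFun {P : Subgroup G} [Fintype P] {f f' : P → ℂ}
    (hf : IsClassFun f) (hf' : IsClassFun f') {w : G}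
    (hw : ∀ z ∉ P, ∃ p p' : P, z = p * w * p') :
    charPair (indFun f) (indFun f') = charPair f f' +
      ((Nat.card G : ℂ) - Nat.card P) / (Nat.card P : ℂ) ^ 2 *
        ∑ p : P, f p * extendZero f' (w⁻¹ * (p : G)⁻¹ * w) := by
  classical
  set M : G → ℂ := fun x => ∑ p : P, f p * extendZero f' (x⁻¹ * (p : G)⁻¹ * x) with hM
  have hMr : ∀ (x : G) (p : P), M (x * p) = M x := by
    intro x p
    refine Finset.sum_congr rfl fun r _ => ?_
    congr 1
    rw [← extendZero_conj hf' p⁻¹ (x⁻¹ * (r : G)⁻¹ * x)]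
    congr 1
    simp [mul_assoc]
  have hMl : ∀ (x : G) (p : P), M (p * x) = M x := by
    intro x p
    simp only [hM]
    rw [← Equiv.sum_comp (MulAut.conj p).toEquiv]
    refine Finset.sum_congr rfl fun r _ => ?_
    have : (MulAut.conj p).toEquiv r = p * r * p⁻¹ := rfl
    rw [this, hf]
    congr 2
    simp [mul_assoc]
  have hcP : (Nat.card P : ℂ) ≠ 0 := by simp
  have h1 : M 1 = Nat.card P * charPair f f' := by
    unfold charPair
    rw [← mul_assoc, mul_inv_cancel₀ hcP, one_mul]
    refine Finset.sum_congr rfl fun p _ => ?_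
    rw [← extendZero_coe f' p⁻¹]
    simp
  have h2 : ∑ x, M x = Nat.card P * M 1 + ((Nat.card G : ℂ) - Nat.card P) * M w := by
    have h3 : ∀ x, M x = M w + if x ∈ P then M 1 - M w else 0 := by
      intro x
      split_ifs with hx
      · have := hMr 1 ⟨x, hx⟩
        rw [one_mul] at this
        rw [this]; ring
      · obtain ⟨p, p', rfl⟩ := hw x hx
        rw [hMr, hMl, add_zero]
    have h4 : (Finset.univ.filter (· ∈ P)).card = Nat.card P := by
      rw [← Fintype.card_subtype, Nat.card_eq_fintype_card]
    rw [Finset.sum_congr rfl fun x _ => h3 x, Finset.sum_add_distrib, ← Finset.sum_filter,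
      Finset.sum_const, Finset.sum_const, h4, Finset.card_univ, ← Nat.card_eq_fintype_card]
    simp only [nsmul_eq_mul]
    ring
  have h5 : charPair (indFun f) (indFun f') = (Nat.card P : ℂ)⁻¹ ^ 2 * ∑ x, M x := by
    rw [charPair_indFun _ (isClassFun_indFun _)]
    unfold charPair indFun
    simp only [hM]
    rw [Finset.sum_comm, sq, mul_assoc]
    congr 1
    rw [Finset.mul_sum]
    refine Finset.sum_congr rfl fun p _ => ?_
    rw [mul_left_comm, Finset.mul_sum]
    simp
  rw [h5, h2, h1]
  rw [← show M w = ∑ p : P, f p * extendZero f' (w⁻¹ * (p : G)⁻¹ * w) from rfl]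
  field_simp

end Induction

section Gelfand

set_option linter.unusedSectionVars false

variable {G : Type} [Group G] [Fintype G] {M : Type} [AddCommGroup M] [Module ℂ M]
  [FiniteDimensional ℂ M]

/-- The projection onto the vectors on which a subgroup acts through a linear character. -/
noncomputable def charProj (ρ : Representation ℂ G M) {U : Subgroup G} [Fintype U]
    (ψ : U →* ℂ) : M →ₗ[ℂ] M :=
  (Nat.card U : ℂ)⁻¹ • ∑ u : U, ψ u⁻¹ • ρ u

variable (ρ : Representation ℂ G M) {U : Subgroup G} [Fintype U] (ψ : U →* ℂ)

theorem rep_mul_charProj (u : U) : ρ u * charProj ρ ψ = ψ u • charProj ρ ψ := by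
  suffices h : ∑ x : U, ρ u * ψ x⁻¹ • ρ x = ∑ x : U, ψ u • ψ x⁻¹ • ρ x by
    unfold charProj
    rw [mul_smul_comm, smul_comm, Finset.mul_sum, h, ← Finset.smul_sum]
  refine Fintype.sum_equiv (Equiv.mulLeft u) _ _ fun x => ?_
  rw [Equiv.coe_mulLeft, smul_smul, ← map_mul ψ, mul_inv_rev, map_mul, mul_comm, ← map_mul,
    inv_mul_cancel_right, mul_smul_comm, Subgroup.coe_mul, map_mul]

theorem charProj_mul_rep (u : U) : charProj ρ ψ * ρ u = ψ u • charProj ρ ψ := by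
  suffices h : ∑ x : U, ψ x⁻¹ • ρ x * ρ u = ∑ x : U, ψ u • ψ x⁻¹ • ρ x by
    unfold charProj
    rw [smul_mul_assoc, smul_comm, Finset.sum_mul, h, ← Finset.smul_sum]
  refine Fintype.sum_equiv (Equiv.mulRight u) _ _ fun x => ?_
  rw [Equiv.coe_mulRight, smul_smul, ← map_mul ψ, mul_inv_rev, mul_inv_cancel_left, smul_mul_assoc,
    Subgroup.coe_mul, map_mul]

theorem charProj_mul_self : charProj ρ ψ * charProj ρ ψ = charProj ρ ψ := by
  conv_lhs => enter [1]; unfold charProj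
  rw [smul_mul_assoc, Finset.sum_mul]
  simp_rw [smul_mul_assoc, rep_mul_charProj, smul_smul, ← map_mul, inv_mul_cancel, map_one,
    one_smul]
  rw [Finset.sum_const, Finset.card_univ, ← Nat.cast_smul_eq_nsmul ℂ, smul_smul,
    ← Nat.card_eq_fintype_card, inv_mul_cancel₀ (by simp), one_smul]

theorem trace_charProj : LinearMap.trace ℂ M (charProj ρ ψ) =
    Module.finrank ℂ (LinearMap.range (charProj ρ ψ)) :=
  (LinearMap.IsIdempotentElem.isProj_range _ (charProj_mul_self ρ ψ)).trace

theorem charProj_mul_rep_mul_charProj_eq_zero {g : G} {u u' : U} (h : (u : G) * g = g * u')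
    (hψ : ψ u ≠ ψ u') : charProj ρ ψ * ρ g * charProj ρ ψ = 0 := by
  set e := charProj ρ ψ with he
  have h1 : ψ u • (e * ρ g * e) = ψ u' • (e * ρ g * e) := by
    calc ψ u • (e * ρ g * e) = (e * ρ u) * ρ g * e := by
          rw [he, charProj_mul_rep, smul_mul_assoc, smul_mul_assoc]
      _ = e * ρ g * (ρ u' * e) := by
          rw [mul_assoc e, ← map_mul, h, map_mul]; simp only [mul_assoc]
      _ = _ := by rw [he, rep_mul_charProj, mul_smul_comm]
  rw [← sub_eq_zero, ← sub_smul] at h1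
  exact (smul_eq_zero.1 h1).resolve_left (sub_ne_zero.2 hψ)

/-- Gelfand's trick. -/
theorem finrank_range_charProj_le_one (hρ : Representation.IsIrreducible ρ) (σ : G → G)
    (hσ : ∀ g h, σ (g * h) = σ h * σ g) (hσU : ∀ u : U, ∃ h : σ u ∈ U, ψ ⟨σ u, h⟩ = ψ u)
    (hσσ : ∀ g, σ (σ g) = g)
    (hg : ∀ g : G, ∃ (u u' : U) (n : G), g = u * n * u' ∧
      (σ n = n ∨ ∃ v v' : U, (v : G) * n = n * v' ∧ ψ v ≠ ψ v')) :
    Module.finrank ℂ (LinearMap.range (charProj ρ ψ)) ≤ 1 := by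
  set e := charProj ρ ψ with he
  have hee : e * e = e := charProj_mul_self ρ ψ
  have heu : ∀ (u u' : U) (n : G), e * ρ (u * n * u') * e = (ψ u * ψ u') • (e * ρ n * e) := by
    intro u u' n
    rw [map_mul, map_mul, ← mul_assoc, ← mul_assoc, charProj_mul_rep, mul_assoc, rep_mul_charProj,
      smul_mul_assoc, smul_mul_assoc, mul_smul_comm, smul_smul]
  have hT : ∀ g, e * ρ g * e = e * ρ (σ g) * e := by
    intro g
    obtain ⟨u, u', n, rfl, h⟩ := hg g
    obtain ⟨hu, hu2⟩ := hσU u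
    obtain ⟨hu', hu2'⟩ := hσU u'
    have h1 : σ (u * n * u') = (⟨σ u', hu'⟩ : U) * σ n * (⟨σ u, hu⟩ : U) := by
      rw [hσ, hσ, mul_assoc]
    rw [h1, heu, heu, hu2, hu2', mul_comm (ψ u)]
    congr 1
    rcases h with h | ⟨v, v', hv, hne⟩
    · rw [h]
    · rw [he, charProj_mul_rep_mul_charProj_eq_zero ρ ψ hv hne]
      obtain ⟨hv1, hv2⟩ := hσU v
      obtain ⟨hv1', hv2'⟩ := hσU v'
      rw [charProj_mul_rep_mul_charProj_eq_zero ρ ψ (u := ⟨σ v', hv1'⟩) (u' := ⟨σ v, hv1⟩)]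
      · simp only [← hσ, hv]
      · rw [hv2, hv2']; exact hne.symm
  let s : U ≃ U :=
    { toFun := fun u => ⟨σ u, (hσU u).1⟩
      invFun := fun u => ⟨σ u, (hσU u).1⟩
      left_inv := fun u => Subtype.ext (hσσ u)
      right_inv := fun u => Subtype.ext (hσσ u) }
  have hσ1 : σ 1 = 1 := by
    have := hσ 1 1
    rw [one_mul] at this
    exact (mul_eq_left.1 this.symm)
  have hσinv : ∀ g, σ g⁻¹ = (σ g)⁻¹ := fun g => by
    refine eq_inv_of_mul_eq_one_left ?_
    rw [← hσ, mul_inv_cancel, hσ1]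
  have hmul : ∀ x y, (e * ρ x * e) * (e * ρ y * e) =
      (Nat.card U : ℂ)⁻¹ • ∑ u : U, ψ u⁻¹ • (e * ρ (x * u * y) * e) := by
    intro x y
    calc (e * ρ x * e) * (e * ρ y * e) = e * ρ x * (e * e) * ρ y * e := by simp only [mul_assoc]
      _ = e * ρ x * e * ρ y * e := by rw [hee]
      _ = _ := by
        conv_lhs => enter [1, 1, 2]; rw [he]; unfold charProj
        rw [mul_smul_comm, smul_mul_assoc, smul_mul_assoc, Finset.mul_sum, Finset.sum_mul,
          Finset.sum_mul]
        congr 1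
        refine Finset.sum_congr rfl fun u _ => ?_
        rw [mul_smul_comm, smul_mul_assoc, smul_mul_assoc, map_mul, map_mul]
        simp only [mul_assoc]
  have hcomm : ∀ x y, (e * ρ x * e) * (e * ρ y * e) = (e * ρ y * e) * (e * ρ x * e) := by
    intro x y
    rw [hT x, hT y, hmul (σ x), ← hT x, ← hT y, hmul y]
    congr 1
    refine Fintype.sum_equiv s _ _ fun u => ?_
    have h1 : ψ (s u)⁻¹ = ψ u⁻¹ := by
      obtain ⟨h, h2⟩ := hσU u⁻¹
      rw [← h2]
      congr 1
      exact Subtype.ext (hσinv u).symm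
    have h2 : ((s u : U) : G) = σ u := rfl
    rw [h1, h2, hT, hσ, hσ, hσσ, hσσ, mul_assoc y]
  by_contra! hcon
  have hnt : Nontrivial (LinearMap.range e) :=
    Module.nontrivial_of_finrank_pos (R := ℂ) (by omega)
  have hfix : ∀ v ∈ LinearMap.range e, e v = v := by
    rintro _ ⟨v, rfl⟩
    exact LinearMap.congr_fun hee v
  have hspan : ∀ v0 ∈ LinearMap.range e, v0 ≠ 0 → ∀ v ∈ LinearMap.range e,
      v ∈ Submodule.span ℂ (Set.range fun y => (e * ρ y * e) v0) := by
    intro v0 hv0 hne v hv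
    let W : Subrepresentation ρ :=
      { toSubmodule := Submodule.span ℂ (Set.range fun y => ρ y v0)
        apply_mem_toSubmodule := by
          intro g v hv
          have : Submodule.map (ρ g) (Submodule.span ℂ (Set.range fun y => ρ y v0)) ≤
              Submodule.span ℂ (Set.range fun y => ρ y v0) := by
            rw [Submodule.map_span_le]
            rintro _ ⟨y, rfl⟩
            refine Submodule.subset_span ⟨g * y, ?_⟩
            simp
          exact this (Submodule.mem_map_of_mem hv) }
    have hW : W = ⊤ := by
      refine (hρ.eq_bot_or_eq_top W).resolve_left fun h0 => hne ?_
      have : v0 ∈ W.toSubmodule := Submodule.subset_span ⟨1, by simp⟩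
      rw [h0] at this
      exact (Submodule.mem_bot ℂ).1 this
    have hvW : v ∈ W.toSubmodule := by rw [hW]; exact Submodule.mem_top
    have h3 := Submodule.mem_map_of_mem (f := e) hvW
    rw [hfix v hv] at h3
    have h4 : Submodule.map e W.toSubmodule ≤
        Submodule.span ℂ (Set.range fun y => (e * ρ y * e) v0) := by
      rw [Submodule.map_span_le]
      rintro _ ⟨y, rfl⟩
      refine Submodule.subset_span ⟨y, ?_⟩
      simp [hfix v0 hv0]
    exact h4 h3
  have hscalar : ∀ x, ∃ μ : ℂ, ∀ v ∈ LinearMap.range e, (e * ρ x * e) v = μ • v := by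
    intro x
    let T : Module.End ℂ (LinearMap.range e) :=
      (e * ρ x * e).restrict fun v _ => ⟨(ρ x * e) v, rfl⟩
    obtain ⟨μ, hμ⟩ := Module.End.exists_eigenvalue T
    obtain ⟨w, hw⟩ := hμ.exists_hasEigenvector
    refine ⟨μ, fun v hv => ?_⟩
    have hw1 : (e * ρ x * e) w = μ • (w : M) := congrArg Subtype.val hw.apply_eq_smul
    have hw2 : (w : M) ≠ 0 := fun h => hw.2 (Subtype.ext h)
    have h6 : Submodule.span ℂ (Set.range fun y => (e * ρ y * e) w) ≤
        LinearMap.ker (e * ρ x * e - μ • LinearMap.id) := by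
      rw [Submodule.span_le]
      rintro _ ⟨y, rfl⟩
      have := LinearMap.congr_fun (hcomm x y) (w : M)
      change (e * ρ x * e) ((e * ρ y * e) w) = (e * ρ y * e) ((e * ρ x * e) w) at this
      rw [hw1, map_smul] at this
      rw [SetLike.mem_coe, LinearMap.mem_ker, LinearMap.sub_apply, this]
      exact sub_self _
    exact sub_eq_zero.1 (LinearMap.mem_ker.1 (h6 (hspan w w.2 hw2 v hv)))
  obtain ⟨v0, hv0⟩ := exists_ne (0 : LinearMap.range e)
  choose μ hμ using hscalar
  have h6 : LinearMap.range e ≤ Submodule.span ℂ {(v0 : M)} := by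
    intro v hv
    refine Submodule.span_le.2 ?_ (hspan v0 v0.2 (fun h => hv0 (Subtype.ext h)) v hv)
    rintro _ ⟨y, rfl⟩
    exact Submodule.mem_span_singleton.2 ⟨_, (hμ y v0 v0.2).symm⟩
  have h7 := (Submodule.finrank_mono h6).trans (finrank_span_le_card ({(v0 : M)} : Set M))
  rw [Set.toFinset_singleton, Finset.card_singleton] at h7
  omega

end Gelfand

section Twist

set_option linter.unusedSectionVars false

variable {G : Type} [Group G] [Fintype G] {M : Type} [AddCommGroup M] [Module ℂ M]
  [FiniteDimensional ℂ M]

/-- The twist of a representation by a linear character. -/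
noncomputable def twistRep (χ : G →* ℂ) (ρ : Representation ℂ G M) : Representation ℂ G M where
  toFun g := χ g • ρ g
  map_one' := by simp
  map_mul' g h := by rw [map_mul, map_mul, smul_mul_smul_comm]

theorem trace_twistRep (χ : G →* ℂ) (ρ : Representation ℂ G M) (g : G) :
    LinearMap.trace ℂ M (twistRep χ ρ g) = χ g * LinearMap.trace ℂ M (ρ g) := by
  change LinearMap.trace ℂ M (χ g • ρ g) = _
  rw [map_smul, smul_eq_mul]

theorem trace_twistRep_one (χ : G →* ℂ) (g : G) :
    LinearMap.trace ℂ ℂ (twistRep χ 1 g) = χ g := by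
  rw [trace_twistRep, MonoidHom.one_apply, LinearMap.trace_one]
  simp

theorem charPair_monoidHom_self (χ : G →* ℂ) : charPair χ χ = 1 := by
  have : ∀ g, χ g * χ g⁻¹ = 1 := fun g => by rw [← map_mul, mul_inv_cancel, map_one]
  unfold charPair
  simp_rw [this]
  simp

theorem monoidHom_mem_irrChars (χ : G →* ℂ) : (χ : G → ℂ) ∈ irrChars G := by
  have h := isVirtualChar_trace (M := ℂ) (twistRep χ 1)
  simp only [trace_twistRep_one] at h
  exact h.mem_irrChars (charPair_monoidHom_self χ) (d := 1) (by simp)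

theorem isVirtualChar_indFun_monoidHom {P : Subgroup G} (χ : P →* ℂ) :
    IsVirtualChar (indFun fun p => χ p) := by
  classical
  have h := isVirtualChar_indFun (M := ℂ) (twistRep χ 1)
  simpa only [trace_twistRep_one] using h

theorem charPair_prod {H : Type} [Group H] [Fintype H] (f f' : G → ℂ) (g g' : H → ℂ) :
    charPair (fun p : G × H => f p.1 * g p.2) (fun p => f' p.1 * g' p.2) =
      charPair f f' * charPair g g' := by
  unfold charPair
  rw [Nat.card_prod, Nat.cast_mul, mul_inv, mul_mul_mul_comm, Finset.sum_mul_sum,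
    Fintype.sum_prod_type]
  congr 1
  refine Finset.sum_congr rfl fun x _ => Finset.sum_congr rfl fun y _ => ?_
  simp only [Prod.fst_inv, Prod.snd_inv]
  ring

theorem eq_of_charPair_left {f g : G → ℂ} (h : ∀ φ : G → ℂ, charPair φ f = charPair φ g) :
    f = g := by
  classical
  funext x
  have h1 := h (Pi.single x⁻¹ 1)
  unfold charPair at h1
  have hc : (Nat.card G : ℂ)⁻¹ ≠ 0 := inv_ne_zero (by simp)
  have h2 := mul_left_cancel₀ hc h1
  simpa [Pi.single_apply] using h2

theorem IsVirtualChar.eq_zero {f : G → ℂ} (hf : IsVirtualChar f) (h : charPair f f = 0) :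
    f = 0 := by
  choose! c hc using hf.2
  set S := (irrChars_finite (G := G)).toFinset with hS
  have hmem : ∀ χ ∈ S, χ ∈ irrChars G := fun χ hχ => (Set.Finite.mem_toFinset _).1 hχ
  have hsum : ∑ χ ∈ S, c χ ^ 2 = 0 := by
    have := hf.1.charPair_self
    rw [h] at this
    have h2 : ((∑ χ ∈ S, c χ ^ 2 : ℤ) : ℂ) = 0 := by
      rw [this]; push_cast
      exact Finset.sum_congr rfl fun χ hχ => by rw [hc χ (hmem χ hχ)]
    exact_mod_cast h2
  rw [Finset.sum_eq_zero_iff_of_nonneg fun _ _ => sq_nonneg _] at hsum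
  rw [hf.1.eq_sum_irrChars]
  refine Finset.sum_eq_zero fun χ hχ => ?_
  have h0 : c χ = 0 := by simpa using hsum χ hχ
  rw [hc χ (hmem χ hχ), h0, Int.cast_zero, zero_smul]

theorem eq_of_charPair_ne_zero {χ χ' : G → ℂ} (hχ : χ ∈ irrChars G) (hχ' : χ' ∈ irrChars G)
    (h : charPair χ χ' ≠ 0) : χ = χ' := by
  by_contra hne
  exact h (charPair_of_ne hχ hχ' hne)

end Twist

section MulChars

variable {k : Type} [Field k] [Fintype k] [DecidableEq k]

theorem charPair_mulChar [DecidableEq (MulChar k ℂ)] (α β : MulChar k ℂ) :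
    charPair (fun a : kˣ => α a) (fun a : kˣ => β a) = if α = β then 1 else 0 := by
  split_ifs with h
  · subst h
    exact charPair_monoidHom_self (G := kˣ) (α.toMonoidHom.comp (Units.coeHom k))
  · refine charPair_of_ne (G := kˣ)
      (monoidHom_mem_irrChars (α.toMonoidHom.comp (Units.coeHom k)))
      (monoidHom_mem_irrChars (β.toMonoidHom.comp (Units.coeHom k))) fun h1 => h ?_
    exact MulChar.ext fun a => congrFun h1 a

theorem exists_mulChar_charPair_ne_zero {f : kˣ → ℂ} (hf : f ≠ 0) :
    ∃ α : MulChar k ℂ, charPair f (fun a : kˣ => α a) ≠ 0 := by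
  by_contra! h
  refine hf ?_
  have := Fintype.ofFinite (MulChar k ℂ)
  have horth : ∀ a : kˣ, a ≠ 1 → ∑ α : MulChar k ℂ, α a = 0 := by
    intro a ha
    obtain ⟨β, hβ⟩ := MulChar.exists_apply_ne_one_of_hasEnoughRootsOfUnity k ℂ
      (a := (a : k)) (fun h => ha (Units.ext h))
    have h1 : β a * ∑ α : MulChar k ℂ, α a = ∑ α : MulChar k ℂ, α a := by
      rw [Finset.mul_sum]
      exact Fintype.sum_equiv (Equiv.mulLeft β) _ _ fun α => by simp
    have h2 : (β a - 1) * ∑ α : MulChar k ℂ, α a = 0 := by rw [sub_mul, h1, one_mul, sub_self]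
    exact (mul_eq_zero.1 h2).resolve_left (sub_ne_zero.2 hβ)
  funext b
  have h3 : ∑ α : MulChar k ℂ, α b * charPair f (fun a : kˣ => α a) = 0 := by simp [h]
  have h4 : ∀ α : MulChar k ℂ, α b * charPair f (fun a : kˣ => α a) =
      (Nat.card kˣ : ℂ)⁻¹ * ∑ a : kˣ, f a * α ((b * a⁻¹ : kˣ) : k) := by
    intro α
    unfold charPair
    rw [mul_left_comm, Finset.mul_sum]
    congr 1
    refine Finset.sum_congr rfl fun a _ => ?_
    rw [Units.val_mul, map_mul]
    ring
  simp_rw [h4, ← Finset.mul_sum] at h3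
  rw [Finset.sum_comm] at h3
  simp_rw [← Finset.mul_sum] at h3
  rw [Finset.sum_eq_single b] at h3
  · have hc : (Nat.card kˣ : ℂ)⁻¹ ≠ 0 := inv_ne_zero (by simp)
    have h5 := (mul_eq_zero.1 h3).resolve_left hc
    rw [mul_inv_cancel] at h5
    simp only [Units.val_one, map_one, Finset.sum_const, nsmul_eq_mul, mul_one, mul_eq_zero,
      Nat.cast_eq_zero] at h5
    exact h5.resolve_right (Finset.card_ne_zero.2 ⟨1, Finset.mem_univ _⟩)
  · intro a _ hab
    rw [horth _ (fun h => hab (mul_inv_eq_one.1 h).symm), mul_zero]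
  · simp

end MulChars

section GLTwo

set_option linter.unusedSectionVars false

variable {k : Type} [Field k]

/-- An invertible upper triangular matrix of size two. -/
noncomputable def upper2 (a d : kˣ) (b : k) : GL (Fin 2) k :=
  Matrix.GeneralLinearGroup.mkOfDetNeZero !![(a : k), b; 0, (d : k)]
    (by simp)

theorem upper2_val (a d : kˣ) (b : k) : (upper2 a d b).1 = !![(a : k), b; 0, (d : k)] := rfl

/-- Upper triangular matrices of size two. -/
noncomputable def borel2 (k : Type) [Field k] : Subgroup (GL (Fin 2) k) where
  carrier := {g | g.1 1 0 = 0}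
  mul_mem' {g h} hg hh := by
    simp only [Set.mem_ofPred_eq] at *
    simp [Matrix.mul_apply, Fin.sum_univ_two, hg, hh]
  one_mem' := by simp
  inv_mem' {g} hg := by
    simp only [Set.mem_ofPred_eq] at *
    rw [Matrix.coe_units_inv, Matrix.inv_def, Matrix.adjugate_fin_two]
    simp [hg]

theorem mem_borel2 {g : GL (Fin 2) k} : g ∈ borel2 k ↔ g.1 1 0 = 0 := Iff.rfl

theorem upper2_mem (a d : kˣ) (b : k) : upper2 a d b ∈ borel2 k := by
  simp [mem_borel2, upper2_val]

theorem borel2_diag_ne_zero (p : borel2 k) : p.1.1 0 0 ≠ 0 ∧ p.1.1 1 1 ≠ 0 := by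
  have h : p.1.1.det ≠ 0 := (Matrix.isUnit_iff_isUnit_det _).1 p.1.isUnit |>.ne_zero
  rw [Matrix.det_fin_two, mem_borel2.1 p.2, mul_zero, sub_zero] at h
  exact mul_ne_zero_iff.1 h

/-- The diagonal part of an upper triangular matrix. -/
noncomputable def borel2Diag : borel2 k →* kˣ × kˣ where
  toFun p := (Units.mk0 _ (borel2_diag_ne_zero p).1, Units.mk0 _ (borel2_diag_ne_zero p).2)
  map_one' := by ext <;> simp
  map_mul' p p' := by
    have h := mem_borel2.1 p.2
    have h' := mem_borel2.1 p'.2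
    ext <;> simp [Matrix.mul_apply, h, h', Fin.sum_univ_two]

/-- Coordinates on the group of upper triangular matrices of size two. -/
noncomputable def borel2Equiv : (kˣ × kˣ) × k ≃ borel2 k where
  toFun x := ⟨upper2 x.1.1 x.1.2 x.2, upper2_mem _ _ _⟩
  invFun p := (borel2Diag p, p.1.1 0 1)
  left_inv x := by
    ext <;> simp [borel2Diag, upper2_val]
  right_inv p := by
    have h := mem_borel2.1 p.2
    refine Subtype.ext (Units.ext (Matrix.ext fun i j => ?_))
    fin_cases i <;> fin_cases j <;> simp [borel2Diag, upper2_val, h]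

theorem borel2Diag_equiv (x : (kˣ × kˣ) × k) : borel2Diag (borel2Equiv x) = x.1 :=
  congrArg Prod.fst (borel2Equiv.symm_apply_apply x)

/-- The permutation matrix of size two. -/
noncomputable def swap2 : GL (Fin 2) k :=
  Matrix.GeneralLinearGroup.mkOfDetNeZero !![0, 1; 1, 0] (by simp)

theorem swap2_val : (swap2 : GL (Fin 2) k).1 = !![0, 1; 1, 0] := rfl

theorem exists_eq_borel2_swap2 (z : GL (Fin 2) k) (hz : z ∉ borel2 k) :
    ∃ p p' : borel2 k, z = (p : GL (Fin 2) k) * swap2 * (p' : GL (Fin 2) k) := by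
  have hc : z.1 1 0 ≠ 0 := hz
  have h : z.1.det ≠ 0 := (Matrix.isUnit_iff_isUnit_det _).1 z.isUnit |>.ne_zero
  rw [Matrix.det_fin_two] at h
  have hx : z.1 0 1 - z.1 0 0 * z.1 1 1 / z.1 1 0 ≠ 0 := by
    intro h0
    field_simp at h0
    exact h (by linear_combination - h0)
  refine ⟨borel2Equiv ((Units.mk0 _ hx, Units.mk0 _ hc), z.1 0 0),
    borel2Equiv ((1, 1), z.1 1 1 / z.1 1 0), Units.ext (Matrix.ext fun i j => ?_)⟩
  fin_cases i <;> fin_cases j <;>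
    simp [borel2Equiv, upper2_val, swap2_val] <;> field_simp <;> try ring

variable [Fintype k] [DecidableEq k]

theorem sum_borel2 [Fintype (borel2 k)] (F : borel2 k → ℂ) :
    ∑ p, F p = ∑ t : kˣ × kˣ, ∑ b : k, F (borel2Equiv (t, b)) := by
  rw [← Equiv.sum_comp borel2Equiv, Fintype.sum_prod_type]

theorem card_borel2 : Nat.card (borel2 k) = Nat.card (kˣ × kˣ) * Nat.card k := by
  rw [← Nat.card_congr borel2Equiv, Nat.card_prod]

/-- The Jacquet restriction of a class function. -/
noncomputable def jac2 (f : GL (Fin 2) k → ℂ) (t : kˣ × kˣ) : ℂ :=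
  (Nat.card k : ℂ)⁻¹ * ∑ b, f (upper2 t.1 t.2 b)

theorem charPair_borel2 [Fintype (borel2 k)] (φ : kˣ × kˣ → ℂ) (F : GL (Fin 2) k → ℂ) :
    charPair (fun p : borel2 k => φ (borel2Diag p)) (fun p => F p) = charPair φ (jac2 F) := by
  rw [charPair_comm, charPair_comm φ]
  unfold charPair
  rw [sum_borel2, card_borel2, Nat.cast_mul, mul_inv, mul_assoc, Finset.mul_sum]
  congr 1
  refine Finset.sum_congr rfl fun t _ => ?_
  rw [jac2, mul_assoc, Finset.sum_mul]
  congr 1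
  refine Finset.sum_congr rfl fun b _ => ?_
  simp only [map_inv, borel2Diag_equiv]
  rfl

theorem charPair_borel2_borel2 [Fintype (borel2 k)] (φ φ' : kˣ × kˣ → ℂ) :
    charPair (fun p : borel2 k => φ (borel2Diag p)) (fun p => φ' (borel2Diag p)) =
      charPair φ φ' := by
  unfold charPair
  rw [sum_borel2, card_borel2, Nat.cast_mul, mul_inv]
  simp only [map_inv, borel2Diag_equiv, Finset.sum_const, Finset.card_univ, nsmul_eq_mul,
    ← Finset.mul_sum]
  rw [Nat.card_eq_fintype_card (α := k)]
  have : (Fintype.card k : ℂ) ≠ 0 := by simp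
  field_simp

theorem card_GL2 : (Nat.card (GL (Fin 2) k) : ℂ) =
    ((Nat.card k : ℂ) ^ 2 - 1) * ((Nat.card k : ℂ) ^ 2 - Nat.card k) := by
  have h1 : 1 ≤ Fintype.card k := Fintype.card_pos
  rw [Matrix.card_GL_field, Fin.prod_univ_two, Nat.card_eq_fintype_card, Nat.cast_mul,
    Nat.cast_sub (Nat.pow_le_pow_right h1 (by simp)),
    Nat.cast_sub (Nat.pow_le_pow_right h1 (by simp))]
  simp

theorem card_units_cast : (Nat.card kˣ : ℂ) = (Nat.card k : ℂ) - 1 := by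
  rw [Nat.card_eq_fintype_card, Fintype.card_units, Nat.cast_sub Fintype.card_pos,
    Nat.card_eq_fintype_card, Nat.cast_one]

theorem card_sub_one_ne_zero : (Nat.card k : ℂ) - 1 ≠ 0 := by
  rw [← card_units_cast]; simp

theorem isClassFun_comp_borel2Diag (φ : kˣ × kˣ → ℂ) :
    IsClassFun (fun p : borel2 k => φ (borel2Diag p)) := fun g h => by
  simp [mul_comm]

theorem charPair_indFun_borel2 (φ φ' : kˣ × kˣ → ℂ) :
    charPair (indFun fun p : borel2 k => φ (borel2Diag p))
      (indFun fun p : borel2 k => φ' (borel2Diag p)) =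
      charPair φ φ' + charPair φ (fun t => φ' t.swap) := by
  classical
  rw [charPair_indFun_indFun (isClassFun_comp_borel2Diag φ) (isClassFun_comp_borel2Diag φ')
    exists_eq_borel2_swap2, charPair_borel2_borel2, sum_borel2]
  congr 1
  have h1 : ∀ (t : kˣ × kˣ) (b : k), φ (borel2Diag (borel2Equiv (t, b))) *
      extendZero (fun p : borel2 k => φ' (borel2Diag p))
        ((swap2 : GL (Fin 2) k)⁻¹ * ((borel2Equiv (t, b) : borel2 k) : GL (Fin 2) k)⁻¹ *
          (swap2 : GL (Fin 2) k)) =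
      if b = 0 then φ t * φ' t⁻¹.swap else 0 := by
    intro t b
    rw [borel2Diag_equiv]
    have h2 : ∀ s z : GL (Fin 2) k, s⁻¹ * z⁻¹ * s = (s⁻¹ * z * s)⁻¹ :=
      fun s z => by simp [mul_assoc]
    rw [h2]
    split_ifs with hb
    · subst hb
      have h3 : (swap2 : GL (Fin 2) k)⁻¹ * ((borel2Equiv (t, 0) : borel2 k) : GL (Fin 2) k) *
          (swap2 : GL (Fin 2) k) =
          ((borel2Equiv (t.swap, 0) : borel2 k) : GL (Fin 2) k) := by
        rw [mul_assoc, inv_mul_eq_iff_eq_mul]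
        refine Units.ext (Matrix.ext fun i j => ?_)
        fin_cases i <;> fin_cases j <;> simp [borel2Equiv, upper2_val, swap2_val]
      rw [h3, ← Subgroup.coe_inv, extendZero_coe, map_inv, borel2Diag_equiv]
      rfl
    · rw [extendZero_of_notMem, mul_zero]
      intro hmem
      have hmem := (borel2 k).inv_mem hmem
      rw [inv_inv] at hmem
      have h4 : ((swap2 : GL (Fin 2) k)⁻¹ * ((borel2Equiv (t, b) : borel2 k) : GL (Fin 2) k) *
          (swap2 : GL (Fin 2) k)).1 =
          !![(t.2 : k), 0; b, (t.1 : k)] := by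
        have h5 : (swap2 : GL (Fin 2) k)⁻¹ = swap2 := by
          rw [inv_eq_iff_mul_eq_one]
          refine Units.ext (Matrix.ext fun i j => ?_)
          fin_cases i <;> fin_cases j <;> simp [swap2_val]
        rw [h5]
        refine Matrix.ext fun i j => ?_
        fin_cases i <;> fin_cases j <;> simp [borel2Equiv, upper2_val, swap2_val]
      rw [mem_borel2, h4] at hmem
      exact hb (by simpa using hmem)
  simp_rw [h1]
  unfold charPair
  simp only [Finset.sum_ite_eq', Finset.mem_univ, if_true, Prod.swap]
  congr 1
  rw [card_GL2, card_borel2, Nat.card_prod]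
  push_cast
  rw [card_units_cast]
  have h0 : (Nat.card k : ℂ) ≠ 0 := by simp
  have h1 := card_sub_one_ne_zero (k := k)
  field_simp
  ring

theorem jac2_indFun (φ : kˣ × kˣ → ℂ) :
    jac2 (indFun fun p : borel2 k => φ (borel2Diag p)) = φ + fun t => φ t.swap := by
  classical
  refine eq_of_charPair_left fun ψ => ?_
  rw [← charPair_borel2, ← charPair_indFun _ (isClassFun_indFun _), charPair_indFun_borel2,
    charPair_add_right]

end GLTwo

section PrincipalSeriesTwo

set_option linter.unusedSectionVars false

theorem eq_or_eq_of_charPair_add_ne_zero {G : Type} [Group G] [Fintype G] {χ χ₁ χ₂ : G → ℂ}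
    (hχ : χ ∈ irrChars G) (h₁ : χ₁ ∈ irrChars G) (h₂ : χ₂ ∈ irrChars G)
    (h : charPair (χ₁ + χ₂) χ ≠ 0) : χ = χ₁ ∨ χ = χ₂ := by
  by_contra! hne
  refine h ?_
  rw [charPair_add_left, charPair_of_ne h₁ hχ hne.1.symm, charPair_of_ne h₂ hχ hne.2.symm, add_zero]

theorem exists_degree_of_mem_irrChars {G : Type} [Group G] [Fintype G] {χ : G → ℂ}
    (hχ : χ ∈ irrChars G) : ∃ d : ℕ, 0 < d ∧ χ 1 = d := by
  obtain ⟨V, hV, rfl⟩ := hχ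
  exact ⟨_, finrank_pos_of_simple hV, V.char_one⟩

variable {k : Type} [Field k]

/-- The composition of a multiplicative character with the determinant. -/
noncomputable def detChar (n : ℕ) (α : MulChar k ℂ) : GL (Fin n) k →* ℂ :=
  (α.toMonoidHom.comp (Units.coeHom k)).comp Matrix.GeneralLinearGroup.det

theorem detChar_apply (n : ℕ) (α : MulChar k ℂ) (g : GL (Fin n) k) :
    detChar n α g = α g.1.det := rfl

/-- The product of two multiplicative characters. -/
noncomputable def tens (α β : MulChar k ℂ) : kˣ × kˣ →* ℂ where
  toFun t := α t.1 * β t.2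
  map_one' := by simp
  map_mul' t t' := by simp only [Prod.fst_mul, Prod.snd_mul, Units.val_mul, map_mul]; ring

theorem tens_apply (α β : MulChar k ℂ) (t : kˣ × kˣ) : tens α β t = α t.1 * β t.2 := rfl

theorem tens_swap (α β : MulChar k ℂ) : (fun t => tens α β t.swap) = tens β α := by
  ext t
  simp [tens_apply, mul_comm]

variable [Fintype k] [DecidableEq k]

theorem charPair_tens [DecidableEq (MulChar k ℂ)] (α β α' β' : MulChar k ℂ) :
    charPair (tens α β) (tens α' β') = (if α = α' then 1 else 0) * (if β = β' then 1 else 0) := by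
  rw [← charPair_mulChar, ← charPair_mulChar, ← charPair_prod]
  rfl

theorem jac2_detChar (α : MulChar k ℂ) : jac2 (detChar 2 α) = tens α α := by
  ext t
  rw [jac2, tens_apply, ← map_mul]
  simp [detChar_apply, upper2_val]

theorem jac2_sub (f g : GL (Fin 2) k → ℂ) : jac2 (f - g) = jac2 f - jac2 g := by
  ext t
  simp [jac2, mul_sub]

/-- The principal series of `GL₂`. -/
noncomputable def ps2 (α β : MulChar k ℂ) : GL (Fin 2) k → ℂ :=
  indFun fun p : borel2 k => tens α β (borel2Diag p)

theorem isVirtualChar_ps2 (α β : MulChar k ℂ) : IsVirtualChar (ps2 α β) :=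
  isVirtualChar_indFun_monoidHom ((tens α β).comp borel2Diag)

theorem jac2_ps2 (α β : MulChar k ℂ) : jac2 (ps2 α β) = tens α β + tens β α := by
  rw [ps2, jac2_indFun, tens_swap]

theorem charPair_ps2_left (α β : MulChar k ℂ) {F : GL (Fin 2) k → ℂ} (hF : IsClassFun F) :
    charPair (ps2 α β) F = charPair (tens α β) (jac2 F) := by
  classical
  rw [ps2, charPair_indFun _ hF, charPair_borel2]

theorem charPair_ps2 [DecidableEq (MulChar k ℂ)] (α β α' β' : MulChar k ℂ) :
    charPair (ps2 α β) (ps2 α' β') =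
      (if α = α' then 1 else 0) * (if β = β' then 1 else 0) +
        (if α = β' then 1 else 0) * (if β = α' then 1 else 0) := by
  rw [charPair_ps2_left _ _ (isVirtualChar_ps2 _ _).1, jac2_ps2, charPair_add_right, charPair_tens,
    charPair_tens]

theorem charPair_ps2_detChar [DecidableEq (MulChar k ℂ)] (α β γ : MulChar k ℂ) :
    charPair (ps2 α β) (detChar 2 γ) =
      (if α = γ then 1 else 0) * (if β = γ then 1 else 0) := by
  rw [charPair_ps2_left _ _ (isClassFun_of_mem_irrChars (monoidHom_mem_irrChars _)), jac2_detChar,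
    charPair_tens]

theorem ps2_one (α β : MulChar k ℂ) : ps2 α β 1 = (Nat.card k : ℂ) + 1 := by
  rw [ps2, indFun_one, card_GL2, card_borel2, Nat.card_prod]
  push_cast
  rw [card_units_cast, map_one, map_one]
  have h0 : (Nat.card k : ℂ) ≠ 0 := by simp
  have h1 := card_sub_one_ne_zero (k := k)
  field_simp
  ring

theorem ps2_comm (α β : MulChar k ℂ) : ps2 α β = ps2 β α := by
  classical
  rw [← sub_eq_zero]
  refine ((isVirtualChar_ps2 α β).sub (isVirtualChar_ps2 β α)).eq_zero ?_
  simp only [charPair_sub_left, charPair_sub_right, charPair_ps2]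
  by_cases h : α = β
  · simp [h]
  · simp [h, Ne.symm h]

theorem detChar_mem_irrChars (n : ℕ) (α : MulChar k ℂ) :
    ⇑(detChar n α) ∈ irrChars (GL (Fin n) k) := monoidHom_mem_irrChars _

/-- The Steinberg character of `GL₂` twisted by a multiplicative character. -/
noncomputable def st2 (α : MulChar k ℂ) : GL (Fin 2) k → ℂ := ps2 α α - detChar 2 α

theorem ps2_self (α : MulChar k ℂ) : ps2 α α = detChar 2 α + st2 α := by
  simp [st2]

theorem st2_one (α : MulChar k ℂ) : st2 α 1 = Nat.card k := by
  rw [st2, Pi.sub_apply, ps2_one, map_one]; ring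

theorem jac2_st2 (α : MulChar k ℂ) : jac2 (st2 α) = tens α α := by
  rw [st2, jac2_sub, jac2_ps2, jac2_detChar, add_sub_cancel_right]

theorem st2_mem_irrChars (α : MulChar k ℂ) : st2 α ∈ irrChars (GL (Fin 2) k) := by
  classical
  refine ((isVirtualChar_ps2 α α).sub
    (isVirtualChar_of_mem_irrChars (detChar_mem_irrChars 2 α))).mem_irrChars ?_ (st2_one α)
  rw [charPair_sub_left, charPair_sub_right, charPair_sub_right, charPair_ps2,
    charPair_comm (detChar 2 α) (ps2 α α), charPair_ps2_detChar,
    charPair_self_of_mem_irrChars (detChar_mem_irrChars 2 α)]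
  simp

theorem ps2_mem_irrChars {α β : MulChar k ℂ} (h : α ≠ β) : ps2 α β ∈ irrChars (GL (Fin 2) k) := by
  classical
  refine (isVirtualChar_ps2 α β).mem_irrChars ?_ (d := Nat.card k + 1) (by simp [ps2_one])
  rw [charPair_ps2]
  simp [h]

theorem exists_tens_charPair_ne_zero {f : kˣ × kˣ → ℂ} (hf : f ≠ 0) :
    ∃ α β : MulChar k ℂ, charPair (tens α β) f ≠ 0 := by
  obtain ⟨⟨a, b⟩, hab⟩ := Function.ne_iff.1 hf
  have h1 : (fun x : kˣ => f (x, b)) ≠ 0 := fun h => hab (congrFun h a)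
  obtain ⟨α, hα⟩ := exists_mulChar_charPair_ne_zero h1
  have h2 : (fun y : kˣ => charPair (fun x : kˣ => f (x, y)) (fun x : kˣ => α x)) ≠ 0 :=
    fun h => hα (congrFun h b)
  obtain ⟨β, hβ⟩ := exists_mulChar_charPair_ne_zero h2
  refine ⟨α, β, fun h => hβ ?_⟩
  rw [charPair_comm] at h
  rw [← h]
  unfold charPair
  rw [Fintype.sum_prod_type_right, Nat.card_prod, Nat.cast_mul, mul_inv, mul_assoc]
  congr 1
  rw [Finset.mul_sum]
  refine Finset.sum_congr rfl fun y _ => ?_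
  rw [mul_assoc, Finset.sum_mul]
  congr 1
  refine Finset.sum_congr rfl fun x _ => ?_
  rw [mul_assoc]
  rfl

theorem irrChars_GL2_cases {σ : GL (Fin 2) k → ℂ} (hσ : σ ∈ irrChars (GL (Fin 2) k)) :
    jac2 σ = 0 ∨ (∃ α, σ = detChar 2 α) ∨ (∃ α, σ = st2 α) ∨ ∃ α β, α ≠ β ∧ σ = ps2 α β := by
  by_cases h0 : jac2 σ = 0
  · exact Or.inl h0
  right
  obtain ⟨α, β, h⟩ := exists_tens_charPair_ne_zero h0
  rw [← charPair_ps2_left _ _ (isClassFun_of_mem_irrChars hσ)] at h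
  by_cases hab : α = β
  · subst hab
    rw [ps2_self] at h
    rcases eq_or_eq_of_charPair_add_ne_zero hσ (detChar_mem_irrChars 2 α) (st2_mem_irrChars α) h
      with h | h
    · exact Or.inl ⟨α, h⟩
    · exact Or.inr (Or.inl ⟨α, h⟩)
  · exact Or.inr (Or.inr ⟨α, β, hab, (eq_of_charPair_ne_zero (ps2_mem_irrChars hab) hσ h).symm⟩)

end PrincipalSeriesTwo

section Gelfand

set_option linter.unusedSectionVars false

theorem exists_multiplicity_le_one {G : Type} [Group G] [Fintype G] {χ : G → ℂ}
    (hχ : χ ∈ irrChars G) {U : Subgroup G} [Fintype U] (ψ : U →* ℂ) (σ : G → G)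
    (hσ : ∀ g h, σ (g * h) = σ h * σ g) (hσU : ∀ u : U, ∃ h : σ u ∈ U, ψ ⟨σ u, h⟩ = ψ u)
    (hσσ : ∀ g, σ (σ g) = g)
    (hg : ∀ g : G, ∃ (u u' : U) (n : G), g = u * n * u' ∧
      (σ n = n ∨ ∃ v v' : U, (v : G) * n = n * v' ∧ ψ v ≠ ψ v')) :
    ∃ m : ℕ, m ≤ 1 ∧ (Nat.card U : ℂ)⁻¹ * ∑ u : U, ψ u⁻¹ * χ u = m := by
  obtain ⟨V, hV, rfl⟩ := hχ
  have hirr := (FDRep.simple_iff_isIrreducible V).1 hV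
  refine ⟨_, finrank_range_charProj_le_one (V.ρ : Representation ℂ G V) ψ hirr σ hσ hσU hσσ hg, ?_⟩
  rw [← trace_charProj, charProj, map_smul, map_sum, smul_eq_mul]
  simp_rw [map_smul, smul_eq_mul]
  rfl

variable {k : Type} [Field k]

/-- The reflection of an invertible matrix in its antidiagonal. -/
noncomputable def antiTranspose {n : ℕ} (g : GL (Fin n) k) : GL (Fin n) k where
  val := g.1.transpose.submatrix Fin.revPerm Fin.revPerm
  inv := (g⁻¹).1.transpose.submatrix Fin.revPerm Fin.revPerm
  val_inv := by
    rw [Matrix.submatrix_mul_equiv, ← Matrix.transpose_mul, ← Units.val_mul]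
    simp
  inv_val := by
    rw [Matrix.submatrix_mul_equiv, ← Matrix.transpose_mul, ← Units.val_mul]
    simp

theorem antiTranspose_apply {n : ℕ} (g : GL (Fin n) k) (i j : Fin n) :
    (antiTranspose g).1 i j = g.1 j.rev i.rev := rfl

theorem antiTranspose_mul {n : ℕ} (g h : GL (Fin n) k) :
    antiTranspose (g * h) = antiTranspose h * antiTranspose g := by
  refine Units.ext ?_
  simp only [antiTranspose, Units.val_mul, Matrix.submatrix_mul_equiv, ← Matrix.transpose_mul]

theorem antiTranspose_antiTranspose {n : ℕ} (g : GL (Fin n) k) :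
    antiTranspose (antiTranspose g) = g := by
  refine Units.ext (Matrix.ext fun i j => ?_)
  simp [antiTranspose_apply]

/-- Unipotent upper triangular matrices of size two. -/
noncomputable def unip2 (k : Type) [Field k] : Subgroup (GL (Fin 2) k) where
  carrier := {g | g.1 0 0 = 1 ∧ g.1 1 0 = 0 ∧ g.1 1 1 = 1}
  mul_mem' {g h} hg hh := by
    simp only [Set.mem_ofPred_eq] at *
    simp [Matrix.mul_apply, Fin.sum_univ_two, hg, hh]
  one_mem' := by simp
  inv_mem' {g} hg := by
    simp only [Set.mem_ofPred_eq] at *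
    rw [Matrix.coe_units_inv, Matrix.inv_def, Matrix.adjugate_fin_two, Matrix.det_fin_two]
    simp [hg]

theorem mem_unip2 {g : GL (Fin 2) k} :
    g ∈ unip2 k ↔ g.1 0 0 = 1 ∧ g.1 1 0 = 0 ∧ g.1 1 1 = 1 := Iff.rfl

/-- Coordinates on the unipotent group of size two. -/
noncomputable def unip2Equiv : k ≃ unip2 k where
  toFun b := ⟨upper2 1 1 b, by simp [mem_unip2, upper2_val]⟩
  invFun u := u.1.1 0 1
  left_inv b := by simp [upper2_val]
  right_inv u := by
    obtain ⟨h1, h2, h3⟩ := mem_unip2.1 u.2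
    refine Subtype.ext (Units.ext (Matrix.ext fun i j => ?_))
    fin_cases i <;> fin_cases j <;> simp [upper2_val, h1, h2, h3]

theorem unip2Equiv_val (b : k) : (unip2Equiv b : GL (Fin 2) k).1 = !![1, b; 0, 1] := by
  simp [unip2Equiv, upper2_val]

/-- The generic character of the unipotent group of size two. -/
noncomputable def unip2Char (ψ : AddChar k ℂ) : unip2 k →* ℂ where
  toFun u := ψ (u.1.1 0 1)
  map_one' := by simp
  map_mul' u v := by
    obtain ⟨h1, h2, h3⟩ := mem_unip2.1 u.2
    obtain ⟨h1', h2', h3'⟩ := mem_unip2.1 v.2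
    rw [← AddChar.map_add_eq_mul]
    simp [Matrix.mul_apply, Fin.sum_univ_two, h1, h3', add_comm]

theorem unip2Char_equiv (ψ : AddChar k ℂ) (b : k) : unip2Char ψ (unip2Equiv b) = ψ b := by
  simp [unip2Char, unip2Equiv_val]

theorem AddChar.exists_ne_mul {ψ : AddChar k ℂ} (hψ : ψ ≠ 1) {c d : k} (h : c ≠ d) :
    ∃ t, ψ (t * c) ≠ ψ (t * d) := by
  obtain ⟨s, hs⟩ := (AddChar.ne_one_iff).1 hψ
  have h' := sub_ne_zero.2 h
  refine ⟨s / (c - d), fun h1 => hs ?_⟩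
  have h2 : ψ (s / (c - d) * c - s / (c - d) * d) = 1 := by
    rw [AddChar.map_sub_eq_div, h1, div_self]
    intro h3
    have h4 := AddChar.map_add_eq_mul ψ (s / (c - d) * d) (-(s / (c - d) * d))
    rw [add_neg_cancel, AddChar.map_zero_eq_one, h3, zero_mul] at h4
    exact one_ne_zero h4
  rwa [← mul_sub, div_mul_cancel₀ _ h'] at h2

theorem unip2_bruhat {ψ : AddChar k ℂ} (hψ : ψ ≠ 1) (g : GL (Fin 2) k) :
    ∃ (u u' : unip2 k) (n : GL (Fin 2) k), g = u * n * u' ∧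
      (antiTranspose n = n ∨ ∃ v v' : unip2 k, (v : GL (Fin 2) k) * n = n * v' ∧
        unip2Char ψ v ≠ unip2Char ψ v') := by
  have hdet : g.1.det ≠ 0 := (Matrix.isUnit_iff_isUnit_det _).1 g.isUnit |>.ne_zero
  rw [Matrix.det_fin_two] at hdet
  by_cases hc : g.1 1 0 = 0
  · rw [hc, mul_zero, sub_zero] at hdet
    obtain ⟨ha, hd⟩ := mul_ne_zero_iff.1 hdet
    refine ⟨unip2Equiv (g.1 0 1 / g.1 1 1), 1, upper2 (Units.mk0 _ ha) (Units.mk0 _ hd) 0,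
      Units.ext (Matrix.ext fun i j => ?_), ?_⟩
    · fin_cases i <;> fin_cases j <;> simp [unip2Equiv_val, upper2_val, hc, hd]
    · by_cases had : g.1 0 0 = g.1 1 1
      · left
        refine Units.ext (Matrix.ext fun i j => ?_)
        fin_cases i <;> fin_cases j <;> simp [antiTranspose_apply, upper2_val, had]
      · right
        obtain ⟨t, ht⟩ := AddChar.exists_ne_mul hψ had
        refine ⟨unip2Equiv (t * g.1 0 0), unip2Equiv (t * g.1 1 1),
          Units.ext (Matrix.ext fun i j => ?_), by rwa [unip2Char_equiv, unip2Char_equiv]⟩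
        fin_cases i <;> fin_cases j <;> simp [unip2Equiv_val, upper2_val]
        ring
  · refine ⟨unip2Equiv (g.1 0 0 / g.1 1 0), unip2Equiv (g.1 1 1 / g.1 1 0),
      Matrix.GeneralLinearGroup.mkOfDetNeZero
        !![0, g.1 0 1 - g.1 0 0 * g.1 1 1 / g.1 1 0; g.1 1 0, 0] ?_,
      Units.ext (Matrix.ext fun i j => ?_), Or.inl ?_⟩
    · rw [Matrix.det_fin_two]
      simp only [Matrix.of_apply, Matrix.cons_val', Matrix.cons_val_zero, Matrix.cons_val_one,
        Matrix.cons_val_fin_one]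
      intro h
      field_simp at h
      exact hdet (by linear_combination h)
    · fin_cases i <;> fin_cases j <;>
        simp [unip2Equiv_val, Matrix.GeneralLinearGroup.mkOfDetNeZero, hc] <;> field_simp <;>
        try ring
    · refine Units.ext (Matrix.ext fun i j => ?_)
      fin_cases i <;> fin_cases j <;>
        simp [antiTranspose_apply, Matrix.GeneralLinearGroup.mkOfDetNeZero]

theorem exists_addChar_ne_one (k : Type) [Field k] [Fintype k] : ∃ ψ : AddChar k ℂ, ψ ≠ 1 := by
  obtain ⟨ψ, hψ⟩ := AddChar.exists_apply_ne_zero.2 (one_ne_zero (α := k))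
  exact ⟨ψ, AddChar.ne_one_iff.2 ⟨_, hψ⟩⟩

theorem conj_upper2 {χ : GL (Fin 2) k → ℂ} (hχ : IsClassFun χ) {b : k} (hb : b ≠ 0) :
    χ (upper2 1 1 b) = χ (upper2 1 1 1) := by
  rw [← hχ _ (upper2 (Units.mk0 b hb)⁻¹ 1 0)]
  congr 1
  rw [mul_inv_eq_iff_eq_mul]
  refine Units.ext (Matrix.ext fun i j => ?_)
  fin_cases i <;> fin_cases j <;> simp [upper2_val, hb]

variable [Fintype k] [DecidableEq k]

theorem sum_eq_add_mul_of_ne {F : k → ℂ} {x y : ℂ} (h0 : F 0 = x) (h : ∀ b, b ≠ 0 → F b = y)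
    (φ : k → ℂ) : ∑ b, φ b * F b = φ 0 * (x - y) + (∑ b, φ b) * y := by
  have h1 : ∀ b, φ b * F b = (if b = 0 then φ 0 * (x - y) else 0) + φ b * y := by
    intro b
    split_ifs with hb
    · rw [hb, h0]; ring
    · rw [h b hb]; ring
  simp_rw [h1]
  rw [Finset.sum_add_distrib, ← Finset.sum_mul]
  simp

theorem cuspidal_degree_GL2 {χ : GL (Fin 2) k → ℂ} (hχ : χ ∈ irrChars (GL (Fin 2) k))
    (h : jac2 χ = 0) : χ 1 = (Nat.card k : ℂ) - 1 := by
  classical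
  obtain ⟨ψ, hψ⟩ := exists_addChar_ne_one k
  have hcl := isClassFun_of_mem_irrChars hχ
  have h0 : (Nat.card k : ℂ) ≠ 0 := by simp
  have h1 := card_sub_one_ne_zero (k := k)
  have hF0 : χ (upper2 1 1 0) = χ 1 := by
    congr 1
    refine Units.ext (Matrix.ext fun i j => ?_)
    fin_cases i <;> fin_cases j <;> simp [upper2_val]
  have hF : ∀ b : k, b ≠ 0 → χ (upper2 1 1 b) = χ (upper2 1 1 1) := fun b hb => conj_upper2 hcl hb
  have hJ : ∑ b : k, 1 * χ (upper2 1 1 b) = 0 := by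
    have h2 := congrFun h 1
    rw [jac2, Pi.zero_apply, mul_eq_zero] at h2
    simpa using h2.resolve_left (inv_ne_zero h0)
  rw [sum_eq_add_mul_of_ne hF0 hF (fun _ => 1)] at hJ
  obtain ⟨m, hm, hm'⟩ := exists_multiplicity_le_one hχ (unip2Char ψ) antiTranspose
    antiTranspose_mul (fun u => by
      obtain ⟨h1, h2, h3⟩ := mem_unip2.1 u.2
      refine ⟨?_, ?_⟩
      · simp [mem_unip2, antiTranspose_apply, h1, h2, h3]
      · simp [unip2Char, antiTranspose_apply]) antiTranspose_antiTranspose (unip2_bruhat hψ)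
  have hinv : ∀ b : k, (unip2Equiv b)⁻¹ = unip2Equiv (-b) := by
    intro b
    rw [inv_eq_iff_mul_eq_one]
    refine Subtype.ext (Units.ext (Matrix.ext fun i j => ?_))
    fin_cases i <;> fin_cases j <;> simp [unip2Equiv_val]
  rw [← Equiv.sum_comp unip2Equiv, ← Nat.card_congr unip2Equiv] at hm'
  simp_rw [hinv, unip2Char_equiv] at hm'
  have h3 := sum_eq_add_mul_of_ne hF0 hF (fun b => ψ (-b))
  have h4 : ∑ b : k, ψ (-b) = 0 := by
    rw [← AddChar.sum_eq_zero_of_ne_one hψ]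
    exact Fintype.sum_equiv (Equiv.neg k) _ _ fun _ => rfl
  rw [h4, neg_zero, AddChar.map_zero_eq_one] at h3
  have h5 : ∑ b : k, ψ (-b) * χ ((unip2Equiv b : unip2 k) : GL (Fin 2) k) =
    ∑ b : k, ψ (-b) * χ (upper2 1 1 b) := rfl
  rw [h5, h3] at hm'
  obtain ⟨d, hd, hd'⟩ := exists_degree_of_mem_irrChars hχ
  simp only [Finset.sum_const, Finset.card_univ, nsmul_eq_mul, mul_one,
    ← Nat.card_eq_fintype_card] at hJ
  have h6 : χ 1 = ((Nat.card k : ℂ) - 1) * m := by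
    field_simp at hm'
    have h7 : (Nat.card k : ℂ) * (χ 1 - ((Nat.card k : ℂ) - 1) * m) = 0 := by
      linear_combination ((Nat.card k : ℂ) - 1) * hm' + hJ
    exact sub_eq_zero.1 ((mul_eq_zero.1 h7).resolve_left h0)
  interval_cases m
  · rw [Nat.cast_zero, mul_zero, hd', Nat.cast_eq_zero] at h6
    omega
  · simpa using h6

end Gelfand

section Parabolic

set_option linter.unusedSectionVars false

variable {k : Type} [Field k]

theorem Matrix.GeneralLinearGroup.val_det_ne_zero {n : ℕ} (g : GL (Fin n) k) : g.1.det ≠ 0 :=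
  (Matrix.isUnit_iff_isUnit_det _).1 g.isUnit |>.ne_zero

/-- The maximal parabolic subgroup of `GL₃` with Levi factor `GL₂ × GL₁`. -/
noncomputable def par3 (k : Type) [Field k] : Subgroup (GL (Fin 3) k) where
  carrier := {g | g.1 2 0 = 0 ∧ g.1 2 1 = 0}
  mul_mem' {g h} hg hh := by
    simp only [Set.mem_ofPred_eq] at *
    simp [Matrix.mul_apply, Fin.sum_univ_three, hg, hh]
  one_mem' := by simp
  inv_mem' {g} hg := by
    simp only [Set.mem_ofPred_eq] at *
    rw [Matrix.coe_units_inv, Matrix.inv_def, Matrix.adjugate_fin_three]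
    simp [hg]

theorem mem_par3 {g : GL (Fin 3) k} : g ∈ par3 k ↔ g.1 2 0 = 0 ∧ g.1 2 1 = 0 := Iff.rfl

/-- The projection of the parabolic subgroup to its Levi factor. -/
noncomputable def par3Levi : par3 k →* GL (Fin 2) k × kˣ :=
  MonoidHom.prod
    (MonoidHom.toHomUnits
      { toFun := fun p : par3 k =>
          (!![p.1.1 0 0, p.1.1 0 1; p.1.1 1 0, p.1.1 1 1] : Matrix (Fin 2) (Fin 2) k)
        map_one' := by
          refine Matrix.ext fun i j => ?_
          fin_cases i <;> fin_cases j <;> simp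
        map_mul' := fun p p' => by
          obtain ⟨h1, h2⟩ := mem_par3.1 p'.2
          refine Matrix.ext fun i j => ?_
          fin_cases i <;> fin_cases j <;>
            simp [Matrix.mul_apply, Fin.sum_univ_three, h1, h2] })
    (MonoidHom.toHomUnits
      { toFun := fun p : par3 k => p.1.1 2 2
        map_one' := by simp
        map_mul' := fun p p' => by
          obtain ⟨h1, h2⟩ := mem_par3.1 p.2
          simp [Matrix.mul_apply, Fin.sum_univ_three, h1, h2] })

theorem par3Levi_fst (p : par3 k) :
    (par3Levi p).1.1 = !![p.1.1 0 0, p.1.1 0 1; p.1.1 1 0, p.1.1 1 1] := rfl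

theorem par3Levi_snd (p : par3 k) : ((par3Levi p).2 : k) = p.1.1 2 2 := rfl

/-- A block upper triangular matrix of size three. -/
noncomputable def block3 (A : GL (Fin 2) k) (f : kˣ) (v : k × k) : GL (Fin 3) k :=
  Matrix.GeneralLinearGroup.mkOfDetNeZero
    !![A.1 0 0, A.1 0 1, v.1; A.1 1 0, A.1 1 1, v.2; 0, 0, (f : k)] (by
      have h := A.val_det_ne_zero
      rw [Matrix.det_fin_two] at h
      rw [Matrix.det_fin_three]
      simpa [← sub_mul] using h)

theorem block3_val (A : GL (Fin 2) k) (f : kˣ) (v : k × k) :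
    (block3 A f v).1 = !![A.1 0 0, A.1 0 1, v.1; A.1 1 0, A.1 1 1, v.2; 0, 0, (f : k)] := rfl

/-- Coordinates on the parabolic subgroup. -/
noncomputable def par3Equiv : (GL (Fin 2) k × kˣ) × (k × k) ≃ par3 k where
  toFun x := ⟨block3 x.1.1 x.1.2 x.2, by simp [mem_par3, block3_val]⟩
  invFun p := (par3Levi p, (p.1.1 0 2, p.1.1 1 2))
  left_inv x := by
    refine Prod.ext (Prod.ext (Units.ext (Matrix.ext fun i j => ?_)) (Units.ext ?_)) ?_
    · fin_cases i <;> fin_cases j <;> simp [par3Levi_fst, block3_val]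
    · simp [par3Levi_snd, block3_val]
    · simp [block3_val]
  right_inv p := by
    obtain ⟨h1, h2⟩ := mem_par3.1 p.2
    refine Subtype.ext (Units.ext (Matrix.ext fun i j => ?_))
    fin_cases i <;> fin_cases j <;> simp [par3Levi_fst, par3Levi_snd, block3_val, h1, h2]

theorem par3Equiv_val (x : (GL (Fin 2) k × kˣ) × (k × k)) :
    (par3Equiv x : GL (Fin 3) k) = block3 x.1.1 x.1.2 x.2 := rfl

theorem par3Levi_equiv (x : (GL (Fin 2) k × kˣ) × (k × k)) : par3Levi (par3Equiv x) = x.1 :=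
  congrArg Prod.fst (par3Equiv.symm_apply_apply x)

theorem par3Levi_surjective : Function.Surjective (par3Levi (k := k)) := fun x =>
  ⟨par3Equiv (x, 0), par3Levi_equiv _⟩

/-- The permutation matrix exchanging the last two basis vectors. -/
noncomputable def swap3 : GL (Fin 3) k :=
  Matrix.GeneralLinearGroup.mkOfDetNeZero !![1, 0, 0; 0, 0, 1; 0, 1, 0]
    (by rw [Matrix.det_fin_three]; simp)

theorem swap3_val : (swap3 : GL (Fin 3) k).1 = !![1, 0, 0; 0, 0, 1; 0, 1, 0] := rfl

theorem swap3_inv : (swap3 : GL (Fin 3) k)⁻¹ = swap3 := by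
  rw [inv_eq_iff_mul_eq_one]
  refine Units.ext (Matrix.ext fun i j => ?_)
  fin_cases i <;> fin_cases j <;> simp [swap3_val, Matrix.mul_apply, Fin.sum_univ_three]

theorem mem_par3_of_row_eq {z y : GL (Fin 3) k} (h : z.1 2 = y.1 2) : z * y⁻¹ ∈ par3 k := by
  have h1 : (z * y⁻¹).1 2 = (1 : Matrix (Fin 3) (Fin 3) k) 2 := by
    have h2 : (y * y⁻¹).1 2 = (1 : Matrix (Fin 3) (Fin 3) k) 2 := by
      rw [mul_inv_cancel, Units.val_one]
    rw [← h2]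
    funext j
    simp only [Units.val_mul, Matrix.mul_apply]
    rw [h]
  rw [mem_par3, h1]
  simp

theorem exists_eq_par3_swap3 (z : GL (Fin 3) k) (hz : z ∉ par3 k) :
    ∃ p p' : par3 k, z = (p : GL (Fin 3) k) * swap3 * (p' : GL (Fin 3) k) := by
  obtain ⟨A, hA1, hA2⟩ : ∃ A : GL (Fin 2) k, A.1 1 0 = z.1 2 0 ∧ A.1 1 1 = z.1 2 1 := by
    by_cases h : z.1 2 0 = 0
    · have h' : z.1 2 1 ≠ 0 := fun h' => hz ⟨h, h'⟩
      exact ⟨Matrix.GeneralLinearGroup.mkOfDetNeZero !![1, 0; z.1 2 0, z.1 2 1] (by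
        rw [Matrix.det_fin_two]; simpa using h'), rfl, rfl⟩
    · exact ⟨Matrix.GeneralLinearGroup.mkOfDetNeZero !![0, 1; z.1 2 0, z.1 2 1] (by
        rw [Matrix.det_fin_two]; simpa using h), rfl, rfl⟩
  set p' : par3 k := par3Equiv ((A, 1), (0, z.1 2 2)) with hp'
  refine ⟨⟨z * (swap3 * (p' : GL (Fin 3) k))⁻¹, mem_par3_of_row_eq ?_⟩, p', by
    simp [mul_assoc]⟩
  funext j
  fin_cases j <;>
    simp [hp', par3Equiv_val, block3_val, swap3_val, Matrix.mul_apply, Fin.sum_univ_three, hA1, hA2]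

theorem isClassFun_comp_par3Levi {Φ : GL (Fin 2) k × kˣ → ℂ} (hΦ : IsClassFun Φ) :
    IsClassFun (fun p : par3 k => Φ (par3Levi p)) := fun g h => by
  simp only [map_mul, map_inv]
  exact hΦ _ _

variable [Fintype k] [DecidableEq k]

theorem card_par3 : Nat.card (par3 k) =
    Nat.card (GL (Fin 2) k × kˣ) * Nat.card (k × k) := by
  rw [← Nat.card_congr par3Equiv, Nat.card_prod]

theorem card_GL3 : (Nat.card (GL (Fin 3) k) : ℂ) =
    ((Nat.card k : ℂ) ^ 3 - 1) * ((Nat.card k : ℂ) ^ 3 - Nat.card k) *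
      ((Nat.card k : ℂ) ^ 3 - (Nat.card k : ℂ) ^ 2) := by
  have h1 : 1 ≤ Fintype.card k := Fintype.card_pos
  rw [Matrix.card_GL_field, Fin.prod_univ_three, Nat.card_eq_fintype_card, Nat.cast_mul,
    Nat.cast_mul, Nat.cast_sub (Nat.pow_le_pow_right h1 (by simp)),
    Nat.cast_sub (Nat.pow_le_pow_right h1 (by simp)),
    Nat.cast_sub (Nat.pow_le_pow_right h1 (by simp))]
  simp

theorem card_add_one_ne_zero : (Nat.card k : ℂ) + 1 ≠ 0 := by
  exact_mod_cast Nat.succ_ne_zero (Nat.card k)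

theorem card_par3_cast : (Nat.card (par3 k) : ℂ) =
    ((Nat.card k : ℂ) ^ 2 - 1) * ((Nat.card k : ℂ) ^ 2 - Nat.card k) * (Nat.card k - 1) *
      (Nat.card k : ℂ) ^ 2 := by
  rw [card_par3, Nat.card_prod, Nat.card_prod]
  push_cast
  rw [card_GL2, card_units_cast]
  ring

theorem sum_par3 [Fintype (par3 k)] (F : par3 k → ℂ) :
    ∑ p, F p = ∑ t : GL (Fin 2) k × kˣ, ∑ v : k × k, F (par3Equiv (t, v)) := by
  rw [← Equiv.sum_comp par3Equiv, Fintype.sum_prod_type]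

/-- The Jacquet restriction from `GL₃` to the Levi factor `GL₂ × GL₁`. -/
noncomputable def jac3 (f : GL (Fin 3) k → ℂ) (t : GL (Fin 2) k × kˣ) : ℂ :=
  (Nat.card (k × k) : ℂ)⁻¹ * ∑ v, f (block3 t.1 t.2 v)

theorem charPair_par3 [Fintype (par3 k)] (Φ : GL (Fin 2) k × kˣ → ℂ) (F : GL (Fin 3) k → ℂ) :
    charPair (fun p : par3 k => Φ (par3Levi p)) (fun p => F p) = charPair Φ (jac3 F) := by
  rw [charPair_comm, charPair_comm Φ]
  unfold charPair
  rw [sum_par3, card_par3, Nat.cast_mul, mul_inv, mul_assoc, Finset.mul_sum]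
  congr 1
  refine Finset.sum_congr rfl fun t _ => ?_
  rw [jac3, mul_assoc, Finset.sum_mul]
  congr 1
  refine Finset.sum_congr rfl fun b _ => ?_
  simp only [map_inv, par3Levi_equiv]
  rfl

theorem charPair_par3_par3 [Fintype (par3 k)] (Φ Φ' : GL (Fin 2) k × kˣ → ℂ) :
    charPair (fun p : par3 k => Φ (par3Levi p)) (fun p => Φ' (par3Levi p)) = charPair Φ Φ' := by
  unfold charPair
  rw [sum_par3, card_par3, Nat.cast_mul, mul_inv]
  simp only [map_inv, par3Levi_equiv, Finset.sum_const, Finset.card_univ, nsmul_eq_mul,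
    ← Finset.mul_sum]
  rw [Nat.card_eq_fintype_card (α := k × k)]
  have : (Fintype.card (k × k) : ℂ) ≠ 0 := by simp
  field_simp

theorem isClassFun_jac3 {F : GL (Fin 3) k → ℂ} (hF : IsClassFun F) : IsClassFun (jac3 F) := by
  classical
  have h1 : ∀ t, jac3 F t =
      (Nat.card (k × k) : ℂ)⁻¹ * ∑ p : par3 k, if par3Levi p = t then F p else 0 := by
    intro t
    rw [sum_par3, jac3, Finset.sum_comm]
    simp_rw [par3Levi_equiv]
    simp [par3Equiv_val]
  intro t s
  obtain ⟨b, rfl⟩ := par3Levi_surjective s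
  rw [h1, h1, ← Equiv.sum_comp (MulAut.conj b).toEquiv]
  congr 1
  refine Finset.sum_congr rfl fun p _ => ?_
  simp only [MulEquiv.toEquiv_eq_coe, EquivLike.coe_coe, MulAut.conj_apply, map_mul, map_inv,
    mul_left_inj, mul_right_inj, Subgroup.coe_mul, Subgroup.coe_inv, hF _ _]

/-- The function on the torus attached to a function on the diagonal torus of `GL₂` and a
multiplicative character. -/
noncomputable def torusFun (J : kˣ × kˣ → ℂ) (χ : MulChar k ℂ) (t : kˣ × kˣ × kˣ) : ℂ :=
  J (t.1, t.2.1) * χ t.2.2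

/-- The contribution of the nontrivial double coset to the Mackey formula. -/
noncomputable def mack (J : kˣ × kˣ → ℂ) (χ : MulChar k ℂ) (J' : kˣ × kˣ → ℂ)
    (χ' : MulChar k ℂ) : ℂ :=
  charPair (torusFun J χ) (fun t => torusFun J' χ' (t.1, t.2.2, t.2.1))

theorem mack_add_left (J₁ J₂ : kˣ × kˣ → ℂ) (χ : MulChar k ℂ) (J' : kˣ × kˣ → ℂ)
    (χ' : MulChar k ℂ) : mack (J₁ + J₂) χ J' χ' = mack J₁ χ J' χ' + mack J₂ χ J' χ' := by
  unfold mack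
  rw [← charPair_add_left]
  congr 1
  ext t
  simp [torusFun, add_mul]

theorem mack_add_right (J₁ J₂ : kˣ × kˣ → ℂ) (χ : MulChar k ℂ) (J : kˣ × kˣ → ℂ)
    (χ' : MulChar k ℂ) : mack J χ (J₁ + J₂) χ' = mack J χ J₁ χ' + mack J χ J₂ χ' := by
  unfold mack
  rw [← charPair_add_right]
  congr 1
  ext t
  simp [torusFun, add_mul]

theorem mack_zero_left (χ : MulChar k ℂ) (J' : kˣ × kˣ → ℂ) (χ' : MulChar k ℂ) :
    mack 0 χ J' χ' = 0 := by
  simp [mack, torusFun, charPair]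

theorem mack_tens [DecidableEq (MulChar k ℂ)] (α β γ α' β' γ' : MulChar k ℂ) :
    mack (tens α β) γ (tens α' β') γ' = (if α = α' then 1 else 0) *
      ((if β = γ' then 1 else 0) * (if γ = β' then 1 else 0)) := by
  rw [← charPair_mulChar, ← charPair_mulChar β, ← charPair_mulChar γ, ← charPair_prod,
    ← charPair_prod]
  unfold mack
  congr 1 <;> ext t <;> simp only [torusFun, tens_apply] <;> ring

/-- The outer product of a function on `GL₂` and a multiplicative character. -/
noncomputable def outer (σ : GL (Fin 2) k → ℂ) (χ : MulChar k ℂ) (t : GL (Fin 2) k × kˣ) : ℂ :=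
  σ t.1 * χ t.2

/-- Harish-Chandra induction from `GL₂ × GL₁` to `GL₃`. -/
noncomputable def indPar (σ : GL (Fin 2) k → ℂ) (χ : MulChar k ℂ) : GL (Fin 3) k → ℂ :=
  indFun fun p : par3 k => outer σ χ (par3Levi p)

theorem isClassFun_outer {σ : GL (Fin 2) k → ℂ} (hσ : IsClassFun σ) (χ : MulChar k ℂ) :
    IsClassFun (outer σ χ) := fun g h => by
  simp only [outer, Prod.fst_mul, Prod.snd_mul, Prod.fst_inv, Prod.snd_inv, hσ _ _,
    mul_inv_cancel_comm]

theorem charPair_outer [DecidableEq (MulChar k ℂ)] (σ σ' : GL (Fin 2) k → ℂ) (χ χ' : MulChar k ℂ) :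
    charPair (outer σ χ) (outer σ' χ') = charPair σ σ' * (if χ = χ' then 1 else 0) := by
  rw [← charPair_mulChar, ← charPair_prod]
  rfl

theorem isVirtualChar_indPar {σ : GL (Fin 2) k → ℂ} (hσ : σ ∈ irrChars (GL (Fin 2) k))
    (χ : MulChar k ℂ) : IsVirtualChar (indPar σ χ) := by
  classical
  obtain ⟨V, hV, rfl⟩ := hσ
  have h := isVirtualChar_indFun (P := par3 k)
    (twistRep ((χ.toMonoidHom.comp (Units.coeHom k)).comp ((MonoidHom.snd _ _).comp par3Levi))
      ((V.ρ : Representation ℂ (GL (Fin 2) k) V).comp ((MonoidHom.fst _ _).comp par3Levi)))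
  convert h using 1
  unfold indPar
  congr 1
  ext p
  rw [trace_twistRep, mul_comm]
  rfl

theorem indPar_add (σ σ' : GL (Fin 2) k → ℂ) (χ : MulChar k ℂ) :
    indPar (σ + σ') χ = indPar σ χ + indPar σ' χ := by
  classical
  ext g
  unfold indPar indFun
  rw [Pi.add_apply, ← mul_add, ← Finset.sum_add_distrib]
  congr 1
  refine Finset.sum_congr rfl fun x _ => ?_
  unfold extendZero
  split_ifs
  · simp [outer, add_mul]
  · simp

theorem card_GL3_div_card_par3 : (Nat.card (GL (Fin 3) k) : ℂ) / Nat.card (par3 k) =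
    (Nat.card k : ℂ) ^ 2 + Nat.card k + 1 := by
  rw [card_GL3, card_par3_cast]
  have h0 : (Nat.card k : ℂ) ≠ 0 := by simp
  have h1 := card_sub_one_ne_zero (k := k)
  have h2 := card_add_one_ne_zero (k := k)
  have h3 : ((Nat.card k : ℂ) ^ 2 - 1) ≠ 0 := by
    rw [show (Nat.card k : ℂ) ^ 2 - 1 = (Nat.card k - 1) * (Nat.card k + 1) by ring]
    exact mul_ne_zero h1 h2
  field_simp
  ring

theorem indPar_one (σ : GL (Fin 2) k → ℂ) (χ : MulChar k ℂ) :
    indPar σ χ 1 = ((Nat.card k : ℂ) ^ 2 + Nat.card k + 1) * σ 1 := by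
  rw [indPar, indFun_one, card_GL3_div_card_par3, map_one, outer]
  simp

theorem charPair_indPar_left {σ : GL (Fin 2) k → ℂ} {χ : MulChar k ℂ} {F : GL (Fin 3) k → ℂ}
    (hF : IsClassFun F) : charPair (indPar σ χ) F = charPair (outer σ χ) (jac3 F) := by
  classical
  rw [indPar, charPair_indFun _ hF, charPair_par3]

theorem exists_indPar_charPair_ne_zero {F : GL (Fin 3) k → ℂ} (hF : IsClassFun F)
    (h : jac3 F ≠ 0) : ∃ σ ∈ irrChars (GL (Fin 2) k), ∃ χ : MulChar k ℂ,
      charPair (indPar σ χ) F ≠ 0 := by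
  obtain ⟨⟨A, f⟩, hAf⟩ := Function.ne_iff.1 h
  have h1 : (fun x : kˣ => jac3 F (A, x)) ≠ 0 := fun h => hAf (congrFun h f)
  obtain ⟨χ, hχ⟩ := exists_mulChar_charPair_ne_zero h1
  have h2 : (fun B => charPair (fun x : kˣ => jac3 F (B, x)) (fun x : kˣ => χ x)) ≠ 0 :=
    fun h => hχ (congrFun h A)
  have h3 : IsClassFun (fun B => charPair (fun x : kˣ => jac3 F (B, x)) (fun x : kˣ => χ x)) := by
    intro B C
    have h4 : ∀ x : kˣ, jac3 F (C * B * C⁻¹, x) = jac3 F (B, x) := fun x => by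
      have := isClassFun_jac3 hF (B, x) (C, 1)
      simpa using this
    simp only [h4]
  obtain ⟨σ, hσ, hσ'⟩ := exists_charPair_ne_zero h3 h2
  refine ⟨σ, hσ, χ, fun h => hσ' ?_⟩
  rw [charPair_indPar_left hF, charPair_comm] at h
  rw [← h]
  unfold charPair
  rw [Fintype.sum_prod_type, Nat.card_prod, Nat.cast_mul, mul_inv, mul_assoc]
  congr 1
  rw [Finset.mul_sum]
  refine Finset.sum_congr rfl fun y _ => ?_
  rw [mul_assoc, Finset.sum_mul]
  congr 1
  refine Finset.sum_congr rfl fun x _ => ?_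
  rw [mul_assoc, mul_comm (χ _)]
  rfl

end Parabolic

section Mackey

set_option linter.unusedSectionVars false

variable {k : Type} [Field k]

theorem swap3_conj_val (g : GL (Fin 3) k) :
    (swap3⁻¹ * g * swap3).1 = !![g.1 0 0, g.1 0 2, g.1 0 1; g.1 2 0, g.1 2 2, g.1 2 1;
      g.1 1 0, g.1 1 2, g.1 1 1] := by
  rw [swap3_inv]
  refine Matrix.ext fun i j => ?_
  fin_cases i <;> fin_cases j <;>
    simp [swap3_val, Matrix.mul_apply, Matrix.vecMul, dotProduct, Fin.sum_univ_three]

/-- The elements of the parabolic subgroup conjugated into it by the permutation. -/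
noncomputable def swapParam (x : (kˣ × kˣ × kˣ) × (k × k)) : par3 k :=
  par3Equiv ((upper2 x.1.1 x.1.2.1 x.2.1, x.1.2.2), (x.2.2, 0))

theorem swapParam_val (x : (kˣ × kˣ × kˣ) × (k × k)) : (swapParam x : GL (Fin 3) k).1 =
    !![(x.1.1 : k), x.2.1, x.2.2; 0, (x.1.2.1 : k), 0; 0, 0, (x.1.2.2 : k)] := by
  simp [swapParam, par3Equiv_val, block3_val, upper2_val]

theorem swapParam_injective : Function.Injective (swapParam (k := k)) := by
  intro x y h
  have h1 : (swapParam x : GL (Fin 3) k).1 = (swapParam y : GL (Fin 3) k).1 := by rw [h]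
  rw [swapParam_val, swapParam_val] at h1
  have e := fun i j => congrFun (congrFun h1 i) j
  refine Prod.ext (Prod.ext (Units.ext ?_) (Prod.ext (Units.ext ?_) (Units.ext ?_)))
    (Prod.ext ?_ ?_)
  · simpa using e 0 0
  · simpa using e 1 1
  · simpa using e 2 2
  · simpa using e 0 1
  · simpa using e 0 2

theorem swap3_conj_swapParam (x : (kˣ × kˣ × kˣ) × (k × k)) :
    swap3⁻¹ * (swapParam x : GL (Fin 3) k) * swap3 =
      (swapParam ((x.1.1, x.1.2.2, x.1.2.1), x.2.swap) : GL (Fin 3) k) := by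
  refine Units.ext ?_
  rw [swap3_conj_val, swapParam_val, swapParam_val]
  simp

theorem mem_range_swapParam (p : par3 k) (h : swap3⁻¹ * (p : GL (Fin 3) k) * swap3 ∈ par3 k) :
    p ∈ Set.range (swapParam (k := k)) := by
  rw [mem_par3, swap3_conj_val] at h
  have h1 : p.1.1 1 0 = 0 ∧ p.1.1 1 2 = 0 := by simpa using h
  obtain ⟨h2, h3⟩ := mem_par3.1 p.2
  have hdet := p.1.val_det_ne_zero
  rw [Matrix.det_fin_three, h1.1, h1.2, h2, h3] at hdet
  have h4 : p.1.1 0 0 * p.1.1 1 1 * p.1.1 2 2 ≠ 0 := fun h => hdet (by rw [h]; ring)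
  obtain ⟨h5, hf⟩ := mul_ne_zero_iff.1 h4
  obtain ⟨ha, hd⟩ := mul_ne_zero_iff.1 h5
  refine ⟨((Units.mk0 _ ha, Units.mk0 _ hd, Units.mk0 _ hf), (p.1.1 0 1, p.1.1 0 2)),
    Subtype.ext (Units.ext ?_)⟩
  rw [swapParam_val]
  refine Matrix.ext fun i j => ?_
  fin_cases i <;> fin_cases j <;> simp [h1, h2, h3]

theorem par3Levi_swapParam (x : (kˣ × kˣ × kˣ) × (k × k)) :
    par3Levi (swapParam x) = (upper2 x.1.1 x.1.2.1 x.2.1, x.1.2.2) := par3Levi_equiv _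

theorem upper2_inv (a d : kˣ) (b : k) :
    (upper2 a d b)⁻¹ = upper2 a⁻¹ d⁻¹ (-(b * (a⁻¹ * d⁻¹ : kˣ))) := by
  rw [inv_eq_iff_mul_eq_one]
  refine Units.ext (Matrix.ext fun i j => ?_)
  fin_cases i <;> fin_cases j <;> simp [upper2_val]
  field_simp
  ring

variable [Fintype k] [DecidableEq k]

theorem sum_upper2_inv (σ : GL (Fin 2) k → ℂ) (a d : kˣ) :
    ∑ b, σ (upper2 a d b)⁻¹ = ∑ b, σ (upper2 a⁻¹ d⁻¹ b) := by
  refine Fintype.sum_equiv ((Units.mulRight (a⁻¹ * d⁻¹)).trans (Equiv.neg k)) _ _ fun b => ?_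
  rw [upper2_inv]
  rfl

theorem charPair_indPar {σ σ' : GL (Fin 2) k → ℂ} (hσ : IsClassFun σ) (hσ' : IsClassFun σ')
    (χ χ' : MulChar k ℂ) :
    charPair (indPar σ χ) (indPar σ' χ') =
      charPair (outer σ χ) (outer σ' χ') + mack (jac2 σ) χ (jac2 σ') χ' := by
  classical
  unfold indPar
  rw [charPair_indFun_indFun (isClassFun_comp_par3Levi (isClassFun_outer hσ χ))
    (isClassFun_comp_par3Levi (isClassFun_outer hσ' χ')) exists_eq_par3_swap3, charPair_par3_par3]
  congr 1
  have h2 : ∀ s z : GL (Fin 3) k, s⁻¹ * z⁻¹ * s = (s⁻¹ * z * s)⁻¹ :=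
    fun s z => by simp [mul_assoc]
  simp_rw [h2]
  have h3 := Fintype.sum_of_injective (swapParam (k := k)) swapParam_injective
    (fun x => outer σ χ (upper2 x.1.1 x.1.2.1 x.2.1, x.1.2.2) *
      outer σ' χ' ((upper2 x.1.1 x.1.2.2 x.2.2)⁻¹, x.1.2.1⁻¹))
    (fun p => outer σ χ (par3Levi p) * extendZero (fun p : par3 k => outer σ' χ' (par3Levi p))
      (swap3⁻¹ * (p : GL (Fin 3) k) * swap3)⁻¹)
    (fun p hp => by
      rw [extendZero_of_notMem, mul_zero]
      intro h
      exact hp (mem_range_swapParam p (by simpa using (par3 k).inv_mem h)))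
    (fun x => by
      rw [swap3_conj_swapParam, ← Subgroup.coe_inv, extendZero_coe, map_inv, par3Levi_swapParam,
        par3Levi_swapParam]
      rfl)
  rw [← h3, Fintype.sum_prod_type]
  simp_rw [Fintype.sum_prod_type (α₁ := k) (α₂ := k)]
  have h4 : ∀ t : kˣ × kˣ × kˣ, (∑ b : k, ∑ c : k, outer σ χ (upper2 t.1 t.2.1 b, t.2.2) *
      outer σ' χ' ((upper2 t.1 t.2.2 c)⁻¹, t.2.1⁻¹)) =
      (Nat.card k : ℂ) ^ 2 * (torusFun (jac2 σ) χ t *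
        torusFun (jac2 σ') χ' ((t⁻¹).1, (t⁻¹).2.2, (t⁻¹).2.1)) := by
    intro t
    simp_rw [← Finset.mul_sum, ← Finset.sum_mul]
    simp only [outer, ← Finset.sum_mul, sum_upper2_inv, torusFun, jac2, Prod.fst_inv, Prod.snd_inv]
    have h0 : (Nat.card k : ℂ) ≠ 0 := by simp
    field_simp
  simp_rw [h4, ← Finset.mul_sum]
  rw [mack, charPair, ← mul_assoc]
  congr 1
  have h5 : ((Nat.card (GL (Fin 3) k) : ℂ) - Nat.card (par3 k)) / Nat.card (par3 k) =
      (Nat.card k : ℂ) ^ 2 + Nat.card k := by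
    have := card_GL3_div_card_par3 (k := k)
    rw [sub_div, this, div_self (by simp)]
    ring
  rw [pow_two (Nat.card (par3 k) : ℂ), ← div_div, h5, card_par3_cast, Nat.card_prod, Nat.card_prod]
  push_cast
  rw [card_units_cast]
  have h0 : (Nat.card k : ℂ) ≠ 0 := by simp
  have h1 := card_sub_one_ne_zero (k := k)
  have h2 := card_add_one_ne_zero (k := k)
  have h3 : ((Nat.card k : ℂ) ^ 2 - 1) ≠ 0 := by
    rw [show (Nat.card k : ℂ) ^ 2 - 1 = (Nat.card k - 1) * (Nat.card k + 1) by ring]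
    exact mul_ne_zero h1 h2
  field_simp
  ring

end Mackey

section HarishChandraSeries

set_option linter.unusedSectionVars false

theorem IsVirtualChar.add {G : Type} [Group G] [Fintype G] {f g : G → ℂ} (hf : IsVirtualChar f)
    (hg : IsVirtualChar g) : IsVirtualChar (f + g) := by
  refine ⟨fun x y => by simp [hf.1 x y, hg.1 x y], fun χ hχ => ?_⟩
  obtain ⟨m, hm⟩ := hf.2 χ hχ
  obtain ⟨n, hn⟩ := hg.2 χ hχ
  exact ⟨m + n, by rw [charPair_add_left, hm, hn, Int.cast_add]⟩

variable {k : Type} [Field k] [Fintype k] [DecidableEq k]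

theorem isVirtualChar_indPar_ps2 (α β γ : MulChar k ℂ) : IsVirtualChar (indPar (ps2 α β) γ) := by
  by_cases h : α = β
  · subst h
    rw [ps2_self, indPar_add]
    exact (isVirtualChar_indPar (detChar_mem_irrChars 2 α) γ).add
      (isVirtualChar_indPar (st2_mem_irrChars α) γ)
  · exact isVirtualChar_indPar (ps2_mem_irrChars h) γ

theorem charPair_indPar_ps2 [DecidableEq (MulChar k ℂ)] (α β γ α' β' γ' : MulChar k ℂ) :
    charPair (indPar (ps2 α β) γ) (indPar (ps2 α' β') γ') =
      ((if α = α' then 1 else 0) * (if β = β' then 1 else 0) +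
        (if α = β' then 1 else 0) * (if β = α' then 1 else 0)) * (if γ = γ' then 1 else 0) +
      ((if α = α' then 1 else 0) * ((if β = γ' then 1 else 0) * (if γ = β' then 1 else 0)) +
       (if α = β' then 1 else 0) * ((if β = γ' then 1 else 0) * (if γ = α' then 1 else 0)) +
       ((if β = α' then 1 else 0) * ((if α = γ' then 1 else 0) * (if γ = β' then 1 else 0)) +
       (if β = β' then 1 else 0) * ((if α = γ' then 1 else 0) * (if γ = α' then 1 else 0)))) := by
  rw [charPair_indPar (isVirtualChar_ps2 _ _).1 (isVirtualChar_ps2 _ _).1, charPair_outer,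
    charPair_ps2, jac2_ps2, jac2_ps2, mack_add_left, mack_add_right, mack_add_right, mack_tens,
    mack_tens, mack_tens, mack_tens]

theorem indPar_ps2_mem_irrChars {α β γ : MulChar k ℂ} (h : α ≠ β) (h1 : γ ≠ α) (h2 : γ ≠ β) :
    indPar (ps2 α β) γ ∈ irrChars (GL (Fin 3) k) := by
  classical
  refine (isVirtualChar_indPar_ps2 α β γ).mem_irrChars ?_
    (d := (Nat.card k ^ 2 + Nat.card k + 1) * (Nat.card k + 1)) ?_
  · rw [charPair_indPar_ps2]
    simp [h, h.symm, h1, h1.symm, h2, h2.symm]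
  · rw [indPar_one, ps2_one]
    push_cast
    ring

theorem indPar_ps2_eq {α β : MulChar k ℂ} (h : α ≠ β) :
    indPar (ps2 α β) β = indPar (ps2 β β) α := by
  classical
  rw [← sub_eq_zero]
  refine ((isVirtualChar_indPar_ps2 α β β).sub (isVirtualChar_indPar_ps2 β β α)).eq_zero ?_
  simp only [charPair_sub_left, charPair_sub_right, charPair_indPar_ps2]
  simp [h, h.symm]

theorem charPair_detChar_detChar [DecidableEq (MulChar k ℂ)] (α β : MulChar k ℂ) :
    charPair (detChar 2 α) (detChar 2 β) = if α = β then 1 else 0 := by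
  split_ifs with h
  · rw [h, charPair_self_of_mem_irrChars (detChar_mem_irrChars 2 β)]
  · refine charPair_of_ne (detChar_mem_irrChars 2 α) (detChar_mem_irrChars 2 β) fun h1 => h ?_
    have h2 := congrArg jac2 h1
    rw [jac2_detChar, jac2_detChar] at h2
    refine MulChar.ext fun a => ?_
    have := congrFun h2 (a, 1)
    simpa [tens_apply] using this

theorem charPair_detChar_st2 (α β : MulChar k ℂ) : charPair (detChar 2 α) (st2 β) = 0 := by
  classical
  rw [st2, charPair_sub_right, charPair_comm, charPair_ps2_detChar, charPair_detChar_detChar]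
  by_cases h : β = α
  · simp [h]
  · simp [h, Ne.symm h]

theorem charPair_st2_st2 [DecidableEq (MulChar k ℂ)] (α β : MulChar k ℂ) :
    charPair (st2 α) (st2 β) = if α = β then 1 else 0 := by
  split_ifs with h
  · rw [h, charPair_self_of_mem_irrChars (st2_mem_irrChars β)]
  · refine charPair_of_ne (st2_mem_irrChars α) (st2_mem_irrChars β) fun h1 => h ?_
    have h2 := congrArg jac2 h1
    rw [jac2_st2, jac2_st2] at h2
    refine MulChar.ext fun a => ?_
    have := congrFun h2 (a, 1)
    simpa [tens_apply] using this

theorem charPair_indPar_det_det [DecidableEq (MulChar k ℂ)] (α β α' β' : MulChar k ℂ) :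
    charPair (indPar (detChar 2 α) β) (indPar (detChar 2 α') β') =
      (if α = α' then 1 else 0) * (if β = β' then 1 else 0) +
      (if α = α' then 1 else 0) * ((if α = β' then 1 else 0) * (if β = α' then 1 else 0)) := by
  rw [charPair_indPar (isClassFun_of_mem_irrChars (detChar_mem_irrChars _ _))
    (isClassFun_of_mem_irrChars (detChar_mem_irrChars _ _)), charPair_outer,
    charPair_detChar_detChar, jac2_detChar, jac2_detChar, mack_tens]

theorem charPair_indPar_st2_st2 [DecidableEq (MulChar k ℂ)] (α β α' β' : MulChar k ℂ) :
    charPair (indPar (st2 α) β) (indPar (st2 α') β') =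
      (if α = α' then 1 else 0) * (if β = β' then 1 else 0) +
      (if α = α' then 1 else 0) * ((if α = β' then 1 else 0) * (if β = α' then 1 else 0)) := by
  rw [charPair_indPar (isClassFun_of_mem_irrChars (st2_mem_irrChars _))
    (isClassFun_of_mem_irrChars (st2_mem_irrChars _)), charPair_outer,
    charPair_st2_st2, jac2_st2, jac2_st2, mack_tens]

theorem charPair_indPar_det_st2 [DecidableEq (MulChar k ℂ)] (α β α' β' : MulChar k ℂ) :
    charPair (indPar (detChar 2 α) β) (indPar (st2 α') β') =
      (if α = α' then 1 else 0) * ((if α = β' then 1 else 0) * (if β = α' then 1 else 0)) := by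
  rw [charPair_indPar (isClassFun_of_mem_irrChars (detChar_mem_irrChars _ _))
    (isClassFun_of_mem_irrChars (st2_mem_irrChars _)), charPair_outer,
    charPair_detChar_st2, jac2_st2, jac2_detChar, mack_tens, zero_mul, zero_add]

theorem jac3_detChar (α : MulChar k ℂ) : jac3 (detChar 3 α) = outer (detChar 2 α) α := by
  ext t
  have h : ∀ v : k × k, detChar 3 α (block3 t.1 t.2 v) = detChar 2 α t.1 * α t.2 := by
    intro v
    rw [detChar_apply, detChar_apply, ← map_mul, block3_val, Matrix.det_fin_three,
      Matrix.det_fin_two]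
    congr 1
    simp
    ring
  rw [jac3, outer]
  simp only [h, Finset.sum_const, Finset.card_univ, nsmul_eq_mul]
  rw [Nat.card_eq_fintype_card, inv_mul_cancel_left₀ (by simp)]

theorem charPair_indPar_detChar [DecidableEq (MulChar k ℂ)] (σ : GL (Fin 2) k → ℂ)
    (α β : MulChar k ℂ) : charPair (indPar σ α) (detChar 3 β) =
      charPair σ (detChar 2 β) * if α = β then 1 else 0 := by
  rw [charPair_indPar_left (isClassFun_of_mem_irrChars (detChar_mem_irrChars _ _)), jac3_detChar,
    charPair_outer]

/-- The irreducible character of degree `q ^ 2 + q` attached to a multiplicative character. -/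
noncomputable def pi3 (α : MulChar k ℂ) : GL (Fin 3) k → ℂ :=
  indPar (detChar 2 α) α - detChar 3 α

/-- The Steinberg character of `GL₃` twisted by a multiplicative character. -/
noncomputable def st3 (α : MulChar k ℂ) : GL (Fin 3) k → ℂ := indPar (st2 α) α - pi3 α

theorem pi3_one (α : MulChar k ℂ) : pi3 α 1 = (Nat.card k : ℂ) ^ 2 + Nat.card k := by
  rw [pi3, Pi.sub_apply, indPar_one, map_one, map_one]; ring

theorem st3_one (α : MulChar k ℂ) : st3 α 1 = (Nat.card k : ℂ) ^ 3 := by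
  rw [st3, Pi.sub_apply, indPar_one, pi3_one, st2_one]; ring

theorem indPar_st2_one (α β : MulChar k ℂ) :
    indPar (st2 α) β 1 = ((Nat.card k : ℂ) ^ 2 + Nat.card k + 1) * Nat.card k := by
  rw [indPar_one, st2_one]

theorem pi3_mem_irrChars (α : MulChar k ℂ) : pi3 α ∈ irrChars (GL (Fin 3) k) := by
  classical
  refine ((isVirtualChar_indPar (detChar_mem_irrChars 2 α) α).sub
    (isVirtualChar_of_mem_irrChars (detChar_mem_irrChars 3 α))).mem_irrChars ?_
    (d := Nat.card k ^ 2 + Nat.card k) (by rw [← pi3, pi3_one]; push_cast; rfl)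
  rw [charPair_sub_left, charPair_sub_right, charPair_sub_right,
    charPair_comm (detChar 3 α) (indPar _ _), charPair_indPar_det_det, charPair_indPar_detChar,
    charPair_detChar_detChar, charPair_self_of_mem_irrChars (detChar_mem_irrChars 3 α)]
  norm_num

theorem charPair_indPar_st2_pi3 [DecidableEq (MulChar k ℂ)] (α β γ : MulChar k ℂ) :
    charPair (indPar (st2 α) β) (pi3 γ) =
      (if γ = α then 1 else 0) * ((if γ = β then 1 else 0) * (if γ = α then 1 else 0)) := by
  rw [pi3, charPair_sub_right, charPair_comm, charPair_indPar_det_st2, charPair_indPar_detChar,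
    charPair_comm, charPair_detChar_st2, zero_mul, sub_zero]

theorem st3_mem_irrChars (α : MulChar k ℂ) : st3 α ∈ irrChars (GL (Fin 3) k) := by
  classical
  refine ((isVirtualChar_indPar (st2_mem_irrChars α) α).sub
    (isVirtualChar_of_mem_irrChars (pi3_mem_irrChars α))).mem_irrChars ?_
    (d := Nat.card k ^ 3) (by rw [← st3, st3_one]; push_cast; rfl)
  rw [charPair_sub_left, charPair_sub_right, charPair_sub_right,
    charPair_comm (pi3 α) (indPar _ _), charPair_indPar_st2_st2, charPair_indPar_st2_pi3,
    charPair_self_of_mem_irrChars (pi3_mem_irrChars α)]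
  norm_num

theorem pi3_injective : Function.Injective (pi3 (k := k)) := by
  classical
  have h : ∀ α β : MulChar k ℂ,
      charPair (indPar (detChar 2 α) α) (pi3 β) = if α = β then 1 else 0 := by
    intro α β
    rw [pi3, charPair_sub_right, charPair_indPar_det_det, charPair_indPar_detChar,
      charPair_detChar_detChar]
    by_cases h : α = β <;> simp [h]
  intro α β hαβ
  have h1 := h α α
  rw [hαβ, h] at h1
  by_contra hne
  simp [hne] at h1

theorem st3_injective : Function.Injective (st3 (k := k)) := by
  classical
  have h : ∀ α β : MulChar k ℂ,
      charPair (indPar (st2 α) α) (st3 β) = if α = β then 1 else 0 := by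
    intro α β
    rw [st3, charPair_sub_right, charPair_indPar_st2_st2, charPair_indPar_st2_pi3]
    by_cases h : α = β
    · simp [h]
    · simp [h, Ne.symm h]
  intro α β hαβ
  have h1 := h α α
  rw [hαβ, h] at h1
  by_contra hne
  simp [hne] at h1

theorem indPar_det_mem_irrChars {α β : MulChar k ℂ} (h : α ≠ β) :
    indPar (detChar 2 α) β ∈ irrChars (GL (Fin 3) k) := by
  classical
  refine (isVirtualChar_indPar (detChar_mem_irrChars 2 α) β).mem_irrChars ?_
    (d := Nat.card k ^ 2 + Nat.card k + 1) (by rw [indPar_one, map_one]; push_cast; ring)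
  rw [charPair_indPar_det_det]
  simp [h]

theorem indPar_st2_mem_irrChars {α β : MulChar k ℂ} (h : α ≠ β) :
    indPar (st2 α) β ∈ irrChars (GL (Fin 3) k) := by
  classical
  refine (isVirtualChar_indPar (st2_mem_irrChars α) β).mem_irrChars ?_
    (d := (Nat.card k ^ 2 + Nat.card k + 1) * Nat.card k)
    (by rw [indPar_st2_one]; push_cast; ring)
  rw [charPair_indPar_st2_st2]
  simp [h]

theorem indPar_st2_injective {α β α' β' : MulChar k ℂ} (hne : α ≠ β)
    (h : indPar (st2 α) β = indPar (st2 α') β') : α = α' ∧ β = β' := by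
  classical
  have h1 := charPair_self_of_mem_irrChars (indPar_st2_mem_irrChars hne)
  conv at h1 => enter [1, 2]; rw [h]
  rw [charPair_indPar_st2_st2] at h1
  by_contra hcon
  rw [not_and_or] at hcon
  rcases hcon with h2 | h2
  · simp [h2] at h1
  · by_cases h3 : α = α'
    · subst h3
      simp [h2, Ne.symm hne] at h1
    · simp [h3] at h1

theorem indPar_cuspidal_mem_irrChars {σ : GL (Fin 2) k → ℂ} (hσ : σ ∈ irrChars (GL (Fin 2) k))
    (h : jac2 σ = 0) (χ : MulChar k ℂ) : indPar σ χ ∈ irrChars (GL (Fin 3) k) := by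
  classical
  obtain ⟨d, -, hd⟩ := exists_degree_of_mem_irrChars hσ
  refine (isVirtualChar_indPar hσ χ).mem_irrChars ?_
    (d := (Nat.card k ^ 2 + Nat.card k + 1) * d)
    (by rw [indPar_one, hd]; push_cast; ring)
  rw [charPair_indPar (isClassFun_of_mem_irrChars hσ) (isClassFun_of_mem_irrChars hσ),
    charPair_outer, h, mack_zero_left, charPair_self_of_mem_irrChars hσ]
  simp

theorem irrChars_GL3_cases {χ : GL (Fin 3) k → ℂ} (hχ : χ ∈ irrChars (GL (Fin 3) k))
    (h : jac3 χ ≠ 0) : (∃ d : ℤ, χ 1 = d ∧ IsCoprime d (Nat.card k : ℤ)) ∨ (∃ α, χ = pi3 α) ∨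
      (∃ α, χ = st3 α) ∨ ∃ α β, α ≠ β ∧ χ = indPar (st2 α) β := by
  obtain ⟨σ, hσ, γ, hne⟩ := exists_indPar_charPair_ne_zero (isClassFun_of_mem_irrChars hχ) h
  have hps : ∀ α β : MulChar k ℂ, α ≠ β → charPair (indPar (ps2 α β) β) χ ≠ 0 →
      (∃ d : ℤ, χ 1 = d ∧ IsCoprime d (Nat.card k : ℤ)) ∨ (∃ α, χ = pi3 α) ∨
      (∃ α, χ = st3 α) ∨ ∃ α β, α ≠ β ∧ χ = indPar (st2 α) β := by
    intro α β hαβ hne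
    rw [indPar_ps2_eq hαβ, ps2_self, indPar_add] at hne
    rcases eq_or_eq_of_charPair_add_ne_zero hχ (indPar_det_mem_irrChars hαβ.symm)
      (indPar_st2_mem_irrChars hαβ.symm) hne with rfl | rfl
    · refine Or.inl ⟨Nat.card k ^ 2 + Nat.card k + 1, ?_, 1, -(Nat.card k) - 1, by ring⟩
      rw [indPar_one, map_one]; push_cast; ring
    · exact Or.inr (Or.inr (Or.inr ⟨β, α, hαβ.symm, rfl⟩))
  rcases irrChars_GL2_cases hσ with hc | ⟨α, rfl⟩ | ⟨α, rfl⟩ | ⟨α, β, hαβ, rfl⟩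
  · left
    rw [← eq_of_charPair_ne_zero (indPar_cuspidal_mem_irrChars hσ hc γ) hχ hne]
    refine ⟨(Nat.card k ^ 2 + Nat.card k + 1) * (Nat.card k - 1), ?_, -1, Nat.card k ^ 2, by ring⟩
    rw [indPar_one, cuspidal_degree_GL2 hσ hc]; push_cast; ring
  · by_cases h1 : α = γ
    · subst h1
      have h2 : indPar (detChar 2 α) α = pi3 α + detChar 3 α := by simp [pi3]
      rw [h2] at hne
      rcases eq_or_eq_of_charPair_add_ne_zero hχ (pi3_mem_irrChars α)
        (detChar_mem_irrChars 3 α) hne with rfl | rfl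
      · exact Or.inr (Or.inl ⟨α, rfl⟩)
      · exact Or.inl ⟨1, by simp, isCoprime_one_left⟩
    · rw [← eq_of_charPair_ne_zero (indPar_det_mem_irrChars h1) hχ hne]
      refine Or.inl ⟨Nat.card k ^ 2 + Nat.card k + 1, ?_, 1, -(Nat.card k) - 1, by ring⟩
      rw [indPar_one, map_one]; push_cast; ring
  · by_cases h1 : α = γ
    · subst h1
      have h2 : indPar (st2 α) α = st3 α + pi3 α := by simp [st3]
      rw [h2] at hne
      rcases eq_or_eq_of_charPair_add_ne_zero hχ (st3_mem_irrChars α)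
        (pi3_mem_irrChars α) hne with rfl | rfl
      · exact Or.inr (Or.inr (Or.inl ⟨α, rfl⟩))
      · exact Or.inr (Or.inl ⟨α, rfl⟩)
    · exact Or.inr (Or.inr (Or.inr ⟨α, γ, h1,
        (eq_of_charPair_ne_zero (indPar_st2_mem_irrChars h1) hχ hne).symm⟩))
  · by_cases h1 : γ = α
    · subst h1
      rw [ps2_comm] at hne
      exact hps _ _ hαβ.symm hne
    · by_cases h2 : γ = β
      · subst h2
        exact hps _ _ hαβ hne
      · left
        rw [← eq_of_charPair_ne_zero (indPar_ps2_mem_irrChars hαβ h1 h2) hχ hne]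
        refine ⟨(Nat.card k ^ 2 + Nat.card k + 1) * (Nat.card k + 1), ?_,
          1, -(Nat.card k) ^ 2 - 2 * Nat.card k - 2, by ring⟩
        rw [indPar_one, ps2_one]; push_cast; ring

end HarishChandraSeries

section Whittaker

set_option linter.unusedSectionVars false

variable {k : Type} [Field k]

/-- The unipotent upper triangular matrix with the given entries. -/
def unip3Matrix (a b c : k) : Matrix (Fin 3) (Fin 3) k := !![1, a, c; 0, 1, b; 0, 0, 1]

/-- Either `N` is fixed by reflection in the antidiagonal, or some unipotent matrices `v`, `v'`
with different values of the generic character satisfy `v * N = N * v'`. -/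
def WhittakerRelevant (ψ : AddChar k ℂ) (N : Matrix (Fin 3) (Fin 3) k) : Prop :=
  (∀ i j, N (Fin.rev j) (Fin.rev i) = N i j) ∨ ∃ a b c a' b' c' : k,
    unip3Matrix a b c * N = N * unip3Matrix a' b' c' ∧ ψ (a + b) ≠ ψ (a' + b')

theorem whittakerRelevant_diagonal {ψ : AddChar k ℂ} (hψ : ψ ≠ 1) (x y z : k) :
    WhittakerRelevant ψ !![x, 0, 0; 0, y, 0; 0, 0, z] := by
  by_cases hxy : x = y
  · by_cases hyz : y = z
    · subst hxy hyz
      left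
      intro i j
      fin_cases i <;> fin_cases j <;> rfl
    · right
      obtain ⟨r, hr⟩ := AddChar.exists_ne_mul hψ hyz
      refine ⟨0, r * y, 0, 0, r * z, 0, ?_, by simpa using hr⟩
      refine Matrix.ext fun i j => ?_
      fin_cases i <;> fin_cases j <;> simp [unip3Matrix]
      ring
  · right
    obtain ⟨r, hr⟩ := AddChar.exists_ne_mul hψ hxy
    refine ⟨r * x, 0, 0, r * y, 0, 0, ?_, by simpa using hr⟩
    refine Matrix.ext fun i j => ?_
    fin_cases i <;> fin_cases j <;> simp [unip3Matrix]
    ring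

set_option maxHeartbeats 1000000 in
theorem exists_bruhat_three {ψ : AddChar k ℂ} (hψ : ψ ≠ 1) (x₁ x₂ x₃ y₁ y₂ y₃ z₁ z₂ z₃ : k)
    (hdet : x₁ * y₂ * z₃ - x₁ * y₃ * z₂ - x₂ * y₁ * z₃ + x₂ * y₃ * z₁ + x₃ * y₁ * z₂ -
      x₃ * y₂ * z₁ ≠ 0) :
    ∃ (a b c a' b' c' : k) (N : Matrix (Fin 3) (Fin 3) k),
      !![x₁, x₂, x₃; y₁, y₂, y₃; z₁, z₂, z₃] = unip3Matrix a b c * N * unip3Matrix a' b' c' ∧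
        WhittakerRelevant ψ N := by
  obtain ⟨s, hs⟩ := AddChar.ne_one_iff.1 hψ
  have hdiv : ∀ {x : k}, x ≠ 0 → ∀ y, ∃ r, y = x * r := fun {x} hx y => ⟨y / x, by field_simp⟩
  have hadd : ∀ x y : k, ∃ r, y = r + x := fun x y => ⟨y - x, by ring⟩
  by_cases hz₁ : z₁ = 0
  · subst hz₁
    by_cases hz₂ : z₂ = 0
    · subst hz₂
      have hz₃ : z₃ ≠ 0 := fun h => hdet (by subst h; ring)
      obtain ⟨c, rfl⟩ := hdiv hz₃ x₃
      obtain ⟨b, rfl⟩ := hdiv hz₃ y₃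
      by_cases hy₁ : y₁ = 0
      · subst hy₁
        have hy₂ : y₂ ≠ 0 := fun h => hdet (by subst h; ring)
        obtain ⟨a, rfl⟩ := hdiv hy₂ x₂
        refine ⟨a, b, c, 0, 0, 0, _, ?_, whittakerRelevant_diagonal hψ x₁ y₂ z₃⟩
        refine Matrix.ext fun i j => ?_
        fin_cases i <;> fin_cases j <;> simp [unip3Matrix] <;> ring
      · obtain ⟨a, rfl⟩ := hdiv hy₁ x₁
        obtain ⟨a', rfl⟩ := hdiv hy₁ y₂
        obtain ⟨B, rfl⟩ := hadd (a * a' * y₁) x₂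
        refine ⟨a, b, c, a', 0, 0, !![0, B, 0; y₁, 0, 0; 0, 0, z₃], ?_,
          Or.inr ⟨0, s, 0, 0, 0, s * z₃ / y₁, ?_, by simpa using hs⟩⟩
        · refine Matrix.ext fun i j => ?_
          fin_cases i <;> fin_cases j <;> simp [unip3Matrix] <;> ring
        · refine Matrix.ext fun i j => ?_
          fin_cases i <;> fin_cases j <;> simp [unip3Matrix] <;> field_simp
    · obtain ⟨c, rfl⟩ := hdiv hz₂ x₂
      obtain ⟨b, rfl⟩ := hdiv hz₂ y₂
      obtain ⟨b', rfl⟩ := hdiv hz₂ z₃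
      obtain ⟨D, rfl⟩ := hadd (b * z₂ * b') y₃
      by_cases hy₁ : y₁ = 0
      · subst hy₁
        have hD : D ≠ 0 := fun h => hdet (by subst h; ring)
        have hx₁ : x₁ ≠ 0 := fun h => hdet (by subst h; ring)
        obtain ⟨B, rfl⟩ := hadd (c * z₂ * b') x₃
        obtain ⟨a, rfl⟩ := hdiv hD B
        refine ⟨a, b, c, 0, b', 0, !![x₁, 0, 0; 0, 0, D; 0, z₂, 0], ?_,
          Or.inr ⟨s, 0, 0, 0, 0, s * D / x₁, ?_, by simpa using hs⟩⟩
        · refine Matrix.ext fun i j => ?_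
          fin_cases i <;> fin_cases j <;> simp [unip3Matrix] <;> ring
        · refine Matrix.ext fun i j => ?_
          fin_cases i <;> fin_cases j <;> simp [unip3Matrix] <;> field_simp
      · obtain ⟨a, rfl⟩ := hdiv hy₁ x₁
        obtain ⟨c', rfl⟩ := hdiv hy₁ D
        obtain ⟨B, rfl⟩ := hadd (c * z₂ * b' + a * y₁ * c') x₃
        refine ⟨a, b, c, 0, b', c', !![0, 0, B; y₁, 0, 0; 0, z₂, 0], ?_, ?_⟩
        · refine Matrix.ext fun i j => ?_
          fin_cases i <;> fin_cases j <;> simp [unip3Matrix] <;> ring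
        · by_cases h : y₁ = z₂
          · subst h
            left
            intro i j
            fin_cases i <;> fin_cases j <;> rfl
          · right
            obtain ⟨r, hr⟩ := AddChar.exists_ne_mul hψ h
            refine ⟨0, r * y₁, 0, r * z₂, 0, 0, ?_, by simpa using hr⟩
            refine Matrix.ext fun i j => ?_
            fin_cases i <;> fin_cases j <;> simp [unip3Matrix]
            ring
  · obtain ⟨c, rfl⟩ := hdiv hz₁ x₁
    obtain ⟨b, rfl⟩ := hdiv hz₁ y₁
    obtain ⟨a', rfl⟩ := hdiv hz₁ z₂
    obtain ⟨c', rfl⟩ := hdiv hz₁ z₃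
    obtain ⟨A, rfl⟩ := hadd (c * z₁ * a') x₂
    obtain ⟨B, rfl⟩ := hadd (c * z₁ * c') x₃
    obtain ⟨C, rfl⟩ := hadd (b * z₁ * a') y₂
    obtain ⟨D, rfl⟩ := hadd (b * z₁ * c') y₃
    by_cases hC : C = 0
    · subst hC
      have hD : D ≠ 0 := fun h => hdet (by subst h; ring)
      obtain ⟨a, rfl⟩ := hdiv hD B
      refine ⟨a, b, c, a', 0, c', !![0, A, 0; 0, 0, D; z₁, 0, 0], ?_, ?_⟩
      · refine Matrix.ext fun i j => ?_
        fin_cases i <;> fin_cases j <;> simp [unip3Matrix] <;> ring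
      · by_cases h : A = D
        · subst h
          left
          intro i j
          fin_cases i <;> fin_cases j <;> rfl
        · right
          obtain ⟨r, hr⟩ := AddChar.exists_ne_mul hψ h
          refine ⟨r * A, 0, 0, 0, r * D, 0, ?_, by simpa using hr⟩
          refine Matrix.ext fun i j => ?_
          fin_cases i <;> fin_cases j <;> simp [unip3Matrix]
          ring
    · obtain ⟨a, rfl⟩ := hdiv hC A
      obtain ⟨b', rfl⟩ := hdiv hC D
      obtain ⟨E, rfl⟩ := hadd (C * a * b') B
      refine ⟨a, b, c, a', b', c', !![0, 0, E; 0, C, 0; z₁, 0, 0], ?_, Or.inl ?_⟩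
      · refine Matrix.ext fun i j => ?_
        fin_cases i <;> fin_cases j <;> simp [unip3Matrix] <;> ring
      · intro i j
        fin_cases i <;> fin_cases j <;> rfl

/-- The unipotent upper triangular invertible matrix with the given entries. -/
noncomputable def uni3 (a b c : k) : GL (Fin 3) k :=
  Matrix.GeneralLinearGroup.mkOfDetNeZero (unip3Matrix a b c)
    (by rw [unip3Matrix, Matrix.det_fin_three]; simp)

theorem uni3_val (a b c : k) : (uni3 a b c).1 = !![1, a, c; 0, 1, b; 0, 0, 1] := rfl

theorem uni3_mul (a b c a' b' c' : k) :
    uni3 a b c * uni3 a' b' c' = uni3 (a + a') (b + b') (c + c' + a * b') := by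
  refine Units.ext (Matrix.ext fun i j => ?_)
  fin_cases i <;> fin_cases j <;> simp [uni3_val] <;> ring

theorem uni3_inv (a b c : k) : (uni3 a b c)⁻¹ = uni3 (-a) (-b) (a * b - c) := by
  rw [inv_eq_iff_mul_eq_one, uni3_mul]
  refine Units.ext (Matrix.ext fun i j => ?_)
  fin_cases i <;> fin_cases j <;> simp [uni3_val]

/-- Unipotent upper triangular matrices of size three. -/
noncomputable def unip3 (k : Type) [Field k] : Subgroup (GL (Fin 3) k) where
  carrier := {g | ∃ a b c, uni3 a b c = g}
  mul_mem' := by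
    rintro _ _ ⟨a, b, c, rfl⟩ ⟨a', b', c', rfl⟩
    exact ⟨_, _, _, (uni3_mul _ _ _ _ _ _).symm⟩
  one_mem' := ⟨0, 0, 0, by
    refine Units.ext (Matrix.ext fun i j => ?_)
    fin_cases i <;> fin_cases j <;> simp [uni3_val]⟩
  inv_mem' := by
    rintro _ ⟨a, b, c, rfl⟩
    exact ⟨_, _, _, (uni3_inv _ _ _).symm⟩

/-- Coordinates on the unipotent group of size three. -/
noncomputable def unip3Equiv : k × k × k ≃ unip3 k where
  toFun x := ⟨uni3 x.1 x.2.1 x.2.2, _, _, _, rfl⟩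
  invFun u := (u.1.1 0 1, u.1.1 1 2, u.1.1 0 2)
  left_inv x := by simp [uni3_val]
  right_inv u := by
    obtain ⟨_, a, b, c, rfl⟩ := u
    exact Subtype.ext (by simp [uni3_val])

theorem unip3Equiv_val (x : k × k × k) :
    (unip3Equiv x : GL (Fin 3) k) = uni3 x.1 x.2.1 x.2.2 := rfl

/-- The generic character of the unipotent group of size three. -/
noncomputable def unip3Char (ψ : AddChar k ℂ) : unip3 k →* ℂ where
  toFun u := ψ (u.1.1 0 1 + u.1.1 1 2)
  map_one' := by simp
  map_mul' u v := by
    obtain ⟨_, a, b, c, rfl⟩ := u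
    obtain ⟨_, a', b', c', rfl⟩ := v
    rw [← AddChar.map_add_eq_mul]
    simp only [Subgroup.coe_mul, uni3_mul]
    congr 1
    simp [uni3_val]
    ring

theorem unip3Char_equiv (ψ : AddChar k ℂ) (x : k × k × k) :
    unip3Char ψ (unip3Equiv x) = ψ (x.1 + x.2.1) := by
  simp [unip3Char, unip3Equiv_val, uni3_val]

theorem unip3_bruhat {ψ : AddChar k ℂ} (hψ : ψ ≠ 1) (g : GL (Fin 3) k) :
    ∃ (u u' : unip3 k) (n : GL (Fin 3) k), g = u * n * u' ∧
      (antiTranspose n = n ∨ ∃ v v' : unip3 k, (v : GL (Fin 3) k) * n = n * v' ∧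
        unip3Char ψ v ≠ unip3Char ψ v') := by
  have hdet := g.val_det_ne_zero
  rw [Matrix.det_fin_three] at hdet
  obtain ⟨a, b, c, a', b', c', N, hN, h⟩ := exists_bruhat_three hψ _ _ _ _ _ _ _ _ _ hdet
  rw [← Matrix.eta_fin_three] at hN
  obtain ⟨n, hgn⟩ : ∃ n, n = (uni3 a b c)⁻¹ * g * (uni3 a' b' c')⁻¹ := ⟨_, rfl⟩
  have hn : n.1 = N := by
    rw [hgn]
    have h1 : g.1 = (uni3 a b c).1 * N * (uni3 a' b' c').1 := hN
    rw [Units.val_mul, Units.val_mul, h1, mul_assoc, mul_assoc, mul_assoc, Units.mul_inv, mul_one,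
      Units.inv_mul_cancel_left]
  refine ⟨unip3Equiv (a, b, c), unip3Equiv (a', b', c'), n, ?_, ?_⟩
  · simp only [unip3Equiv_val, hgn]
    group
  · rcases h with h | ⟨x, y, z, x', y', z', h, hne⟩
    · left
      refine Units.ext (Matrix.ext fun i j => ?_)
      rw [antiTranspose_apply, hn, h]
    · right
      refine ⟨unip3Equiv (x, y, z), unip3Equiv (x', y', z'), Units.ext ?_,
        by rwa [unip3Char_equiv, unip3Char_equiv]⟩
      rw [Units.val_mul, Units.val_mul, hn]
      exact h

theorem IsClassFun.eq_of_mul_eq {n : ℕ} {χ : GL (Fin n) k → ℂ} [Fintype (GL (Fin n) k)]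
    (hχ : IsClassFun χ) {g h : GL (Fin n) k} (Q : Matrix (Fin n) (Fin n) k) (hQ : Q.det ≠ 0)
    (hgh : g.1 * Q = Q * h.1) : χ g = χ h := by
  set q := Matrix.GeneralLinearGroup.mkOfDetNeZero Q hQ with hq
  have h1 : g * q = q * h := Units.ext hgh
  rw [← hχ h q, ← h1, mul_inv_cancel_right]

theorem IsClassFun.uni3_regular [Fintype (GL (Fin 3) k)] {χ : GL (Fin 3) k → ℂ}
    (hχ : IsClassFun χ) {a b : k} (ha : a ≠ 0) (hb : b ≠ 0) (c : k) :
    χ (uni3 a b c) = χ (uni3 1 1 0) := by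
  refine hχ.eq_of_mul_eq !![a * b, c, 0; 0, b, 0; 0, 0, 1] ?_ (Matrix.ext fun i j => ?_)
  · rw [Matrix.det_fin_three]; simp [ha, hb]
  · fin_cases i <;> fin_cases j <;> simp [uni3_val]
    ring

theorem IsClassFun.uni3_zero_left [Fintype (GL (Fin 3) k)] {χ : GL (Fin 3) k → ℂ}
    (hχ : IsClassFun χ) {b c : k} (h : b ≠ 0 ∨ c ≠ 0) :
    χ (uni3 0 b c) = χ (uni3 0 0 1) := by
  by_cases hb : b = 0
  · have hc : c ≠ 0 := h.resolve_left (not_not.2 hb)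
    refine hχ.eq_of_mul_eq !![c, 0, 0; b, 1, 0; 0, 0, 1] ?_ (Matrix.ext fun i j => ?_)
    · rw [Matrix.det_fin_three]; simp [hc]
    · fin_cases i <;> fin_cases j <;> simp [uni3_val]
  · refine hχ.eq_of_mul_eq !![c, 1, 0; b, 0, 0; 0, 0, 1] ?_ (Matrix.ext fun i j => ?_)
    · rw [Matrix.det_fin_three]; simp [hb]
    · fin_cases i <;> fin_cases j <;> simp [uni3_val]

theorem IsClassFun.uni3_zero_right [Fintype (GL (Fin 3) k)] {χ : GL (Fin 3) k → ℂ}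
    (hχ : IsClassFun χ) {a : k} (ha : a ≠ 0) (c : k) :
    χ (uni3 a 0 c) = χ (uni3 0 0 1) := by
  refine hχ.eq_of_mul_eq !![a, 0, 0; 0, -c, 1; 0, a, 0] ?_ (Matrix.ext fun i j => ?_)
  · rw [Matrix.det_fin_three]; simp [ha]
  · fin_cases i <;> fin_cases j <;> simp [uni3_val]
    ring

end Whittaker

section Cuspidal

set_option linter.unusedSectionVars false

variable {k : Type} [Field k] [Fintype k] [DecidableEq k]

theorem sum_addChar_neg {ψ : AddChar k ℂ} (hψ : ψ ≠ 1) : ∑ b : k, ψ (-b) = 0 := by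
  rw [← AddChar.sum_eq_zero_of_ne_one hψ]
  exact Fintype.sum_equiv (Equiv.neg k) _ _ fun _ => rfl

theorem jac3_eq_zero_apply {χ : GL (Fin 3) k → ℂ} (h : jac3 χ = 0) (a : k) :
    ∑ b : k, 1 * ∑ c : k, χ (uni3 a b c) = 0 := by
  have h2 := congrFun h (upper2 1 1 a, 1)
  rw [jac3, Pi.zero_apply, mul_eq_zero] at h2
  have h3 := h2.resolve_left (inv_ne_zero (by simp))
  rw [Fintype.sum_prod_type_right] at h3
  simp_rw [one_mul]
  rw [← h3]
  refine Finset.sum_congr rfl fun b _ => Finset.sum_congr rfl fun c _ => ?_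
  congr 1

theorem cuspidal_degree_GL3 {χ : GL (Fin 3) k → ℂ} (hχ : χ ∈ irrChars (GL (Fin 3) k))
    (h : jac3 χ = 0) : χ 1 = ((Nat.card k : ℂ) ^ 2 - 1) * ((Nat.card k : ℂ) - 1) := by
  classical
  obtain ⟨ψ, hψ⟩ := exists_addChar_ne_one k
  have hcl := isClassFun_of_mem_irrChars hχ
  have h0 : (Nat.card k : ℂ) ≠ 0 := by simp
  have hone : uni3 (0 : k) 0 0 = 1 := by
    refine Units.ext (Matrix.ext fun i j => ?_)
    fin_cases i <;> fin_cases j <;> simp [uni3_val]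
  have hq : ∑ _b : k, (1 : ℂ) = Nat.card k := by simp
  set q := (Nat.card k : ℂ)
  set x := χ 1 with hx
  set t := χ (uni3 0 0 1)
  set u := χ (uni3 1 1 0)
  have hconst : ∀ F : k → ℂ, ∀ y, (∀ c, F c = y) → ∑ c, F c = q * y := by
    intro F y hF
    simp_rw [hF]
    rw [← hq, Finset.sum_mul]
    simp
  have H00 : ∑ c : k, χ (uni3 0 0 c) = x + (q - 1) * t := by
    have h2 := sum_eq_add_mul_of_ne (F := fun c : k => χ (uni3 0 0 c)) (x := x) (y := t)
      (by simp only [hone, hx]) (fun c hc => hcl.uni3_zero_left (Or.inr hc)) fun _ => 1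
    simp only [one_mul] at h2
    rw [h2, hq]
    ring
  have H01 : ∀ b : k, b ≠ 0 → ∑ c : k, χ (uni3 0 b c) = q * t := fun b hb =>
    hconst _ _ fun c => hcl.uni3_zero_left (Or.inl hb)
  have H10 : ∀ a : k, a ≠ 0 → ∑ c : k, χ (uni3 a 0 c) = q * t := fun a ha =>
    hconst _ _ fun c => hcl.uni3_zero_right ha c
  have H11 : ∀ a b : k, a ≠ 0 → b ≠ 0 → ∑ c : k, χ (uni3 a b c) = q * u := fun a b ha hb =>
    hconst _ _ fun c => hcl.uni3_regular ha hb c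
  have hJ0 := jac3_eq_zero_apply h 0
  have hJ1 := jac3_eq_zero_apply h 1
  rw [sum_eq_add_mul_of_ne H00 H01 (fun _ => 1), hq] at hJ0
  rw [sum_eq_add_mul_of_ne (H10 1 one_ne_zero) (fun b => H11 1 b one_ne_zero) (fun _ => 1), hq]
    at hJ1
  have hG0 := sum_eq_add_mul_of_ne H00 H01 (fun b => ψ (-b))
  have hG1 : ∀ a : k, a ≠ 0 → ∑ b, ψ (-b) * ∑ c, χ (uni3 a b c) = q * t - q * u := by
    intro a ha
    rw [sum_eq_add_mul_of_ne (H10 a ha) (fun b => H11 a b ha) (fun b => ψ (-b)),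
      sum_addChar_neg hψ]
    simp
  rw [sum_addChar_neg hψ, neg_zero, AddChar.map_zero_eq_one] at hG0
  have hS := sum_eq_add_mul_of_ne hG0 hG1 (fun a => ψ (-a))
  rw [sum_addChar_neg hψ, neg_zero, AddChar.map_zero_eq_one] at hS
  obtain ⟨m, hm, hm'⟩ := exists_multiplicity_le_one hχ (unip3Char ψ) antiTranspose
    antiTranspose_mul (fun v => by
      obtain ⟨_, a, b, c, rfl⟩ := v
      have h2 : antiTranspose (uni3 a b c) = uni3 b a c := by
        refine Units.ext (Matrix.ext fun i j => ?_)
        fin_cases i <;> fin_cases j <;> simp [antiTranspose_apply, uni3_val]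
      refine ⟨?_, ?_⟩
      · simp only [h2]
        exact ⟨_, _, _, rfl⟩
      · simp [unip3Char, h2, uni3_val, add_comm]) antiTranspose_antiTranspose (unip3_bruhat hψ)
  have hinv : ∀ v : k × k × k, (unip3Equiv v)⁻¹ =
      unip3Equiv (-v.1, -v.2.1, v.1 * v.2.1 - v.2.2) := fun v => Subtype.ext (uni3_inv _ _ _)
  rw [← Equiv.sum_comp unip3Equiv, ← Nat.card_congr unip3Equiv] at hm'
  simp_rw [hinv, unip3Char_equiv] at hm'
  rw [Fintype.sum_prod_type] at hm'
  simp_rw [Fintype.sum_prod_type, unip3Equiv_val, AddChar.map_add_eq_mul, mul_assoc,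
    ← Finset.mul_sum] at hm'
  rw [hS, Nat.card_prod, Nat.card_prod, Nat.cast_mul, Nat.cast_mul] at hm'
  change (q * (q * q))⁻¹ * _ = _ at hm'
  obtain ⟨d, hd, hd'⟩ := exists_degree_of_mem_irrChars hχ
  field_simp at hm'
  have ht : t = -(q - 1) * u := by
    have h3 : q * (t + (q - 1) * u) = 0 := by linear_combination hJ1
    linear_combination (mul_eq_zero.1 h3).resolve_left h0
  have hx' : x = (q ^ 2 - 1) * (q - 1) * u := by
    rw [ht] at hJ0
    linear_combination hJ0
  have hu : u = m := by
    rw [hx', ht] at hm'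
    have h3 : q ^ 3 * (u - m) = 0 := by linear_combination hm'
    exact sub_eq_zero.1 ((mul_eq_zero.1 h3).resolve_left (pow_ne_zero 3 h0))
  rw [hu] at hx'
  interval_cases m
  · rw [Nat.cast_zero, mul_zero, hx, hd', Nat.cast_eq_zero] at hx'
    omega
  · have hm1 := hx'
    simpa using hm1

/-- The irreducible characters of `GL₃` whose degree is not prime to `q`. -/
theorem irrChars_GL3_degree {χ : GL (Fin 3) k → ℂ} (hχ : χ ∈ irrChars (GL (Fin 3) k)) :
    (∃ d : ℤ, χ 1 = d ∧ IsCoprime d (Nat.card k : ℤ)) ∨ (∃ α, χ = pi3 α) ∨ (∃ α, χ = st3 α) ∨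
      ∃ α β, α ≠ β ∧ χ = indPar (st2 α) β := by
  by_cases h : jac3 χ = 0
  · refine Or.inl ⟨((Nat.card k : ℤ) ^ 2 - 1) * ((Nat.card k : ℤ) - 1), ?_, ?_⟩
    · rw [cuspidal_degree_GL3 hχ h]
      push_cast
      ring
    · refine ⟨1, -((Nat.card k : ℤ) ^ 2 - (Nat.card k : ℤ) - 1), ?_⟩
      ring
  · exact irrChars_GL3_cases hχ h

end Cuspidal

section DegreeValuation

set_option linter.unusedSectionVars false

theorem padicValNat_pow_mul {p : ℕ} [hp : Fact p.Prime] (n : ℕ) {m : ℕ} (h : ¬ p ∣ m) :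
    padicValNat p (p ^ n * m) = n := by
  have hm : m ≠ 0 := fun h0 => h (h0 ▸ dvd_zero p)
  rw [padicValNat.mul (pow_ne_zero _ hp.1.ne_zero) hm, padicValNat.prime_pow,
    padicValNat.eq_zero_of_not_dvd h, add_zero]

theorem padicValRat_prod {p : ℕ} [Fact p.Prime] {ι : Type*} (s : Finset ι) (f : ι → ℕ)
    (h : ∀ i ∈ s, f i ≠ 0) :
    padicValRat p (∏ i ∈ s, (f i : ℚ)) = ∑ i ∈ s, (padicValNat p (f i) : ℤ) := by
  classical
  induction s using Finset.induction_on with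
  | empty => simp
  | insert a s ha ih =>
    rw [Finset.prod_insert ha, Finset.sum_insert ha, padicValRat.mul,
      ih fun i hi => h i (Finset.mem_insert_of_mem hi), padicValRat.of_nat]
    · exact Nat.cast_ne_zero.2 (h a (Finset.mem_insert_self a s))
    · exact Finset.prod_ne_zero_iff.2 fun i hi =>
        Nat.cast_ne_zero.2 (h i (Finset.mem_insert_of_mem hi))

theorem mem_irrCharDegSet {G : Type} [Group G] [Fintype G] {x : (G → ℂ) × ℕ} :
    x ∈ irrCharDegSet G ↔ x.1 ∈ irrChars G ∧ x.1 1 = x.2 := by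
  constructor
  · rintro ⟨V, hV, h1, h2⟩
    exact ⟨⟨V, hV, h1⟩, by rw [h1, h2, FDRep.char_one]⟩
  · rintro ⟨⟨V, hV, h1⟩, h2⟩
    refine ⟨V, hV, h1, ?_⟩
    rw [h1, FDRep.char_one] at h2
    exact (Nat.cast_injective h2).symm

theorem irrCharDegSet_finite (G : Type) [Group G] [Fintype G] : (irrCharDegSet G).Finite := by
  refine Set.Finite.of_finite_image (f := Prod.fst)
    ((irrChars_finite (G := G)).subset ?_) ?_
  · rintro _ ⟨x, hx, rfl⟩
    exact (mem_irrCharDegSet.1 hx).1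
  · intro x hx y hy hxy
    refine Prod.ext hxy (Nat.cast_injective (R := ℂ) ?_)
    rw [← (mem_irrCharDegSet.1 hx).2, ← (mem_irrCharDegSet.1 hy).2, hxy]

theorem irrCharDegSet_snd_ne_zero {G : Type} [Group G] [Fintype G] {x : (G → ℂ) × ℕ}
    (hx : x ∈ irrCharDegSet G) : x.2 ≠ 0 := by
  obtain ⟨V, hV, -, h⟩ := hx
  rw [h]
  exact (finrank_pos_of_simple hV).ne'

variable {k : Type} [Field k] [Fintype k] [DecidableEq k]

/-- The irreducible characters of `GL₃` of degree divisible by the characteristic. -/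
noncomputable def defectChar :
    MulChar k ℂ ⊕ MulChar k ℂ ⊕ MulChar k ℂ × MulChar k ℂ → (GL (Fin 3) k → ℂ) × ℕ
  | .inl α => (pi3 α, Nat.card k ^ 2 + Nat.card k)
  | .inr (.inl α) => (st3 α, Nat.card k ^ 3)
  | .inr (.inr x) => (indPar (st2 x.1) x.2, (Nat.card k ^ 2 + Nat.card k + 1) * Nat.card k)

theorem defectChar_injOn [Fintype (MulChar k ℂ)] [DecidableEq (MulChar k ℂ)] :
    Set.InjOn (defectChar (k := k)) ↑((Finset.univ : Finset (MulChar k ℂ)).disjSum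
      ((Finset.univ : Finset (MulChar k ℂ)).disjSum
        (Finset.univ : Finset (MulChar k ℂ)).offDiag)) := by
  have hq : 1 < Nat.card k := Finite.one_lt_card
  have h1 : Nat.card k ^ 2 + Nat.card k ≠ Nat.card k ^ 3 := by
    intro h
    have h2 : Nat.card k + 1 = Nat.card k * Nat.card k :=
      Nat.eq_of_mul_eq_mul_left (by omega : 0 < Nat.card k) (by linear_combination h)
    nlinarith
  have h2 : Nat.card k ^ 2 + Nat.card k ≠ (Nat.card k ^ 2 + Nat.card k + 1) * Nat.card k := by
    nlinarith
  have h3 : Nat.card k ^ 3 ≠ (Nat.card k ^ 2 + Nat.card k + 1) * Nat.card k := by nlinarith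
  rintro (α | α | ⟨α, β⟩) hx (α' | α' | ⟨α', β'⟩) hy h
  · rw [pi3_injective (Prod.ext_iff.1 h).1]
  · exact (h1 (Prod.ext_iff.1 h).2).elim
  · exact (h2 (Prod.ext_iff.1 h).2).elim
  · exact (h1 (Prod.ext_iff.1 h).2.symm).elim
  · rw [st3_injective (Prod.ext_iff.1 h).1]
  · exact (h3 (Prod.ext_iff.1 h).2).elim
  · exact (h2 (Prod.ext_iff.1 h).2.symm).elim
  · exact (h3 (Prod.ext_iff.1 h).2.symm).elim
  · have hne : α ≠ β := by simpa using hx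
    obtain ⟨rfl, rfl⟩ := indPar_st2_injective hne (Prod.ext_iff.1 h).1
    rfl

theorem padicValRat_prod_degrees {p e : ℕ} [hp : Fact p.Prime] (he : 0 < e)
    (hk : Nat.card k = p ^ e) :
    (∏ᶠ x ∈ irrCharDegSet (GL (Fin 3) k), (x.2 : ℚ)) ≠ 0 ∧
    padicValRat p (∏ᶠ x ∈ irrCharDegSet (GL (Fin 3) k), (x.2 : ℚ)) =
      (e : ℤ) * ((p : ℤ) ^ e - 1) * ((p : ℤ) ^ e + 2) := by
  classical
  have := Fintype.ofFinite (MulChar k ℂ)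
  have hfin := irrCharDegSet_finite (GL (Fin 3) k)
  rw [finprod_mem_eq_finite_toFinset_prod _ hfin]
  have hne : ∀ x ∈ hfin.toFinset, x.2 ≠ 0 := fun x hx =>
    irrCharDegSet_snd_ne_zero (hfin.mem_toFinset.1 hx)
  refine ⟨Finset.prod_ne_zero_iff.2 fun x hx => Nat.cast_ne_zero.2 (hne x hx), ?_⟩
  rw [padicValRat_prod _ _ hne]
  have hpq : p ∣ Nat.card k := hk ▸ dvd_pow_self p he.ne'
  have hp1 : ¬ p ∣ 1 := hp.1.one_lt.ne' ∘ Nat.dvd_one.1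
  have hv1 : padicValNat p (Nat.card k ^ 2 + Nat.card k) = e := by
    have h1 : Nat.card k ^ 2 + Nat.card k = p ^ e * (Nat.card k + 1) := by rw [← hk]; ring
    rw [h1, padicValNat_pow_mul]
    rwa [Nat.dvd_add_right hpq]
  have hv2 : padicValNat p (Nat.card k ^ 3) = 3 * e := by
    rw [hk, padicValNat.pow, padicValNat.prime_pow]
  have hv3 : padicValNat p ((Nat.card k ^ 2 + Nat.card k + 1) * Nat.card k) = e := by
    rw [mul_comm]
    nth_rw 1 [hk]
    rw [padicValNat_pow_mul]
    rwa [Nat.dvd_add_right (dvd_add (dvd_pow hpq two_ne_zero) hpq)]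
  have hcard : (Fintype.card (MulChar k ℂ) : ℤ) = (p : ℤ) ^ e - 1 := by
    rw [← Nat.card_eq_fintype_card, MulChar.card_eq_card_units_of_hasEnoughRootsOfUnity,
      Nat.card_eq_fintype_card, Fintype.card_units, ← Nat.card_eq_fintype_card,
      Nat.cast_sub Nat.card_pos, hk]
    push_cast
    rfl
  set T := (Finset.univ : Finset (MulChar k ℂ)).disjSum
    ((Finset.univ : Finset (MulChar k ℂ)).disjSum
      (Finset.univ : Finset (MulChar k ℂ)).offDiag) with hT
  have hsub : T.image (defectChar (k := k)) ⊆ hfin.toFinset := by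
    intro x hx
    obtain ⟨y, hy, rfl⟩ := Finset.mem_image.1 hx
    rw [hfin.mem_toFinset, mem_irrCharDegSet]
    rcases y with α | α | ⟨α, β⟩
    · exact ⟨pi3_mem_irrChars α, by simp [defectChar, pi3_one]⟩
    · exact ⟨st3_mem_irrChars α, by simp [defectChar, st3_one]⟩
    · exact ⟨indPar_st2_mem_irrChars (by simpa [hT] using hy),
        by simp [defectChar, indPar_st2_one]⟩
  rw [← Finset.sum_subset hsub, Finset.sum_image defectChar_injOn, Finset.sum_disjSum,
    Finset.sum_disjSum]
  · simp only [defectChar, hv1, hv2, hv3, Finset.sum_const, Finset.card_univ,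
      Finset.offDiag_card, nsmul_eq_mul]
    rw [Nat.cast_sub (Nat.le_mul_self _)]
    push_cast
    rw [hcard]
    ring
  · intro x hx hxT
    obtain ⟨h1, h2⟩ := mem_irrCharDegSet.1 (hfin.mem_toFinset.1 hx)
    have hmem : ∀ y ∈ T, (defectChar y).1 = x.1 → False := by
      intro y hy hyx
      have h3 := (mem_irrCharDegSet.1 (hfin.mem_toFinset.1
        (hsub (Finset.mem_image_of_mem defectChar hy)))).2
      refine hxT (Finset.mem_image.2 ⟨y, hy, Prod.ext hyx (Nat.cast_injective (R := ℂ) ?_)⟩)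
      rw [← h2, ← h3, hyx]
    rcases irrChars_GL3_degree h1 with ⟨d, hd, hco⟩ | ⟨α, h⟩ | ⟨α, h⟩ | ⟨α, β, hαβ, h⟩
    · rw [Nat.cast_eq_zero]
      refine padicValNat.eq_zero_of_not_dvd fun hdvd => ?_
      have h3 : d = (x.2 : ℤ) := by
        rw [h2] at hd
        exact_mod_cast hd.symm
      rw [h3, Nat.isCoprime_iff_coprime] at hco
      exact hp1 (hco ▸ Nat.dvd_gcd hdvd hpq)
    · exact (hmem (.inl α) (by simp [hT]) h.symm).elim
    · exact (hmem (.inr (.inl α)) (by simp [hT]) h.symm).elim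
    · exact (hmem (.inr (.inr (α, β))) (by simpa [hT] using hαβ) h.symm).elim

end DegreeValuation

section Representatives

set_option linter.unusedSectionVars false

variable {k : Type} [Field k]

theorem isConj_of_mul_eq {n : ℕ} {g h : GL (Fin n) k} (Q : Matrix (Fin n) (Fin n) k)
    (hQ : Q.det ≠ 0) (hgh : g.1 * Q = Q * h.1) : IsConj g h := by
  set q := Matrix.GeneralLinearGroup.mkOfDetNeZero Q hQ with hq
  have h1 : g * q = q * h := Units.ext hgh
  rw [isConj_iff]
  exact ⟨q⁻¹, by rw [inv_inv, mul_assoc, h1, inv_mul_cancel_left]⟩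

theorem exists_mul_eq_of_isConj {n : ℕ} {g h : GL (Fin n) k} (H : IsConj g h) :
    ∃ c : GL (Fin n) k, h.1 = c.1 * g.1 * (c⁻¹).1 := by
  obtain ⟨c, rfl⟩ := isConj_iff.1 H
  exact ⟨c, rfl⟩

theorem exists_isConj_of_det_ne_zero {n : ℕ} (g : GL (Fin n) k) (Q : Matrix (Fin n) (Fin n) k)
    (hQ : Q.det ≠ 0) : ∃ h : GL (Fin n) k, IsConj g h ∧ ∀ j j',
      (∀ i, (g.1 * Q) i j = Q i j') → ∀ i, h.1 i j = (1 : Matrix (Fin n) (Fin n) k) i j' := by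
  set q := Matrix.GeneralLinearGroup.mkOfDetNeZero Q hQ with hq
  refine ⟨q⁻¹ * g * q, isConj_of_mul_eq Q hQ ?_, ?_⟩
  · have h1 : g * q = q * (q⁻¹ * g * q) := by group
    exact congrArg Units.val h1
  · intro j j' hj i
    have h1 : (q⁻¹).1 * q.1 = 1 := q.inv_mul
    have h2 : (q⁻¹ * g * q).1 = (q⁻¹).1 * (g.1 * Q) := mul_assoc _ _ _
    have h3 : (q⁻¹).1 * Q = 1 := h1
    rw [h2, ← h3, Matrix.mul_apply, Matrix.mul_apply]
    exact Finset.sum_congr rfl fun l _ => by rw [hj]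

/-- The companion matrix of `X ^ 3 - c₂ X ^ 2 - c₁ X - c₀`. -/
noncomputable def comp3 (c : kˣ × k × k) : GL (Fin 3) k :=
  Matrix.GeneralLinearGroup.mkOfDetNeZero !![0, 0, (c.1 : k); 1, 0, c.2.1; 0, 1, c.2.2]
    (by rw [Matrix.det_fin_three]; simp)

/-- A non-scalar matrix annihilated by `(X - a) (X - b)`, where `a` has a plane of
eigenvectors. -/
noncomputable def quad3 (x : kˣ × kˣ) : GL (Fin 3) k :=
  Matrix.GeneralLinearGroup.mkOfDetNeZero
    !![(x.1 : k), 0, 0; 0, (x.1 : k), 1; 0, 0, (x.2 : k)]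
    (by rw [Matrix.det_fin_three]; simp)

/-- A scalar matrix of size three. -/
noncomputable def scal3 (a : kˣ) : GL (Fin 3) k :=
  Matrix.GeneralLinearGroup.mkOfDetNeZero
    !![(a : k), 0, 0; 0, (a : k), 0; 0, 0, (a : k)]
    (by rw [Matrix.det_fin_three]; simp)

theorem comp3_val (c : kˣ × k × k) :
    (comp3 c).1 = !![0, 0, (c.1 : k); 1, 0, c.2.1; 0, 1, c.2.2] := rfl

theorem quad3_val (x : kˣ × kˣ) :
    (quad3 x).1 = !![(x.1 : k), 0, 0; 0, (x.1 : k), 1; 0, 0, (x.2 : k)] := rfl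

theorem scal3_val (a : kˣ) :
    (scal3 a).1 = !![(a : k), 0, 0; 0, (a : k), 0; 0, 0, (a : k)] := rfl

theorem scal3_val_eq_smul (a : kˣ) : (scal3 a).1 = (a : k) • (1 : Matrix (Fin 3) (Fin 3) k) := by
  refine Matrix.ext fun i j => ?_
  fin_cases i <;> fin_cases j <;> simp [scal3_val]

/-- The matrix with columns `v`, `g v` and `w`. -/
def colMatrix (g : Matrix (Fin 3) (Fin 3) k) (v w : Fin 3 → k) : Matrix (Fin 3) (Fin 3) k :=
  Matrix.of fun i j => ![v i, g.mulVec v i, w i] j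

theorem exists_comp3_of_cyclic (g : GL (Fin 3) k) (v : Fin 3 → k)
    (h : (colMatrix g.1 v (g.1.mulVec (g.1.mulVec v))).det ≠ 0) :
    ∃ c, IsConj (comp3 c) g := by
  obtain ⟨m, hm, hcol⟩ := exists_isConj_of_det_ne_zero g _ h
  have h0 := hcol 0 1 fun i => by
    simp [colMatrix, Matrix.mul_apply, Matrix.mulVec, dotProduct]
  have h1 := hcol 1 2 fun i => by
    simp [colMatrix, Matrix.mul_apply, Matrix.mulVec, dotProduct]
  have hd := m.val_det_ne_zero
  rw [Matrix.det_fin_three] at hd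
  simp [h0, h1] at hd
  refine ⟨(Units.mk0 _ hd, m.1 1 2, m.1 2 2), ?_⟩
  convert hm.symm
  refine Units.ext (Matrix.ext fun i j => ?_)
  fin_cases i <;> fin_cases j <;> simp [comp3_val, h0, h1]

theorem exists_scal3_or_exists_det_ne_zero (g : GL (Fin 3) k) :
    (∃ a, g = scal3 a) ∨ ∃ v w, (colMatrix g.1 v w).det ≠ 0 := by
  by_contra! H
  obtain ⟨H1, H2⟩ := H
  simp only [Matrix.det_fin_three, colMatrix, Matrix.of_apply, Matrix.mulVec, dotProduct,
    Fin.sum_univ_three] at H2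
  have h10 := H2 ![1, 0, 0] ![0, 0, 1]
  have h20 := H2 ![1, 0, 0] ![0, 1, 0]
  have h01 := H2 ![0, 1, 0] ![0, 0, 1]
  have h21 := H2 ![0, 1, 0] ![1, 0, 0]
  have h02 := H2 ![0, 0, 1] ![0, 1, 0]
  have h12 := H2 ![0, 0, 1] ![1, 0, 0]
  simp at h10 h20 h01 h21 h02 h12
  have h1 := H2 ![1, 1, 0] ![0, 0, 1]
  have h2 := H2 ![1, 0, 1] ![0, 1, 0]
  simp [h10, h20, h01, h21, h02, h12] at h1 h2
  have hd := g.val_det_ne_zero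
  rw [Matrix.det_fin_three] at hd
  have h0 : g.1 0 0 ≠ 0 := fun h0 => hd (by rw [h0, h01, h02]; ring)
  refine H1 (Units.mk0 _ h0) (Units.ext (Matrix.ext fun i j => ?_))
  fin_cases i <;> fin_cases j <;> simp [scal3_val, h10, h20, h01, h21, h02, h12]
  · linear_combination h1
  · linear_combination -h2

theorem exists_rep_of_eq {g : GL (Fin 3) k} {x y r t : k}
    (hg : g.1 = !![0, x, r; 1, y, 0; 0, 0, t]) :
    (∃ c, IsConj (comp3 c) g) ∨ ∃ c, IsConj (quad3 c) g := by
  by_cases hr : r = 0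
  · subst hr
    by_cases hf : t ^ 2 - t * y - x = 0
    · obtain ⟨b, rfl⟩ : ∃ b, y = t + b := ⟨y - t, by ring⟩
      obtain rfl : x = -(t * b) := by linear_combination -hf
      have hd := g.val_det_ne_zero
      rw [hg, Matrix.det_fin_three] at hd
      simp at hd
      refine Or.inr ⟨(Units.mk0 t hd.1.1, Units.mk0 b hd.1.2), IsConj.symm ?_⟩
      refine isConj_of_mul_eq !![0, -b, 1; 0, 1, 0; 1, 0, 0] ?_ (Matrix.ext fun i j => ?_)
      · rw [Matrix.det_fin_three]; simp
      · fin_cases i <;> fin_cases j <;> simp [hg, quad3_val] <;> ring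
    · refine Or.inl (exists_comp3_of_cyclic g ![1, 0, 1] fun h => hf ?_)
      simp [Matrix.det_fin_three, colMatrix, hg, Matrix.mulVec, dotProduct,
        Fin.sum_univ_three] at h
      linear_combination h
  · refine Or.inl (exists_comp3_of_cyclic g ![0, 0, 1] fun h => hr ?_)
    simp [Matrix.det_fin_three, colMatrix, hg, Matrix.mulVec, dotProduct,
      Fin.sum_univ_three] at h
    exact h

theorem exists_rep (g : GL (Fin 3) k) :
    (∃ c, IsConj (comp3 c) g) ∨ (∃ x, IsConj (quad3 x) g) ∨ ∃ a, IsConj (scal3 a) g := by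
  rcases exists_scal3_or_exists_det_ne_zero g with ⟨a, rfl⟩ | ⟨v, w, hvw⟩
  · exact Or.inr (Or.inr ⟨a, IsConj.refl _⟩)
  obtain ⟨m, hm, hcol⟩ := exists_isConj_of_det_ne_zero g _ hvw
  have h0 := hcol 0 1 fun i => by
    simp [colMatrix, Matrix.mul_apply, Matrix.mulVec, dotProduct]
  by_cases hz : m.1 2 1 = 0
  · obtain ⟨n, hn⟩ : ∃ n : GL (Fin 3) k,
        n.1 = !![0, m.1 0 1, m.1 0 2 + m.1 2 2 * m.1 1 2; 1, m.1 1 1, 0; 0, 0, m.1 2 2] := by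
      have hd := m.val_det_ne_zero
      rw [Matrix.det_fin_three] at hd
      refine ⟨Matrix.GeneralLinearGroup.mkOfDetNeZero _ ?_, rfl⟩
      rw [Matrix.det_fin_three]
      simpa [h0, hz] using hd
    have hmn : IsConj m n := by
      refine isConj_of_mul_eq !![1, 0, -m.1 1 2; 0, 1, 0; 0, 0, 1] ?_ (Matrix.ext fun i j => ?_)
      · rw [Matrix.det_fin_three]; simp
      · fin_cases i <;> fin_cases j <;>
          simp [hn, h0, hz, Matrix.mul_apply, Fin.sum_univ_three] <;> ring
    have hgn := (hm.trans hmn).symm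
    rcases exists_rep_of_eq hn with ⟨c, hc⟩ | ⟨c, hc⟩
    · exact Or.inl ⟨c, hc.trans hgn⟩
    · exact Or.inr (Or.inl ⟨c, hc.trans hgn⟩)
  · obtain ⟨c, hc⟩ := exists_comp3_of_cyclic m ![1, 0, 0] fun h => hz (by
      simpa [Matrix.det_fin_three, colMatrix, Matrix.mulVec, dotProduct,
        Fin.sum_univ_three, h0] using h)
    exact Or.inl ⟨c, hc.trans hm.symm⟩

theorem comp3_cube (c : kˣ × k × k) : (comp3 c).1 ^ 3 =
    c.2.2 • (comp3 c).1 ^ 2 + c.2.1 • (comp3 c).1 + (c.1 : k) • 1 := by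
  refine Matrix.ext fun i j => ?_
  fin_cases i <;> fin_cases j <;> simp [comp3_val, pow_succ] <;> ring

theorem quad3_sq (x : kˣ × kˣ) : (quad3 x).1 ^ 2 =
    (x.1 + x.2 : k) • (quad3 x).1 + (-(x.1 * x.2) : k) • 1 := by
  refine Matrix.ext fun i j => ?_
  fin_cases i <;> fin_cases j <;> simp [quad3_val, pow_succ] <;> ring

theorem conj_pow_val {n : ℕ} (c : GL (Fin n) k) (A : Matrix (Fin n) (Fin n) k) (m : ℕ) :
    (c.1 * A * (c⁻¹).1) ^ m = c.1 * A ^ m * (c⁻¹).1 := by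
  induction m with
  | zero => rw [pow_zero, pow_zero, mul_one]; exact c.mul_inv.symm
  | succ m ih =>
    have h : (c⁻¹).1 * c.1 = 1 := c.inv_mul
    rw [pow_succ, ih, pow_succ]
    simp only [mul_assoc]
    rw [← mul_assoc (c⁻¹).1 c.1, h, one_mul]

theorem cube_eq_of_isConj {n : ℕ} {g h : GL (Fin n) k} (H : IsConj g h) {x y z : k}
    (hg : g.1 ^ 3 = x • g.1 ^ 2 + y • g.1 + z • 1) :
    h.1 ^ 3 = x • h.1 ^ 2 + y • h.1 + z • 1 := by
  obtain ⟨c, hc⟩ := exists_mul_eq_of_isConj H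
  have h1 : c.1 * (c⁻¹).1 = 1 := c.mul_inv
  rw [hc, conj_pow_val, conj_pow_val, hg]
  simp only [mul_add, add_mul, Matrix.mul_smul, Matrix.smul_mul, mul_one, h1]

theorem sq_eq_of_isConj {n : ℕ} {g h : GL (Fin n) k} (H : IsConj g h) {y z : k}
    (hg : g.1 ^ 2 = y • g.1 + z • 1) : h.1 ^ 2 = y • h.1 + z • 1 := by
  obtain ⟨c, hc⟩ := exists_mul_eq_of_isConj H
  have h1 : c.1 * (c⁻¹).1 = 1 := c.mul_inv
  rw [hc, conj_pow_val, hg]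
  simp only [mul_add, add_mul, Matrix.mul_smul, Matrix.smul_mul, mul_one, h1]

theorem eq_scal3_of_isConj {a : kˣ} {h : GL (Fin 3) k} (H : IsConj (scal3 a) h) :
    h = scal3 a := by
  obtain ⟨c, hc⟩ := exists_mul_eq_of_isConj H
  have h1 : c.1 * (c⁻¹).1 = 1 := c.mul_inv
  refine Units.ext ?_
  rw [hc, scal3_val_eq_smul, Matrix.mul_smul, Matrix.smul_mul, mul_one, h1]

theorem comp3_injective_of_isConj {c c' : kˣ × k × k} (H : IsConj (comp3 c) (comp3 c')) :
    c = c' := by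
  have h := cube_eq_of_isConj H (comp3_cube c)
  have h0 := congrFun (congrFun h 0) 0
  have h1 := congrFun (congrFun h 1) 0
  have h2 := congrFun (congrFun h 2) 0
  simp [comp3_val, pow_succ] at h0 h1 h2
  exact Prod.ext (Units.ext h0.symm) (Prod.ext h1.symm h2.symm)

theorem not_isConj_quad3_comp3 (x : kˣ × kˣ) (c : kˣ × k × k) :
    ¬ IsConj (quad3 x) (comp3 c) := by
  intro H
  have h := congrFun (congrFun (sq_eq_of_isConj H (quad3_sq x)) 2) 0
  simp [comp3_val, pow_succ] at h

theorem quad3_injective_of_isConj {x x' : kˣ × kˣ} (H : IsConj (quad3 x) (quad3 x')) :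
    x = x' := by
  have h := congrFun (congrFun (sq_eq_of_isConj H (quad3_sq x)) 1) 2
  simp [quad3_val, pow_succ] at h
  obtain ⟨c, hc⟩ := exists_mul_eq_of_isConj H
  have h1 : (c⁻¹).1 * c.1 = 1 := c.inv_mul
  have ht := congrArg Matrix.trace hc
  rw [Matrix.trace_mul_comm, ← mul_assoc, h1, one_mul, Matrix.trace_fin_three,
    Matrix.trace_fin_three] at ht
  simp [quad3_val] at ht
  refine Prod.ext (Units.ext ?_) (Units.ext ?_)
  · linear_combination h - ht
  · linear_combination ht - 2 * h

/-- Representatives of the conjugacy classes of `GL₃`. -/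
noncomputable def rep3 : (kˣ × k × k) ⊕ (kˣ × kˣ) ⊕ kˣ → GL (Fin 3) k
  | .inl c => comp3 c
  | .inr (.inl x) => quad3 x
  | .inr (.inr a) => scal3 a

theorem rep3_bijective : Function.Bijective fun d => ConjClasses.mk (rep3 (k := k) d) := by
  refine ⟨?_, ?_⟩
  · have hc : ∀ (a : kˣ) (c : kˣ × k × k), ¬ IsConj (scal3 a) (comp3 c) := fun a c H => by
      have h := congrArg (fun g : GL (Fin 3) k => g.1 1 0) (eq_scal3_of_isConj H)
      simp [comp3_val, scal3_val] at h
    have hx : ∀ (a : kˣ) (x : kˣ × kˣ), ¬ IsConj (scal3 a) (quad3 x) := fun a c H => by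
      have h := congrArg (fun g : GL (Fin 3) k => g.1 1 2) (eq_scal3_of_isConj H)
      simp [quad3_val, scal3_val] at h
    rintro (c | x | a) (c' | x' | a') h <;> replace h := ConjClasses.mk_eq_mk_iff_isConj.1 h
    · rw [comp3_injective_of_isConj h]
    · exact (not_isConj_quad3_comp3 x' c h.symm).elim
    · exact (hc _ _ h.symm).elim
    · exact (not_isConj_quad3_comp3 _ _ h).elim
    · rw [quad3_injective_of_isConj h]
    · exact (hx _ _ h.symm).elim
    · exact (hc _ _ h).elim
    · exact (hx _ _ h).elim
    · have h1 := congrArg (fun g : GL (Fin 3) k => g.1 0 0) (eq_scal3_of_isConj h)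
      simp [rep3, scal3_val] at h1
      rw [Units.ext h1]
  · intro K
    obtain ⟨g, rfl⟩ := ConjClasses.mk_surjective K
    rcases exists_rep g with ⟨c, h⟩ | ⟨x, h⟩ | ⟨a, h⟩
    · exact ⟨.inl c, ConjClasses.mk_eq_mk_iff_isConj.2 h⟩
    · exact ⟨.inr (.inl x), ConjClasses.mk_eq_mk_iff_isConj.2 h⟩
    · exact ⟨.inr (.inr a), ConjClasses.mk_eq_mk_iff_isConj.2 h⟩

end Representatives

section Centralizers

set_option linter.unusedSectionVars false

theorem ncard_carrier_mul_card_centralizer {G : Type} [Group G] (g : G) :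
    (ConjClasses.mk g).carrier.ncard * Nat.card (Subgroup.centralizer {g}) = Nat.card G := by
  rw [Subgroup.nat_card_centralizer_nat_card_stabilizer, ← ConjAct.orbit_eq_carrier_conjClasses,
    ← MulAction.index_stabilizer, mul_comm, Subgroup.card_mul_index]
  rfl

theorem card_centralizer_eq_of_isConj {G : Type} [Group G] [Finite G] {g h : G}
    (H : IsConj g h) :
    Nat.card (Subgroup.centralizer {g}) = Nat.card (Subgroup.centralizer {h}) := by
  have h1 := ncard_carrier_mul_card_centralizer g
  have h2 := ncard_carrier_mul_card_centralizer h
  rw [ConjClasses.mk_eq_mk_iff_isConj.2 H, ← h2] at h1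
  refine Nat.eq_of_mul_eq_mul_left (Nat.pos_of_ne_zero fun h0 => ?_) h1
  rw [h0, zero_mul] at h2
  exact Nat.card_pos.ne h2

theorem card_centralizer_eq {X G : Type} [Group G] {g : G} (φ : X → G)
    (hφ : Function.Injective φ) (h : ∀ x : G, x * g = g * x ↔ ∃ y, φ y = x) :
    Nat.card (Subgroup.centralizer {g}) = Nat.card X := by
  refine (Nat.card_eq_of_bijective
    (fun y => (⟨φ y, Subgroup.mem_centralizer_singleton_iff.2 ((h _).2 ⟨y, rfl⟩)⟩ :
      Subgroup.centralizer {g})) ⟨fun x y hxy => hφ (congrArg Subtype.val hxy), fun x => ?_⟩).symm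
  obtain ⟨y, hy⟩ := (h x).1 (Subgroup.mem_centralizer_singleton_iff.1 x.2)
  exact ⟨y, Subtype.ext hy⟩

variable {k : Type} [Field k]

theorem mul_eq_mul_iff_three {g h : GL (Fin 3) k} :
    g * h = h * g ↔ ∀ i j, g.1 i 0 * h.1 0 j + g.1 i 1 * h.1 1 j + g.1 i 2 * h.1 2 j =
      h.1 i 0 * g.1 0 j + h.1 i 1 * g.1 1 j + h.1 i 2 * g.1 2 j := by
  rw [← Units.val_inj, ← Matrix.ext_iff]
  simp only [Units.val_mul, Matrix.mul_apply, Fin.sum_univ_three]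

theorem card_centralizer_quad3_self (a : kˣ) :
    Nat.card (Subgroup.centralizer {quad3 (a, a)}) = Nat.card (kˣ × kˣ × k × k × k) := by
  refine card_centralizer_eq (fun x => Matrix.GeneralLinearGroup.mkOfDetNeZero
    !![(x.1 : k), 0, x.2.2.1; x.2.2.2.1, (x.2.1 : k), x.2.2.2.2; 0, 0, (x.2.1 : k)]
    (by rw [Matrix.det_fin_three]; simp)) ?_ ?_
  · intro x y h
    have h' : ∀ i j, _ := fun i j => congrArg (fun g : GL (Fin 3) k => g.1 i j) h
    have h1 := h' 0 0
    have h2 := h' 1 1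
    have h3 := h' 0 2
    have h4 := h' 1 0
    have h5 := h' 1 2
    simp [Matrix.GeneralLinearGroup.mkOfDetNeZero, Units.val_inj] at h1 h2 h3 h4 h5
    simp only [Prod.ext_iff]
    exact ⟨h1, h2, h3, h4, h5⟩
  · intro m
    constructor
    · intro h
      rw [mul_eq_mul_iff_three] at h
      have h1 := h 1 1
      have h2 := h 0 2
      have h3 := h 1 2
      have h4 := h 1 0
      simp [quad3_val] at h1 h2 h3 h4
      have hd := m.val_det_ne_zero
      have h01 : m.1 0 1 = 0 := by linear_combination h2
      have h20 : m.1 2 0 = 0 := by linear_combination -h4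
      have h21 : m.1 2 1 = 0 := by linear_combination -h1
      have h22 : m.1 1 1 = m.1 2 2 := by linear_combination h3
      rw [Matrix.det_fin_three] at hd
      simp [h01, h20, h21, h22] at hd
      refine ⟨(Units.mk0 _ hd.1, Units.mk0 _ hd.2, m.1 0 2, m.1 1 0, m.1 1 2),
        Units.ext (Matrix.ext fun i j => ?_)⟩
      fin_cases i <;> fin_cases j <;>
        simp [Matrix.GeneralLinearGroup.mkOfDetNeZero, h01, h20, h21, h22]
    · rintro ⟨x, rfl⟩
      refine Units.ext (Matrix.ext fun i j => ?_)
      fin_cases i <;> fin_cases j <;>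
        simp [Matrix.GeneralLinearGroup.mkOfDetNeZero, quad3_val] <;> ring

theorem card_centralizer_quad3_of_ne {a b : kˣ} (hab : a ≠ b) :
    Nat.card (Subgroup.centralizer {quad3 (a, b)}) = Nat.card (GL (Fin 2) k × kˣ) := by
  have hd : (b : k) - a ≠ 0 := sub_ne_zero.2 fun h => hab (Units.ext h.symm)
  refine card_centralizer_eq (fun x => block3 x.1 x.2
    (-x.1.1 0 1 / (b - a), (x.2 - x.1.1 1 1) / (b - a))) ?_ ?_
  · intro x y h
    have h' : ∀ i j, _ := fun i j => congrArg (fun g : GL (Fin 3) k => g.1 i j) h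
    have h1 := h' 0 0
    have h2 := h' 0 1
    have h3 := h' 1 0
    have h4 := h' 1 1
    have h5 := h' 2 2
    simp [block3_val, Units.val_inj] at h1 h2 h3 h4 h5
    refine Prod.ext (Units.ext (Matrix.ext fun i j => ?_)) h5
    fin_cases i <;> fin_cases j <;> simp [h1, h2, h3, h4]
  · intro m
    constructor
    · intro h
      rw [mul_eq_mul_iff_three] at h
      have h1 := h 1 1
      have h2 := h 0 2
      have h3 := h 1 2
      have h4 := h 1 0
      simp [quad3_val] at h1 h2 h3 h4
      have h20 : m.1 2 0 = 0 := by linear_combination -h4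
      have h21 : m.1 2 1 = 0 := by linear_combination -h1
      have h02 : m.1 0 2 = -m.1 0 1 / (b - a) := by
        rw [eq_div_iff hd]
        linear_combination h2
      have h12 : m.1 1 2 = (m.1 2 2 - m.1 1 1) / (b - a) := by
        rw [eq_div_iff hd]
        linear_combination h3
      have hdet := m.val_det_ne_zero
      rw [Matrix.det_fin_three] at hdet
      have hdet' : (m.1 0 0 * m.1 1 1 - m.1 0 1 * m.1 1 0) * m.1 2 2 ≠ 0 := by
        intro h0
        rw [h20, h21] at hdet
        exact hdet (by linear_combination h0)
      obtain ⟨hA, hu⟩ := mul_ne_zero_iff.1 hdet'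
      refine ⟨(Matrix.GeneralLinearGroup.mkOfDetNeZero
        !![m.1 0 0, m.1 0 1; m.1 1 0, m.1 1 1] (by rwa [Matrix.det_fin_two]), Units.mk0 _ hu),
        Units.ext (Matrix.ext fun i j => ?_)⟩
      fin_cases i <;> fin_cases j <;>
        simp [Matrix.GeneralLinearGroup.mkOfDetNeZero, block3_val, h20, h21, h02, h12]
    · rintro ⟨x, rfl⟩
      refine Units.ext (Matrix.ext fun i j => ?_)
      fin_cases i <;> fin_cases j <;> simp [block3_val, quad3_val] <;> field_simp <;> ring

/-- A matrix with characteristic and minimal polynomial `(X - a) ^ 2 (X - b)`. -/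
noncomputable def tri3 (x : kˣ × kˣ) : GL (Fin 3) k :=
  Matrix.GeneralLinearGroup.mkOfDetNeZero
    !![(x.1 : k), 1, 0; 0, (x.1 : k), 1; 0, 0, (x.2 : k)]
    (by rw [Matrix.det_fin_three]; simp)

theorem tri3_val (x : kˣ × kˣ) :
    (tri3 x).1 = !![(x.1 : k), 1, 0; 0, (x.1 : k), 1; 0, 0, (x.2 : k)] := rfl

/-- The coefficients of `X ^ 3 - (X - a) ^ 2 (X - b)`. -/
def triCoeff (x : kˣ × kˣ) : kˣ × k × k :=
  (x.1 ^ 2 * x.2, -((x.1 : k) ^ 2 + 2 * x.1 * x.2), 2 * x.1 + x.2)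

theorem isConj_tri3_comp3 (x : kˣ × kˣ) : IsConj (tri3 x) (comp3 (triCoeff x)) := by
  refine isConj_of_mul_eq !![0, 0, 1; 0, 1, (x.1 + x.2 : k); 1, (x.2 : k), (x.2 : k) ^ 2] ?_
    (Matrix.ext fun i j => ?_)
  · rw [Matrix.det_fin_three]; simp
  · fin_cases i <;> fin_cases j <;> simp [tri3_val, comp3_val, triCoeff] <;> ring

theorem triCoeff_injective : Function.Injective (triCoeff (k := k)) := by
  rintro ⟨a, b⟩ ⟨c, d⟩ h
  simp only [triCoeff, Prod.ext_iff, ← Units.val_inj, Units.val_mul, Units.val_pow_eq_pow_val]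
    at h
  obtain ⟨h0, h1, h2⟩ := h
  have hac : (a : k) = c := by
    by_contra hne
    have hne' : (a : k) - c ≠ 0 := sub_ne_zero.2 hne
    have e1 : ((a : k) - c) ^ 2 * (a - d) = 0 := by
      linear_combination h0 + a * h1 + a ^ 2 * h2
    have e2 : ((c : k) - a) ^ 2 * (c - b) = 0 := by
      linear_combination -h0 - c * h1 - c ^ 2 * h2
    have e3 := (mul_eq_zero.1 e1).resolve_left (pow_ne_zero 2 hne')
    have e4 := (mul_eq_zero.1 e2).resolve_left
      (pow_ne_zero 2 (sub_ne_zero.2 (Ne.symm hne)))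
    exact hne' (by linear_combination h2 - e3 + e4)
  exact Prod.ext (Units.ext hac) (Units.ext (by linear_combination h2 - 2 * hac))

theorem mul_tri3_comm {m : GL (Fin 3) k} {x : kˣ × kˣ} (h : m * tri3 x = tri3 x * m) :
    m.1 1 0 = 0 ∧ m.1 2 0 = 0 ∧ m.1 2 1 = 0 ∧ m.1 1 1 = m.1 0 0 ∧
      m.1 1 2 = m.1 0 1 + (x.2 - x.1) * m.1 0 2 ∧ m.1 2 2 = m.1 0 0 + (x.2 - x.1) * m.1 1 2 := by
  rw [mul_eq_mul_iff_three] at h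
  have h1 := h 0 0
  have h2 := h 1 0
  have h3 := h 1 1
  have h4 := h 0 1
  have h5 := h 0 2
  have h6 := h 1 2
  simp [tri3_val] at h1 h2 h3 h4 h5 h6
  have h10 : m.1 1 0 = 0 := by linear_combination -h1
  have h20 : m.1 2 0 = 0 := by linear_combination -h2
  have h21 : m.1 2 1 = 0 := by linear_combination h10 - h3
  have h11 : m.1 1 1 = m.1 0 0 := by linear_combination -h4
  exact ⟨h10, h20, h21, h11, by linear_combination -h5, by linear_combination h11 - h6⟩

theorem card_centralizer_tri3_self (a : kˣ) :
    Nat.card (Subgroup.centralizer {tri3 (a, a)}) = Nat.card (kˣ × k × k) := by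
  refine card_centralizer_eq (fun x => Matrix.GeneralLinearGroup.mkOfDetNeZero
    !![(x.1 : k), x.2.1, x.2.2; 0, (x.1 : k), x.2.1; 0, 0, (x.1 : k)]
    (by rw [Matrix.det_fin_three]; simp)) ?_ ?_
  · intro x y h
    have h' : ∀ i j, _ := fun i j => congrArg (fun g : GL (Fin 3) k => g.1 i j) h
    have h1 := h' 0 0
    have h2 := h' 0 1
    have h3 := h' 0 2
    simp [Matrix.GeneralLinearGroup.mkOfDetNeZero, Units.val_inj] at h1 h2 h3
    simp only [Prod.ext_iff]
    exact ⟨h1, h2, h3⟩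
  · intro m
    constructor
    · intro h
      obtain ⟨h10, h20, h21, h11, h12, h22⟩ := mul_tri3_comm h
      simp only [sub_self, zero_mul, add_zero] at h12 h22
      have hd := m.val_det_ne_zero
      rw [Matrix.det_fin_three] at hd
      simp [h10, h20, h21, h11, h12, h22] at hd
      refine ⟨(Units.mk0 _ hd, m.1 0 1, m.1 0 2), Units.ext (Matrix.ext fun i j => ?_)⟩
      fin_cases i <;> fin_cases j <;>
        simp [Matrix.GeneralLinearGroup.mkOfDetNeZero, h10, h20, h21, h11, h12, h22]
    · rintro ⟨x, rfl⟩
      refine Units.ext (Matrix.ext fun i j => ?_)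
      fin_cases i <;> fin_cases j <;>
        simp [Matrix.GeneralLinearGroup.mkOfDetNeZero, tri3_val] <;> ring

theorem card_centralizer_tri3_of_ne {a b : kˣ} (hab : a ≠ b) :
    Nat.card (Subgroup.centralizer {tri3 (a, b)}) = Nat.card (kˣ × kˣ × k) := by
  have hd : (b : k) - a ≠ 0 := sub_ne_zero.2 fun h => hab (Units.ext h.symm)
  refine card_centralizer_eq (fun x => Matrix.GeneralLinearGroup.mkOfDetNeZero
    !![(x.1 : k), x.2.2, ((x.2.1 - x.1) / (b - a) - x.2.2) / (b - a);
      0, (x.1 : k), (x.2.1 - x.1) / (b - a); 0, 0, (x.2.1 : k)]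
    (by rw [Matrix.det_fin_three]; simp)) ?_ ?_
  · intro x y h
    have h' : ∀ i j, _ := fun i j => congrArg (fun g : GL (Fin 3) k => g.1 i j) h
    have h1 := h' 0 0
    have h2 := h' 2 2
    have h3 := h' 0 1
    simp [Matrix.GeneralLinearGroup.mkOfDetNeZero, Units.val_inj] at h1 h2 h3
    simp only [Prod.ext_iff]
    exact ⟨h1, h2, h3⟩
  · intro m
    constructor
    · intro h
      obtain ⟨h10, h20, h21, h11, h12, h22⟩ := mul_tri3_comm h
      have hdet := m.val_det_ne_zero
      rw [Matrix.det_fin_three] at hdet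
      simp [h10, h20, h21, h11] at hdet
      have h12' : m.1 1 2 = (m.1 2 2 - m.1 0 0) / (b - a) := by
        rw [eq_div_iff hd]
        linear_combination -h22
      have h02 : m.1 0 2 = ((m.1 2 2 - m.1 0 0) / (b - a) - m.1 0 1) / (b - a) := by
        rw [← h12', eq_div_iff hd]
        linear_combination -h12
      refine ⟨(Units.mk0 _ hdet.1, Units.mk0 _ hdet.2, m.1 0 1),
        Units.ext (Matrix.ext fun i j => ?_)⟩
      fin_cases i <;> fin_cases j <;>
        simp [Matrix.GeneralLinearGroup.mkOfDetNeZero, h10, h20, h21, h11, h12', h02]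
    · rintro ⟨x, rfl⟩
      refine Units.ext (Matrix.ext fun i j => ?_)
      fin_cases i <;> fin_cases j <;>
        simp [Matrix.GeneralLinearGroup.mkOfDetNeZero, tri3_val] <;> field_simp <;> ring

end Centralizers

section RegularElements

set_option linter.unusedSectionVars false

open Polynomial

variable {k : Type} [Field k]

/-- The characteristic polynomial of `comp3 c`. -/
noncomputable def compPoly (c : kˣ × k × k) : k[X] :=
  X ^ 3 - (C c.2.2 * X ^ 2 + C c.2.1 * X + C (c.1 : k))

theorem compPoly_monic (c : kˣ × k × k) : (compPoly c).Monic := by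
  unfold compPoly; monicity!

theorem compPoly_natDegree (c : kˣ × k × k) : (compPoly c).natDegree = 3 := by
  unfold compPoly; compute_degree!

theorem aeval_comp3_quadratic (c : kˣ × k × k) (x y z : k) :
    aeval (comp3 c).1 (C x + C y * X + C z * X ^ 2) =
      x • 1 + y • (comp3 c).1 + z • (comp3 c).1 ^ 2 := by
  simp [Algebra.algebraMap_eq_smul_one]

theorem aeval_comp3_compPoly (c : kˣ × k × k) : aeval (comp3 c).1 (compPoly c) = 0 := by
  have h : compPoly c = X ^ 3 - (C (c.1 : k) + C c.2.1 * X + C c.2.2 * X ^ 2) := by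
    unfold compPoly; ring
  rw [h, map_sub, aeval_comp3_quadratic, map_pow, aeval_X, comp3_cube]
  abel

theorem compPoly_dvd_of_aeval_eq_zero {c : kˣ × k × k} {s : k[X]}
    (hs : aeval (comp3 c).1 s = 0) : compPoly c ∣ s := by
  rw [← modByMonic_eq_zero_iff_dvd (compPoly_monic c)]
  have hdeg : (s %ₘ compPoly c).natDegree < 3 := by
    rw [← compPoly_natDegree c]
    exact natDegree_modByMonic_lt s (compPoly_monic c) fun h => by
      simpa [h] using compPoly_natDegree c
  have h0 : aeval (comp3 c).1 (s %ₘ compPoly c) = 0 := by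
    rw [modByMonic_eq_sub_mul_div, map_sub, map_mul, hs, aeval_comp3_compPoly, zero_mul, sub_zero]
  have hr : s %ₘ compPoly c = C ((s %ₘ compPoly c).coeff 0) + C ((s %ₘ compPoly c).coeff 1) * X +
      C ((s %ₘ compPoly c).coeff 2) * X ^ 2 := by
    conv_lhs => rw [as_sum_range_C_mul_X_pow' _ hdeg]
    simp [Finset.sum_range_succ]
  rw [hr, aeval_comp3_quadratic] at h0
  have h1 := congrFun (congrFun h0 0) 0
  have h2 := congrFun (congrFun h0 1) 0
  have h3 := congrFun (congrFun h0 2) 0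
  simp [comp3_val, pow_two, Matrix.mul_apply, Fin.sum_univ_three] at h1 h2 h3
  rw [hr, h1, h2, h3]
  simp

theorem eq_aeval_of_commute_comp3 {c : kˣ × k × k} {g : GL (Fin 3) k}
    (h : g * comp3 c = comp3 c * g) :
    g.1 = aeval (comp3 c).1 (C (g.1 0 0) + C (g.1 1 0) * X + C (g.1 2 0) * X ^ 2) := by
  rw [mul_eq_mul_iff_three] at h
  have h1 := h 0 0
  have h2 := h 1 0
  have h3 := h 2 0
  have h4 := h 0 1
  have h5 := h 1 1
  have h6 := h 2 1
  simp [comp3_val] at h1 h2 h3 h4 h5 h6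
  rw [aeval_comp3_quadratic]
  refine Matrix.ext fun i j => ?_
  fin_cases i <;> fin_cases j <;>
    simp [comp3_val, pow_two, Matrix.mul_apply, Fin.sum_univ_three, h1, h2, h3, h4, h5, h6] <;>
    ring

theorem coeff_eq_of_compPoly_eq {c : kˣ × k × k} {x y z w : k}
    (h : compPoly c = C x * X ^ 3 + C y * X ^ 2 + C z * X + C w) :
    1 = x ∧ -c.2.2 = y ∧ -c.2.1 = z ∧ -(c.1 : k) = w := by
  have e : ∀ n, _ := fun n => congrArg (fun s => coeff s n) h
  have e0 := e 0
  have e1 := e 1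
  have e2 := e 2
  have e3 := e 3
  simp [compPoly, coeff_X, coeff_C, coeff_X_pow] at e0 e1 e2 e3
  exact ⟨e3, e2, e1, e0⟩

theorem compPoly_squarefree {c : kˣ × k × k} (hc : ∀ x, triCoeff x ≠ c) :
    Squarefree (compPoly c) := by
  intro h ⟨m, hm⟩
  have hne := (compPoly_monic c).ne_zero
  have hh0 : h ≠ 0 := by rintro rfl; simp [hm] at hne
  have hm0 : m ≠ 0 := by rintro rfl; simp [hm] at hne
  have hdeg := compPoly_natDegree c
  rw [hm, natDegree_mul (mul_ne_zero hh0 hh0) hm0, natDegree_mul hh0 hh0] at hdeg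
  by_contra hu
  have hh1 : h.natDegree ≠ 0 := fun h0 => hu (isUnit_iff_degree_eq_zero.2
    (by rw [degree_eq_natDegree hh0, h0]; rfl))
  obtain ⟨u, v, rfl⟩ := exists_eq_X_add_C_of_natDegree_le_one (p := h) (by omega)
  obtain ⟨w, z, rfl⟩ := exists_eq_X_add_C_of_natDegree_le_one (p := m) (by omega)
  have hexp : compPoly c = C (u ^ 2 * w) * X ^ 3 + C (u ^ 2 * z + 2 * u * v * w) * X ^ 2 +
      C (v ^ 2 * w + 2 * u * v * z) * X + C (v ^ 2 * z) := by
    rw [hm]; simp only [C_mul, C_pow, C_add, map_ofNat]; ring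
  obtain ⟨e3, e2, e1, e0⟩ := coeff_eq_of_compPoly_eq hexp
  have hu0 : u ≠ 0 := by rintro rfl; simp at e3
  have hw0 : w ≠ 0 := by rintro rfl; simp at e3
  have hv0 : v ≠ 0 := by rintro rfl; simp at e0
  have hz0 : z ≠ 0 := by rintro rfl; simp at e0
  refine hc (Units.mk0 (-v / u) (div_ne_zero (neg_ne_zero.2 hv0) hu0),
    Units.mk0 (-z / w) (div_ne_zero (neg_ne_zero.2 hz0) hw0)) ?_
  have hw : w = 1 / u ^ 2 := by
    rw [eq_div_iff (pow_ne_zero 2 hu0)]; linear_combination -e3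
  subst hw
  refine Prod.ext (Units.ext ?_) (Prod.ext ?_ ?_)
  · simp only [triCoeff, Units.val_mul, Units.val_pow_eq_pow_val, Units.val_mk0]
    field_simp
    linear_combination e0
  · simp only [triCoeff, Units.val_mk0]
    field_simp at e1 ⊢
    linear_combination e1
  · simp only [triCoeff, Units.val_mk0]
    field_simp at e2 ⊢
    linear_combination e2

theorem not_dvd_card_centralizer_comp3 {p : ℕ} [Fact p.Prime] [Finite k] [CharP k p]
    {c : kˣ × k × k} (hc : ∀ x, triCoeff x ≠ c) :
    ¬ p ∣ Nat.card (Subgroup.centralizer {comp3 c}) := by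
  intro hdvd
  obtain ⟨⟨u, hu⟩, hord⟩ := exists_prime_orderOf_dvd_card' p hdvd
  rw [Subgroup.orderOf_mk] at hord
  have hr := eq_aeval_of_commute_comp3 (Subgroup.mem_centralizer_singleton_iff.1 hu)
  set r : k[X] := C (u.1 0 0) + C (u.1 1 0) * X + C (u.1 2 0) * X ^ 2
  have hup : u.1 ^ p = 1 := by
    rw [← Units.val_pow_eq_pow_val, ← hord, pow_orderOf_eq_one, Units.val_one]
  have h1 : compPoly c ∣ (r - 1) ^ p := by
    refine compPoly_dvd_of_aeval_eq_zero ?_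
    rw [sub_pow_char, one_pow, map_sub, map_pow, ← hr, map_one, hup, sub_self]
  obtain ⟨s, hs⟩ := (compPoly_squarefree hc).isRadical _ _ h1
  have h2 : u.1 = 1 := by
    have h3 := congrArg (aeval (comp3 c).1) hs
    rw [map_sub, ← hr, map_one, map_mul, aeval_comp3_compPoly, zero_mul, sub_eq_zero] at h3
    exact h3
  rw [show u = 1 from Units.ext h2, orderOf_one] at hord
  exact (Fact.out : p.Prime).one_lt.ne hord

end RegularElements

section ClassValuation

set_option linter.unusedSectionVars false

variable {k : Type} [Field k] [Finite k] {p e : ℕ} [hp : Fact p.Prime]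

theorem padicValNat_card_units (he : 0 < e) (hk : Nat.card k = p ^ e) :
    padicValNat p (Nat.card kˣ) = 0 := by
  refine padicValNat.eq_zero_of_not_dvd fun h => ?_
  have h1 : Nat.card k = Nat.card kˣ + 1 := by
    rw [Nat.card_units]
    exact (Nat.sub_add_cancel Nat.card_pos).symm
  have h2 : p ∣ Nat.card kˣ + 1 := h1 ▸ hk ▸ dvd_pow_self p he.ne'
  exact hp.1.one_lt.ne' (Nat.dvd_one.1 ((Nat.dvd_add_right h).1 h2))

theorem padicValNat_card_field (hk : Nat.card k = p ^ e) : padicValNat p (Nat.card k) = e := by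
  rw [hk, padicValNat.prime_pow]

theorem not_dvd_pow_sub_one (he : 0 < e) {n : ℕ} (hn : n ≠ 0) : ¬ p ∣ (p ^ e) ^ n - 1 := by
  intro h
  have h1 : p ∣ (p ^ e) ^ n - 1 + 1 := by
    rw [Nat.sub_add_cancel (Nat.pos_of_ne_zero (pow_ne_zero _ (pow_ne_zero _ hp.1.ne_zero)))]
    exact dvd_pow (dvd_pow_self p he.ne') hn
  exact hp.1.one_lt.ne' (Nat.dvd_one.1 ((Nat.dvd_add_right h).1 h1))

theorem padicValNat_card_GL_two (he : 0 < e) (hk : Nat.card k = p ^ e) :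
    padicValNat p (Nat.card (GL (Fin 2) k)) = e := by
  have := Fintype.ofFinite k
  rw [Matrix.card_GL_field, Fin.prod_univ_two, ← Nat.card_eq_fintype_card, hk]
  have h : ((p ^ e) ^ 2 - (p ^ e) ^ ((0 : Fin 2) : ℕ)) * ((p ^ e) ^ 2 - (p ^ e) ^ ((1 : Fin 2) : ℕ))
      = p ^ e * (((p ^ e) ^ 2 - 1) * ((p ^ e) ^ 1 - 1)) := by
    simp only [Fin.val_zero, Fin.val_one, pow_zero, pow_one]
    rw [show (p ^ e) ^ 2 - p ^ e = p ^ e * (p ^ e - 1) by rw [Nat.mul_sub, mul_one, pow_two]]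
    ring
  rw [h, padicValNat_pow_mul]
  rw [hp.1.dvd_mul]
  exact not_or.2 ⟨not_dvd_pow_sub_one he two_ne_zero, not_dvd_pow_sub_one he one_ne_zero⟩

theorem padicValNat_card_GL_three (he : 0 < e) (hk : Nat.card k = p ^ e) :
    padicValNat p (Nat.card (GL (Fin 3) k)) = 3 * e := by
  have := Fintype.ofFinite k
  rw [Matrix.card_GL_field, Fin.prod_univ_three, ← Nat.card_eq_fintype_card, hk]
  have h : ((p ^ e) ^ 3 - (p ^ e) ^ ((0 : Fin 3) : ℕ)) * ((p ^ e) ^ 3 - (p ^ e) ^ ((1 : Fin 3) : ℕ))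
      * ((p ^ e) ^ 3 - (p ^ e) ^ ((2 : Fin 3) : ℕ))
      = p ^ (3 * e) * (((p ^ e) ^ 3 - 1) * (((p ^ e) ^ 2 - 1) * ((p ^ e) ^ 1 - 1))) := by
    simp only [Fin.val_zero, Fin.val_one, Fin.val_two, pow_zero, pow_one]
    rw [show (p ^ e) ^ 3 - p ^ e = p ^ e * ((p ^ e) ^ 2 - 1) by
        rw [Nat.mul_sub, mul_one, pow_succ' _ 2],
      show (p ^ e) ^ 3 - (p ^ e) ^ 2 = (p ^ e) ^ 2 * (p ^ e - 1) by
        rw [Nat.mul_sub, mul_one, pow_succ _ 2]]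
    ring
  rw [h, padicValNat_pow_mul]
  rw [hp.1.dvd_mul, hp.1.dvd_mul]
  exact not_or.2 ⟨not_dvd_pow_sub_one he three_ne_zero,
    not_or.2 ⟨not_dvd_pow_sub_one he two_ne_zero, not_dvd_pow_sub_one he one_ne_zero⟩⟩

variable [DecidableEq k]

theorem padicValNat_card_centralizer_tri3 (he : 0 < e) (hk : Nat.card k = p ^ e) (x : kˣ × kˣ) :
    padicValNat p (Nat.card (Subgroup.centralizer {tri3 x})) =
      if x.1 = x.2 then 2 * e else e := by
  obtain ⟨a, b⟩ := x
  have h1 := padicValNat_card_units he hk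
  have h2 := padicValNat_card_field hk
  have h3 : Nat.card k ≠ 0 := Nat.card_pos.ne'
  have h4 : Nat.card kˣ ≠ 0 := Nat.card_pos.ne'
  split_ifs with h
  · obtain rfl : a = b := h
    rw [card_centralizer_tri3_self, Nat.card_prod, Nat.card_prod,
      padicValNat.mul h4 (mul_ne_zero h3 h3), padicValNat.mul h3 h3, h1, h2]
    ring
  · rw [card_centralizer_tri3_of_ne h, Nat.card_prod, Nat.card_prod,
      padicValNat.mul h4 (mul_ne_zero h4 h3), padicValNat.mul h4 h3, h1, h2]
    ring

theorem padicValNat_card_centralizer_quad3 (he : 0 < e) (hk : Nat.card k = p ^ e) (x : kˣ × kˣ) :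
    padicValNat p (Nat.card (Subgroup.centralizer {quad3 x})) =
      if x.1 = x.2 then 3 * e else e := by
  obtain ⟨a, b⟩ := x
  have h1 := padicValNat_card_units he hk
  have h2 := padicValNat_card_field hk
  have h3 : Nat.card k ≠ 0 := Nat.card_pos.ne'
  have h4 : Nat.card kˣ ≠ 0 := Nat.card_pos.ne'
  split_ifs with h
  · obtain rfl : a = b := h
    rw [card_centralizer_quad3_self]
    simp only [Nat.card_prod]
    rw [padicValNat.mul h4 (mul_ne_zero h4 (mul_ne_zero h3 (mul_ne_zero h3 h3))),
      padicValNat.mul h4 (mul_ne_zero h3 (mul_ne_zero h3 h3)),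
      padicValNat.mul h3 (mul_ne_zero h3 h3), padicValNat.mul h3 h3, h1, h2]
    ring
  · rw [card_centralizer_quad3_of_ne h, Nat.card_prod,
      padicValNat.mul Nat.card_pos.ne' h4, padicValNat_card_GL_two he hk, h1, add_zero]

theorem padicValNat_card_centralizer_scal3 (he : 0 < e) (hk : Nat.card k = p ^ e) (a : kˣ) :
    padicValNat p (Nat.card (Subgroup.centralizer {scal3 a})) = 3 * e := by
  have h : Subgroup.centralizer {scal3 a} = ⊤ := by
    refine (Subgroup.eq_top_iff' _).2 fun g => Subgroup.mem_centralizer_singleton_iff.2 ?_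
    refine Units.ext ?_
    rw [Units.val_mul, Units.val_mul, scal3_val_eq_smul, mul_smul_comm, smul_mul_assoc, mul_one,
      one_mul]
  rw [h, Subgroup.card_top, padicValNat_card_GL_three he hk]

theorem sum_comp3_eq_sum_tri3 [Fintype k] (he : 0 < e) (hk : Nat.card k = p ^ e) :
    ∑ c, (padicValNat p (Nat.card (Subgroup.centralizer {comp3 (k := k) c})) : ℤ) =
      ∑ x, (padicValNat p (Nat.card (Subgroup.centralizer {tri3 (k := k) x})) : ℤ) := by
  have : CharP k p := charP_of_card_eq_prime_pow (f := e) (by rw [← Nat.card_eq_fintype_card, hk])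
  refine (Fintype.sum_of_injective triCoeff triCoeff_injective _ _ (fun c hc => ?_)
    fun x => ?_).symm
  · rw [padicValNat.eq_zero_of_not_dvd, Nat.cast_zero]
    exact not_dvd_card_centralizer_comp3 fun x hx => hc ⟨x, hx⟩
  · rw [card_centralizer_eq_of_isConj (isConj_tri3_comp3 x)]

theorem sum_ite_eq_diag {α : Type} [Fintype α] [DecidableEq α] (x y : ℤ) :
    ∑ a : α × α, (if a.1 = a.2 then x else y) =
      Fintype.card α * x + Fintype.card α * (Fintype.card α - 1) * y := by
  have h : ∀ a : α, ∑ b : α, (if a = b then x else y) = x + (Fintype.card α - 1) * y := by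
    intro a
    have h1 : ∀ b : α, (if a = b then x else y) = (if a = b then x - y else 0) + y := by
      intro b; split_ifs <;> ring
    rw [Finset.sum_congr rfl fun b _ => h1 b, Finset.sum_add_distrib, Finset.sum_ite_eq,
      if_pos (Finset.mem_univ _), Finset.sum_const, Finset.card_univ, nsmul_eq_mul]
    ring
  rw [Fintype.sum_prod_type, Finset.sum_congr rfl fun a _ => h a, Finset.sum_const,
    Finset.card_univ, nsmul_eq_mul]
  ring

theorem ncard_carrier_ne_zero {G : Type} [Group G] [Finite G] (c : ConjClasses G) :
    c.carrier.ncard ≠ 0 := by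
  obtain ⟨g, rfl⟩ := ConjClasses.exists_rep c
  intro h
  have h1 := ncard_carrier_mul_card_centralizer g
  rw [h, zero_mul] at h1
  exact Nat.card_pos.ne h1

theorem padicValNat_ncard_carrier (he : 0 < e) (hk : Nat.card k = p ^ e) (g : GL (Fin 3) k) :
    (padicValNat p (ConjClasses.mk g).carrier.ncard : ℤ) =
      3 * e - padicValNat p (Nat.card (Subgroup.centralizer {g})) := by
  have h := congrArg (padicValNat p) (ncard_carrier_mul_card_centralizer g)
  rw [padicValNat.mul (ncard_carrier_ne_zero _) Nat.card_pos.ne',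
    padicValNat_card_GL_three he hk] at h
  omega

theorem padicValRat_prod_ncard [Fintype k] (he : 0 < e) (hk : Nat.card k = p ^ e) :
    (∏ᶠ c : ConjClasses (GL (Fin 3) k), (c.carrier.ncard : ℚ)) ≠ 0 ∧
      padicValRat p (∏ᶠ c : ConjClasses (GL (Fin 3) k), (c.carrier.ncard : ℚ)) =
        (e : ℤ) * ((p : ℤ) ^ e - 1) * (3 * ((p : ℤ) ^ e) ^ 2 + (p : ℤ) ^ e - 4) := by
  have hne : ∀ d, (ConjClasses.mk (rep3 (k := k) d)).carrier.ncard ≠ 0 :=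
    fun d => ncard_carrier_ne_zero _
  have hq : (Fintype.card k : ℤ) = (p : ℤ) ^ e := by
    rw [← Nat.card_eq_fintype_card, hk, Nat.cast_pow]
  have hu : (Fintype.card kˣ : ℤ) = (p : ℤ) ^ e - 1 := by
    rw [Fintype.card_units, Nat.cast_sub Fintype.card_pos, hq, Nat.cast_one]
  rw [← finprod_eq_of_bijective (f := fun d => ((ConjClasses.mk (rep3 (k := k) d)).carrier.ncard : ℚ))
    _ rep3_bijective fun _ => rfl, finprod_eq_prod_of_fintype]
  refine ⟨Finset.prod_ne_zero_iff.2 fun d _ => Nat.cast_ne_zero.2 (hne d), ?_⟩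
  rw [padicValRat_prod _ _ fun d _ => hne d,
    Finset.sum_congr rfl fun d _ => padicValNat_ncard_carrier he hk _, Finset.sum_sub_distrib]
  have hsum : ∑ d, (padicValNat p (Nat.card (Subgroup.centralizer {rep3 (k := k) d})) : ℤ) =
      ∑ c, (padicValNat p (Nat.card (Subgroup.centralizer {comp3 (k := k) c})) : ℤ) +
        (∑ x, (padicValNat p (Nat.card (Subgroup.centralizer {quad3 (k := k) x})) : ℤ) +
          ∑ a, (padicValNat p (Nat.card (Subgroup.centralizer {scal3 (k := k) a})) : ℤ)) := by
    rw [Fintype.sum_sum_type, Fintype.sum_sum_type]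
    rfl
  rw [hsum, sum_comp3_eq_sum_tri3 he hk]
  simp only [padicValNat_card_centralizer_tri3 he hk, padicValNat_card_centralizer_quad3 he hk,
    padicValNat_card_centralizer_scal3 he hk, Nat.cast_ite, sum_ite_eq_diag, Finset.sum_const,
    Finset.card_univ, Fintype.card_sum, Fintype.card_prod, nsmul_eq_mul]
  push_cast
  rw [hu, hq]
  ring

end ClassValuation

/-- For `q = p ^ e`, the `p`-adic valuation of `h(GL_3(F_q))` is `e · 3(q - 1)(q² - 2)`. -/
theorem valuation_harada_GL3 (p e : ℕ) (hp : p.Prime) (he : 0 < e)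
    (k : Type) [Field k] [Fintype k] (hk : Fintype.card k = p ^ e) :
    groupH (GL (Fin 3) k) ≠ 0 ∧
      padicValRat p (groupH (GL (Fin 3) k)) =
        (e : ℤ) * (3 * ((p : ℤ) ^ e - 1) * (((p : ℤ) ^ e) ^ 2 - 2)) := by
  classical
  have := Fact.mk hp
  have hk' : Nat.card k = p ^ e := by rw [Nat.card_eq_fintype_card, hk]
  obtain ⟨h1, h2⟩ := padicValRat_prod_ncard he hk'
  obtain ⟨h3, h4⟩ := padicValRat_prod_degrees he hk'
  refine ⟨div_ne_zero h1 h3, ?_⟩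
  rw [groupH, padicValRat.div h1 h3, h2, h4]
  ring
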